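/- Let 𝒜 be a homogeneous constant-coefficient differential operator of order k on ℝ^n, let 1 ≤ j ≤ min{k, n−1} and 1 < p < n/(n−j). Then 𝒜 is elliptic if and only if for every u ∈ BV^𝒜_loc(ℝ^n), D^{k−j}u ∈ t^{j,p}(x) for ℒ^n-almost every x ∈ ℝ^n. -/

import Mathlib

open MeasureTheory Metric Filter
open scoped ENNReal RealInnerProductSpace Topology

noncomputable section

/-- Euclidean space `ℝ^n`. -/
abbrev Euc (n : ℕ) : Type := EuclideanSpace ℝ (Fin n)

/-- The `i`-th standard basis vector of `ℝ^n`. -/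
def stdVec (n : ℕ) (i : Fin n) : Euc n := EuclideanSpace.single i (1 : ℝ)

/-- Coefficients `A_I : V →ₗ W` (indexed by `I : Fin k → Fin n`) of a homogeneous linear
constant-coefficient differential operator `𝒜 u = ∑_I A_I ∂_I u` of order `k` on `ℝ^n`. -/
abbrev CoeffOp (n k : ℕ) (V W : Type*) [NormedAddCommGroup V] [InnerProductSpace ℝ V]
    [NormedAddCommGroup W] [InnerProductSpace ℝ W] : Type _ :=
  (Fin k → Fin n) → (V →ₗ[ℝ] W)

variable {V W F : Type*}
  [NormedAddCommGroup V] [InnerProductSpace ℝ V] [FiniteDimensional ℝ V]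
  [NormedAddCommGroup W] [InnerProductSpace ℝ W] [FiniteDimensional ℝ W]

/-- The coefficients represent a linear map on symmetric tensors `V ⊙^k ℝ^n`. -/
def IsSymmetricOp (n k : ℕ) (A : CoeffOp n k V W) : Prop :=
  ∀ (I : Fin k → Fin n) (σ : Equiv.Perm (Fin k)), A (I ∘ σ) = A I

/-- The symbol `𝒜[ξ] v = A (v ⊗^k ξ) = ∑_I (∏ i, ξ_{I i}) A_I v`. -/
def symbolMap (n k : ℕ) (A : CoeffOp n k V W) (ξ : Euc n) : V →ₗ[ℝ] W :=
  ∑ I : Fin k → Fin n, (∏ i, ξ (I i)) • A I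

/-- Ellipticity: the symbol is injective for all `ξ ≠ 0`. -/
def IsElliptic (n k : ℕ) (A : CoeffOp n k V W) : Prop :=
  ∀ ξ : Euc n, ξ ≠ 0 → Function.Injective (symbolMap n k A ξ)

/-- Van Schaftingen's cancellation condition: `⋂_{ξ ∈ 𝕊^{n-1}} im 𝒜[ξ] = {0}`. -/
def IsCanceling (n k : ℕ) (A : CoeffOp n k V W) : Prop :=
  (⋂ ξ ∈ sphere (0 : Euc n) 1, (LinearMap.range (symbolMap n k A ξ) : Set W)) = {0}

/-- Inverse of an endomorphism (junk value when not invertible), via matrix inversion. -/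
def linInv (f : V →ₗ[ℝ] V) : V →ₗ[ℝ] V :=
  letI b := Module.finBasis ℝ V
  Matrix.toLin b b ((LinearMap.toMatrix b b f)⁻¹)

/-- `𝒜†[ξ] = (𝒜*[ξ] 𝒜[ξ])⁻¹ 𝒜*[ξ]`. -/
def Adagger (n k : ℕ) (A : CoeffOp n k V W) (ξ : Euc n) : W →ₗ[ℝ] V :=
  linInv (LinearMap.adjoint (symbolMap n k A ξ) ∘ₗ symbolMap n k A ξ) ∘ₗ
    LinearMap.adjoint (symbolMap n k A ξ)

/-- Condition (WC): for every `w ∈ ⋂_{ξ ∈ 𝕊^{n-1}} im 𝒜[ξ]`,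
`∫_{𝕊^{n-1}} 𝒜†[ξ] w ⊗^{k-n} ξ dℋ^{n-1}(ξ) = 0`, written componentwise in the
tensor coordinates indexed by `J : Fin (k-n) → Fin n`. -/
def IsWeaklyCanceling (n k : ℕ) (A : CoeffOp n k V W) : Prop :=
  ∀ w : W, (∀ ξ ∈ sphere (0 : Euc n) 1, w ∈ LinearMap.range (symbolMap n k A ξ)) →
    ∀ J : Fin (k - n) → Fin n,
      (∫ ξ in sphere (0 : Euc n) 1,
        (∏ i, ξ (J i)) • (Adagger n k A ξ w) ∂(μH[(n : ℝ) - 1])) = 0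

section TestFun

variable [NormedAddCommGroup F] [NormedSpace ℝ F]

/-- Compactly supported smooth test function. -/
def IsTestFun (n : ℕ) (φ : Euc n → F) : Prop :=
  ContDiff ℝ (⊤ : ℕ∞) φ ∧ HasCompactSupport φ

/-- Iterated directional derivative `∂_{I 0} ⋯ ∂_{I (m-1)} φ (x)`. -/
def dirDeriv (n m : ℕ) (I : Fin m → Fin n) (φ : Euc n → F) (x : Euc n) : F :=
  iteratedFDeriv ℝ m φ x (fun i => stdVec n (I i))

/-- Smooth functions of degree-`≤ j` polynomial type. -/
def IsPolyDeg (n : ℕ) (j : ℕ) (P : Euc n → F) : Prop :=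
  ContDiff ℝ (⊤ : ℕ∞) P ∧ ∀ x, iteratedFDeriv ℝ (j + 1) P x = 0

end TestFun

/-- Pointwise application of the operator `𝒜` to a smooth map. -/
def Aapply (n k : ℕ) (A : CoeffOp n k V W) (u : Euc n → V) (x : Euc n) : W :=
  ∑ I : Fin k → Fin n, A I (dirDeriv n k I u x)

/-- `𝒜 u = f σ` (a `W`-valued measure with total-variation measure `σ` and polar density `f`)
in the sense of distributions. -/
def HasDistribA (n k : ℕ) (A : CoeffOp n k V W) (u : Euc n → V) (σ : Measure (Euc n))
    (f : Euc n → W) : Prop :=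
  ∀ φ : Euc n → W, IsTestFun n φ →
    ((-1 : ℝ) ^ k) * (∑ I : Fin k → Fin n,
        ∫ x, ⟪u x, LinearMap.adjoint (A I) (dirDeriv n k I φ x)⟫) =
      ∫ x, ⟪f x, φ x⟫ ∂σ

/-- `u ∈ BV^𝒜_loc(ℝ^n)`: `u` is locally integrable and `𝒜 u` is a `W`-valued Radon measure,
given by its polar decomposition `f σ` with `σ` locally finite and `‖f‖ = 1` σ-a.e. -/
def MemBVAloc (n k : ℕ) (A : CoeffOp n k V W) (u : Euc n → V) : Prop :=
  LocallyIntegrable u volume ∧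
    ∃ (σ : Measure (Euc n)) (f : Euc n → W), IsLocallyFiniteMeasure σ ∧
      LocallyIntegrable f σ ∧ (∀ᵐ x ∂σ, ‖f x‖ = 1) ∧ HasDistribA n k A u σ f

/-- `v` is the family of weak derivatives of order `m` of `u` (componentwise, indexed by
`I : Fin m → Fin n`). -/
def IsWeakDerivFamily (n m : ℕ) (u : Euc n → V) (v : (Fin m → Fin n) → Euc n → V) : Prop :=
  (∀ I, LocallyIntegrable (v I) volume) ∧
    ∀ (I : Fin m → Fin n) (φ : Euc n → ℝ), IsTestFun n φ →
      ∫ x, (dirDeriv n m I φ x) • u x = ((-1 : ℝ) ^ m) • ∫ x, φ x • v I x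

/-- `Q r = o(r^a)` as `r ↓ 0`. -/
def SmallO (Q : ℝ → ℝ≥0∞) (a : ℝ) : Prop :=
  Tendsto (fun r => Q r / ENNReal.ofReal (r ^ a)) (𝓝[>] (0 : ℝ)) (𝓝 0)

section Spaces

variable [NormedAddCommGroup F] [NormedSpace ℝ F]

/-- `f ∈ t^{j,p}(x)`: there is a polynomial `P` of degree at most `j` with
`(⨍_{B_r(x)} |f - P|^p)^{1/p} = o(r^j)` as `r ↓ 0`. -/
def MemT (n : ℕ) (j : ℕ) (p : ℝ) (f : Euc n → F) (x : Euc n) : Prop :=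
  ∃ P : Euc n → F, IsPolyDeg n j P ∧
    SmallO (fun r => ((volume (ball x r))⁻¹ *
      ∫⁻ y in ball x r, (‖f y - P y‖₊ : ℝ≥0∞) ^ p) ^ (1 / p)) (j : ℝ)

/-- `f ∈ t^{j,∞}(x)`: there is a polynomial `P` of degree at most `j` with
`‖f - P‖_{L^∞(B_r(x))} = o(r^j)` as `r ↓ 0`. -/
def MemTInf (n : ℕ) (j : ℕ) (f : Euc n → F) (x : Euc n) : Prop :=
  ∃ P : Euc n → F, IsPolyDeg n j P ∧
    SmallO (fun r => essSup (fun y => (‖f y - P y‖₊ : ℝ≥0∞))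
      (volume.restrict (ball x r))) (j : ℝ)

/-- The Lorentz `L^{p,q}` quasi-norm (for `p, q < ∞`). -/
def lorentzNorm {α : Type*} [MeasurableSpace α] (p q : ℝ) (μ : Measure α) (f : α → F) : ℝ≥0∞ :=
  ENNReal.ofReal p ^ (1 / q) *
    (∫⁻ t in Set.Ioi (0 : ℝ),
      (ENNReal.ofReal t * (μ {x | t < ‖f x‖}) ^ (1 / p)) ^ q * (ENNReal.ofReal t)⁻¹) ^ (1 / q)

/-- `f` is `L^{p,q}`-differentiable of order `j` at `x`:
`‖f - P‖_{L^{p,q}(B_r(x))} = o(r^{j + n/p})` for a polynomial `P` of degree at most `j`. -/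
def MemTLorentz (n : ℕ) (j : ℕ) (p q : ℝ) (f : Euc n → F) (x : Euc n) : Prop :=
  ∃ P : Euc n → F, IsPolyDeg n j P ∧
    SmallO (fun r => lorentzNorm p q (volume.restrict (ball x r)) (fun y => f y - P y))
      ((j : ℝ) + n / p)

/-- `f ∈ L^p_loc`. -/
def LocLp (n : ℕ) (p : ℝ) (f : Euc n → F) : Prop :=
  ∀ K : Set (Euc n), IsCompact K → ∫⁻ x in K, (‖f x‖₊ : ℝ≥0∞) ^ p < ⊤

end Spaces

end

section PolyDeg

variable {n : ℕ} {F G : Type*} [NormedAddCommGroup F] [NormedSpace ℝ F]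
  [NormedAddCommGroup G] [NormedSpace ℝ G]

theorem iteratedFDeriv_eq_zero_of_le {f : Euc n → F} {a b : ℕ} (hab : a ≤ b)
    (h : ∀ x, iteratedFDeriv ℝ a f x = 0) : ∀ x, iteratedFDeriv ℝ b f x = 0 := by
  induction b, hab using Nat.le_induction with
  | base => exact h
  | succ m _ ih =>
    intro x
    have h0 : iteratedFDeriv ℝ m f = 0 := funext ih
    ext v
    rw [iteratedFDeriv_succ_apply_left, h0, fderiv_zero]
    rfl

theorem IsPolyDeg.mono {P : Euc n → F} {i j : ℕ} (h : IsPolyDeg n i P) (hij : i ≤ j) :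
    IsPolyDeg n j P :=
  ⟨h.1, iteratedFDeriv_eq_zero_of_le (Nat.succ_le_succ hij) h.2⟩

theorem isPolyDeg_const (j : ℕ) (c : F) : IsPolyDeg n j (fun _ => c) :=
  ⟨contDiff_const, fun x => by rw [iteratedFDeriv_succ_const]; rfl⟩

theorem IsPolyDeg.add {P Q : Euc n → F} {j : ℕ} (hP : IsPolyDeg n j P) (hQ : IsPolyDeg n j Q) :
    IsPolyDeg n j (fun x => P x + Q x) := by
  refine ⟨hP.1.add hQ.1, fun x => ?_⟩
  have := iteratedFDeriv_add_apply (𝕜 := ℝ) (i := j + 1) (x := x)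
    (hP.1.of_le (mod_cast le_top)).contDiffAt (hQ.1.of_le (mod_cast le_top)).contDiffAt
  rw [show (fun x => P x + Q x) = P + Q from rfl, this, hP.2, hQ.2, add_zero]

theorem IsPolyDeg.sum {ι : Type*} (s : Finset ι) {P : ι → Euc n → F} {j : ℕ}
    (hP : ∀ i ∈ s, IsPolyDeg n j (P i)) : IsPolyDeg n j (fun x => ∑ i ∈ s, P i x) := by
  classical
  induction s using Finset.induction_on with
  | empty => simpa using isPolyDeg_const (n := n) j (0 : F)
  | insert a s ha ih =>
    simp only [Finset.sum_insert ha]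
    exact (hP a (by simp)).add (ih fun i hi => hP i (by simp [hi]))

theorem IsPolyDeg.clm {P : Euc n → F} {j : ℕ} (hP : IsPolyDeg n j P) (L : F →L[ℝ] G) :
    IsPolyDeg n j (fun x => L (P x)) := by
  refine ⟨L.contDiff.comp hP.1, fun x => ?_⟩
  have := L.iteratedFDeriv_comp_left (n := ((j + 1 : ℕ) : ℕ∞)) (i := j + 1) (x := x)
    ((hP.1.of_le (mod_cast le_top)).contDiffAt) (by simp)
  rw [show (fun x => L (P x)) = L ∘ P from rfl, this, hP.2]
  ext; simp

theorem isPolyDeg_coord (x₀ : Euc n) (a : Fin n) : IsPolyDeg n 1 (fun y : Euc n => (y - x₀) a) := by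
  have hd : ∀ y, HasFDerivAt (fun y : Euc n => (y - x₀) a)
      (EuclideanSpace.proj a : Euc n →L[ℝ] ℝ) y := fun y => by
    exact ((EuclideanSpace.proj a : Euc n →L[ℝ] ℝ).hasFDerivAt (x := y - x₀)).comp y
      ((hasFDerivAt_id y).sub_const x₀)
  refine ⟨?_, fun x => ?_⟩
  · exact (EuclideanSpace.proj a : Euc n →L[ℝ] ℝ).contDiff.comp (contDiff_id.sub contDiff_const)
  · rw [← norm_eq_zero, ← norm_iteratedFDeriv_fderiv,
      show fderiv ℝ (fun y : Euc n => (y - x₀) a) = fun _ => (EuclideanSpace.proj a : Euc n →L[ℝ] ℝ)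
        from funext fun y => (hd y).fderiv, iteratedFDeriv_succ_const]
    simp

theorem IsPolyDeg.coord_smul {P : Euc n → F} {j : ℕ} (hP : IsPolyDeg n j P) (x₀ : Euc n)
    (a : Fin n) : IsPolyDeg n (j + 1) (fun y => (y - x₀) a • P y) := by
  have hc := isPolyDeg_coord x₀ a
  refine ⟨hc.1.smul hP.1, fun x => ?_⟩
  rw [← norm_le_zero_iff]
  have := (ContinuousLinearMap.lsmul ℝ ℝ : ℝ →L[ℝ] F →L[ℝ] F).norm_iteratedFDeriv_le_of_bilinear
    (N := (⊤ : ℕ∞)) (n := j + 1 + 1) hc.1 hP.1 x (by exact_mod_cast le_top)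
  refine this.trans (le_of_eq ?_)
  rw [Finset.sum_eq_zero, mul_zero]
  intro i _
  rcases le_or_gt 2 i with h2 | h2
  · rw [iteratedFDeriv_eq_zero_of_le h2 hc.2 x]; simp
  · rw [iteratedFDeriv_eq_zero_of_le (b := j + 1 + 1 - i) (by omega) hP.2 x]; simp

theorem eq_sum_stdVec (z : Euc n) : z = ∑ a, z a • stdVec n a := by
  ext b
  simp [stdVec, Finset.sum_apply, Pi.single_apply]

theorem isPolyDeg_multilinear (x₀ : Euc n) (i : ℕ) (M : ContinuousMultilinearMap ℝ
    (fun _ : Fin i => Euc n) F) : IsPolyDeg n i (fun y => M (fun _ => y - x₀)) := by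
  induction i with
  | zero =>
    have : (fun y => M (fun _ => y - x₀)) = fun _ => M 0 := by
      funext y; congr 1; exact Subsingleton.elim _ _
    rw [this]; exact isPolyDeg_const _ _
  | succ i ih =>
    have : (fun y => M (fun _ => y - x₀)) =
        fun y => ∑ a, (y - x₀) a • (M.curryLeft (stdVec n a)) (fun _ => y - x₀) := by
      funext y
      have h1 : M (fun _ => y - x₀) = M.curryLeft (y - x₀) (fun _ => y - x₀) := by
        rw [ContinuousMultilinearMap.curryLeft_apply]
        congr 1
        funext s
        refine Fin.cases ?_ (fun s => ?_) s <;> simp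
      rw [h1]
      conv_lhs => rw [eq_sum_stdVec (y - x₀)]
      rw [map_sum]
      simp only [sum_apply, map_smul, smul_apply]
      refine Finset.sum_congr rfl fun a _ => ?_
      rw [← eq_sum_stdVec (y - x₀)]
    rw [this]
    exact IsPolyDeg.sum _ fun a _ => (ih _).coord_smul x₀ a

/-- The Taylor polynomial of degree `j`. -/
noncomputable def taylorPoly (j : ℕ) (f : Euc n → F) (x₀ y : Euc n) : F :=
  ∑ i ∈ Finset.range (j + 1),
    ((i.factorial : ℝ)⁻¹) • iteratedFDeriv ℝ i f x₀ (fun _ => y - x₀)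

theorem isPolyDeg_taylorPoly (j : ℕ) (f : Euc n → F) (x₀ : Euc n) :
    IsPolyDeg n j (taylorPoly j f x₀) := by
  refine IsPolyDeg.sum _ fun i hi => ?_
  refine ((isPolyDeg_multilinear x₀ i
    ((i.factorial : ℝ)⁻¹ • iteratedFDeriv ℝ i f x₀)).mono ?_)
  have := Finset.mem_range.1 hi
  omega

theorem norm_sub_taylor_le [CompleteSpace F] {f : Euc n → F} (hf : ContDiff ℝ (⊤ : ℕ∞) f) (j : ℕ)
    (x z : Euc n)
    {C : ℝ} (hC : ∀ t ∈ Set.Icc (0 : ℝ) 1, ‖iteratedFDeriv ℝ (j + 1) f (x + t • z)‖ ≤ C) :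
    ‖f (x + z) - ∑ i ∈ Finset.range (j + 1),
      ((i.factorial : ℝ)⁻¹) • iteratedFDeriv ℝ i f x (fun _ => z)‖ ≤ C * ‖z‖ ^ (j + 1) := by
  have hT := map_add_eq_sum_add_integral_iteratedFDeriv (f := f) (x := x) (y := z) (n := j)
    (by intro t _; exact (hf.of_le (by exact_mod_cast le_top)).contDiffAt)
  rw [hT, add_sub_cancel_left, norm_smul]
  have hC0 : 0 ≤ C := (norm_nonneg _).trans (hC 0 (by simp))
  have h2 : ‖∫ t in (0 : ℝ)..1, (1 - t) ^ j • iteratedFDeriv ℝ (j + 1) f (x + t • z) (fun _ => z)‖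
      ≤ C * ‖z‖ ^ (j + 1) * |1 - 0| := by
    apply intervalIntegral.norm_integral_le_of_norm_le_const
    intro t ht
    rw [Set.uIoc_of_le zero_le_one] at ht
    have ht' : t ∈ Set.Icc (0 : ℝ) 1 := ⟨ht.1.le, ht.2⟩
    rw [norm_smul]
    have h3 : ‖(1 - t) ^ j‖ ≤ 1 := by
      rw [norm_pow, Real.norm_eq_abs, abs_of_nonneg (by linarith [ht.2])]
      exact pow_le_one₀ (by linarith [ht.2]) (by linarith [ht.1])
    have h4 : ‖iteratedFDeriv ℝ (j + 1) f (x + t • z) (fun _ => z)‖ ≤ C * ‖z‖ ^ (j + 1) := by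
      refine (ContinuousMultilinearMap.le_opNorm _ _).trans ?_
      rw [Finset.prod_const, Finset.card_univ, Fintype.card_fin]
      gcongr
      exact hC t ht'
    calc _ ≤ 1 * (C * ‖z‖ ^ (j + 1)) := by gcongr
      _ = _ := one_mul _
  have h5 : ‖((j.factorial : ℝ)⁻¹)‖ ≤ 1 := by
    rw [norm_inv, Real.norm_natCast]
    exact inv_le_one_of_one_le₀ (by
      exact_mod_cast Nat.one_le_iff_ne_zero.2 (Nat.factorial_ne_zero j))
  simp only [sub_zero, abs_one, mul_one] at h2
  calc _ ≤ 1 * (C * ‖z‖ ^ (j + 1)) := by gcongr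
    _ = _ := one_mul _

end PolyDeg

section MemT

variable {n : ℕ} {F G : Type*} [NormedAddCommGroup F] [NormedSpace ℝ F]
  [NormedAddCommGroup G] [NormedSpace ℝ G]

/-- The normalised restriction of Lebesgue measure to the ball `B_r(x)`. -/
noncomputable def ballAvg (x : Euc n) (r : ℝ) : Measure (Euc n) :=
  (volume (ball x r))⁻¹ • volume.restrict (ball x r)

theorem memT_iff {j : ℕ} {p : ℝ} {f : Euc n → F} {x : Euc n} :
    MemT n j p f x ↔ ∃ P : Euc n → F, IsPolyDeg n j P ∧
      SmallO (fun r => eLpNorm' (fun y => f y - P y) p (ballAvg x r)) (j : ℝ) := by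
  simp only [MemT, eLpNorm', ballAvg, lintegral_smul_measure, smul_eq_mul]
  rfl

theorem SmallO.add {Q R : ℝ → ℝ≥0∞} {a : ℝ} (hQ : SmallO Q a) (hR : SmallO R a) :
    SmallO (fun r => Q r + R r) a := by
  have := Tendsto.add hQ hR
  simp only [SmallO, ENNReal.add_div]
  simpa using this

theorem SmallO.mono {Q R : ℝ → ℝ≥0∞} {a : ℝ} (hR : SmallO R a)
    (h : ∀ᶠ r in 𝓝[>] (0 : ℝ), Q r ≤ R r) : SmallO Q a := by
  refine tendsto_of_tendsto_of_tendsto_of_le_of_le' tendsto_const_nhds hR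
    (Eventually.of_forall fun _ => zero_le) ?_
  filter_upwards [h] with r hr
  gcongr

theorem SmallO.const_mul {Q : ℝ → ℝ≥0∞} {a : ℝ} (hQ : SmallO Q a) {c : ℝ≥0∞} (hc : c ≠ ⊤) :
    SmallO (fun r => c * Q r) a := by
  have := ENNReal.Tendsto.const_mul (a := c) hQ (Or.inr hc)
  simp only [SmallO, mul_div_assoc]
  simpa using this

theorem SmallO.ofReal_mul {ε : ℝ → ℝ} {a : ℝ} (hε : Tendsto ε (𝓝[>] 0) (𝓝 0)) :
    SmallO (fun r => ENNReal.ofReal (ε r * r ^ a)) a := by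
  have h1 : Tendsto (fun r => ENNReal.ofReal (ε r)) (𝓝[>] 0) (𝓝 0) := by
    simpa using ENNReal.tendsto_ofReal hε
  refine h1.congr' ?_
  filter_upwards [self_mem_nhdsWithin] with r hr
  have : (0 : ℝ) < r ^ a := Real.rpow_pos_of_pos hr _
  rw [← ENNReal.ofReal_div_of_pos this, mul_div_assoc, div_self this.ne', mul_one]

theorem SmallO.ofReal_pow_succ (C : ℝ) (j : ℕ) :
    SmallO (fun r => ENNReal.ofReal (C * r ^ (j + 1))) (j : ℝ) := by
  have h1 : Tendsto (fun r : ℝ => C * r) (𝓝[>] 0) (𝓝 0) := by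
    have : Tendsto (fun r : ℝ => C * r) (𝓝 0) (𝓝 (C * 0)) := tendsto_id.const_mul C
    rw [mul_zero] at this
    exact this.mono_left nhdsWithin_le_nhds
  refine (SmallO.ofReal_mul (a := j) h1).mono (Eventually.of_forall fun r => le_of_eq ?_)
  rw [Real.rpow_natCast]; ring_nf

theorem ballAvg_ac (x : Euc n) (r : ℝ) : ballAvg x r ≪ volume :=
  (Measure.smul_absolutelyContinuous).trans Measure.restrict_le_self.absolutelyContinuous

theorem ballAvg_ac_restrict (x : Euc n) (r : ℝ) :
    ballAvg x r ≪ volume.restrict (ball x r) :=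
  Measure.smul_absolutelyContinuous

theorem ballAvg_univ_le (x : Euc n) (r : ℝ) : ballAvg x r Set.univ ≤ 1 := by
  simp only [ballAvg, Measure.smul_apply, Measure.restrict_apply_univ, smul_eq_mul]
  exact ENNReal.inv_mul_le_one _

theorem eLpNorm'_ballAvg_le {E : Type*} [NormedAddCommGroup E] {p : ℝ} (hp : 0 < p) {f : Euc n → E}
    {x : Euc n} {r : ℝ} {C : ℝ≥0∞}
    (h : ∀ᵐ y ∂volume.restrict (ball x r), ‖f y‖ₑ ≤ C) : eLpNorm' f p (ballAvg x r) ≤ C := by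
  have h' : ∀ᵐ y ∂ballAvg x r, ‖f y‖ₑ ^ p ≤ C ^ p := by
    filter_upwards [(ballAvg_ac_restrict x r).ae_le h] with y hy
    gcongr
  calc eLpNorm' f p (ballAvg x r) ≤ (∫⁻ _, C ^ p ∂(ballAvg x r)) ^ (1 / p) := by
        unfold eLpNorm'
        gcongr ?_ ^ _
        exact lintegral_mono_ae h'
    _ ≤ (C ^ p) ^ (1 / p) := by
        gcongr
        rw [lintegral_const]
        exact mul_le_of_le_one_right (zero_le) (ballAvg_univ_le x r)
    _ = C := by
        rw [← ENNReal.rpow_mul, mul_one_div_cancel hp.ne', ENNReal.rpow_one]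

theorem MemT.congr {j : ℕ} {p : ℝ} {f g : Euc n → F} {x : Euc n} (hf : MemT n j p f x)
    {R : ℝ} (hR : 0 < R) (h : ∀ᵐ y ∂volume.restrict (ball x R), f y = g y) :
    MemT n j p g x := by
  rw [memT_iff] at hf ⊢
  obtain ⟨P, hP, hs⟩ := hf
  refine ⟨P, hP, hs.mono ?_⟩
  filter_upwards [Ioo_mem_nhdsGT hR] with r hr
  refine le_of_eq (eLpNorm'_congr_ae ?_)
  have : ∀ᵐ y ∂volume.restrict (ball x r), f y = g y :=
    ae_mono (Measure.restrict_mono (ball_subset_ball hr.2.le) le_rfl) h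
  filter_upwards [(ballAvg_ac_restrict x r).ae_le this] with y hy
  rw [hy]

theorem MemT.add {j : ℕ} {p : ℝ} (hp : 1 ≤ p) {f g : Euc n → F} {x : Euc n}
    (hf : MemT n j p f x) (hg : MemT n j p g x)
    (hfm : AEStronglyMeasurable f volume) (hgm : AEStronglyMeasurable g volume) :
    MemT n j p (fun y => f y + g y) x := by
  rw [memT_iff] at hf hg ⊢
  obtain ⟨P, hP, hs⟩ := hf
  obtain ⟨Q, hQ, ht⟩ := hg
  refine ⟨_, hP.add hQ, (hs.add ht).mono (Eventually.of_forall fun r => ?_)⟩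
  have := eLpNorm'_add_le (f := fun y => f y - P y) (g := fun y => g y - Q y) (μ := ballAvg x r)
    ((hfm.sub hP.1.continuous.aestronglyMeasurable).mono_ac (ballAvg_ac x r))
    ((hgm.sub hQ.1.continuous.aestronglyMeasurable).mono_ac (ballAvg_ac x r)) hp
  refine le_trans (le_of_eq ?_) this
  congr 1
  funext y
  simp only [Pi.add_apply]
  abel

theorem MemT.clm {j : ℕ} {p : ℝ} (hp : 0 < p) {f : Euc n → F} {x : Euc n} (hf : MemT n j p f x)
    (L : F →L[ℝ] G) : MemT n j p (fun y => L (f y)) x := by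
  rw [memT_iff] at hf ⊢
  obtain ⟨P, hP, hs⟩ := hf
  refine ⟨_, hP.clm L, (hs.const_mul (c := ‖L‖ₑ) enorm_ne_top).mono
    (Eventually.of_forall fun r => ?_)⟩
  rw [← ENNReal.rpow_one (‖L‖ₑ), ← mul_one_div_cancel hp.ne', ENNReal.rpow_mul]
  unfold eLpNorm'
  rw [← ENNReal.mul_rpow_of_nonneg _ _ (by positivity), ← lintegral_const_mul']
  · gcongr with y
    rw [← ENNReal.mul_rpow_of_nonneg _ _ hp.le]
    gcongr
    beta_reduce
    rw [← map_sub]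
    exact L.le_opENorm _
  · exact ENNReal.rpow_ne_top_of_nonneg hp.le enorm_ne_top

theorem ContDiff.memT [CompleteSpace F] {j : ℕ} {p : ℝ} (hp : 0 < p) {f : Euc n → F}
    (hf : ContDiff ℝ (⊤ : ℕ∞) f) (x : Euc n) : MemT n j p f x := by
  rw [memT_iff]
  have hc : Continuous (iteratedFDeriv ℝ (j + 1) f) :=
    hf.continuous_iteratedFDeriv (by exact_mod_cast le_top)
  obtain ⟨C, hC⟩ := (isCompact_closedBall x 1).exists_bound_of_continuousOn hc.continuousOn
  refine ⟨taylorPoly j f x, isPolyDeg_taylorPoly j f x,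
    (SmallO.ofReal_pow_succ C j).mono ?_⟩
  filter_upwards [Ioo_mem_nhdsGT (zero_lt_one (α := ℝ))] with r hr
  refine eLpNorm'_ballAvg_le hp ?_
  refine (ae_restrict_iff' measurableSet_ball).2 (Eventually.of_forall fun y hy => ?_)
  rw [mem_ball, dist_eq_norm] at hy
  have h1 := norm_sub_taylor_le hf j x (y - x) (C := C) (fun t ht => hC _ (by
    rw [mem_closedBall, dist_eq_norm, add_sub_cancel_left, norm_smul, Real.norm_eq_abs,
      abs_of_nonneg ht.1]
    calc t * ‖y - x‖ ≤ 1 * 1 := by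
          gcongr
          · exact ht.2
          · linarith [hr.2]
      _ = 1 := one_mul _))
  rw [add_sub_cancel] at h1
  rw [← ofReal_norm]
  refine ENNReal.ofReal_le_ofReal (h1.trans ?_)
  have hC0 : 0 ≤ C := (norm_nonneg _).trans (hC x (mem_closedBall_self zero_le_one))
  gcongr

theorem MemT.sum {ι : Type*} (s : Finset ι) {j : ℕ} {p : ℝ} (hp : 1 ≤ p)
    [CompleteSpace F] {f : ι → Euc n → F} {x : Euc n}
    (hf : ∀ i ∈ s, MemT n j p (f i) x) (hfm : ∀ i ∈ s, AEStronglyMeasurable (f i) volume) :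
    MemT n j p (fun y => ∑ i ∈ s, f i y) x := by
  classical
  induction s using Finset.induction_on with
  | empty => simpa using (contDiff_const (c := (0 : F))).memT (by linarith) x
  | insert a s ha ih =>
    simp only [Finset.sum_insert ha]
    refine (hf a (by simp)).add hp (ih (fun i hi => hf i (by simp [hi]))
      (fun i hi => hfm i (by simp [hi]))) (hfm a (by simp)) ?_
    exact Finset.aestronglyMeasurable_fun_sum _ fun i hi => hfm i (by simp [hi])

end MemT

section Decay

variable {n : ℕ}

/-- The `L¹`-normalised decaying bump at scale `2⁻ˡ`. -/
noncomputable def decayWt (n l : ℕ) (z : Euc n) : ℝ :=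
  (2 : ℝ) ^ (l * n) * ((1 + 2 ^ l * ‖z‖) ^ (n + 1))⁻¹

theorem decayWt_nonneg (l : ℕ) (z : Euc n) : 0 ≤ decayWt n l z := by
  unfold decayWt; positivity

theorem continuous_decayWt (l : ℕ) : Continuous (decayWt n l) := by
  unfold decayWt
  refine continuous_const.mul (Continuous.inv₀ (by fun_prop) fun z => ?_)
  positivity

theorem decayWt_neg (l : ℕ) (z : Euc n) : decayWt n l (-z) = decayWt n l z := by
  simp [decayWt]

/-- The integral of the decaying bump centred at `x₀`. -/
noncomputable def decayInt (τ : Measure (Euc n)) (x₀ : Euc n) (l : ℕ) : ℝ≥0∞ :=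
  ∫⁻ x, ENNReal.ofReal (decayWt n l (x - x₀)) ∂τ

/-- `τ` has vanishing `n`-density at `x₀` and at most `n`-dimensional growth. -/
structure ZeroDensity (τ : Measure (Euc n)) (x₀ : Euc n) : Prop where
  growth : ∃ Q : ℝ≥0∞, Q ≠ ⊤ ∧ ∀ r : ℝ, 0 < r → τ (ball x₀ r) ≤ Q * ENNReal.ofReal (r ^ n)
  tendsto : Tendsto (fun r : ℝ => τ (ball x₀ r) / ENNReal.ofReal (r ^ n)) (𝓝[>] 0) (𝓝 0)

theorem ZeroDensity.add {τ τ' : Measure (Euc n)} {x₀ : Euc n} (h : ZeroDensity τ x₀)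
    (h' : ZeroDensity τ' x₀) : ZeroDensity (τ + τ') x₀ := by
  obtain ⟨Q, hQ, hQ'⟩ := h.growth
  obtain ⟨R, hR, hR'⟩ := h'.growth
  refine ⟨⟨Q + R, ENNReal.add_ne_top.2 ⟨hQ, hR⟩, fun r hr => ?_⟩, ?_⟩
  · rw [add_mul, Measure.add_apply]; exact add_le_add (hQ' r hr) (hR' r hr)
  · simpa [ENNReal.add_div] using h.tendsto.add h'.tendsto

theorem decay_le_tsum_shells (N : ℕ) (t : ℝ) (ht : 0 ≤ t) :
    ENNReal.ofReal (((1 + t) ^ N)⁻¹) ≤ ∑' m : ℕ, ENNReal.ofReal (2 ^ N * ((2 : ℝ) ^ (m * N))⁻¹) *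
      (Set.Iio ((2 : ℝ) ^ m)).indicator 1 t := by
  have hex : ∃ m : ℕ, t < 2 ^ m := pow_unbounded_of_one_lt t one_lt_two
  classical
  refine le_trans ?_ (ENNReal.le_tsum (Nat.find hex))
  rw [Set.indicator_of_mem (by exact Nat.find_spec hex), Pi.one_apply, mul_one]
  refine ENNReal.ofReal_le_ofReal ?_
  rw [pow_mul, ← inv_pow, ← inv_pow, ← mul_pow]
  refine pow_le_pow_left₀ (by positivity) ?_ N
  rcases Nat.eq_zero_or_pos (Nat.find hex) with h0 | h0
  · rw [h0]
    have : (1 + t)⁻¹ ≤ 1 := inv_le_one_of_one_le₀ (by linarith)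
    norm_num; linarith
  · obtain ⟨m, hm⟩ := Nat.exists_eq_succ_of_ne_zero h0.ne'
    have h1 : ¬ t < 2 ^ m := Nat.find_min hex (by omega)
    rw [hm, Nat.succ_eq_add_one, pow_succ, mul_inv, mul_comm, mul_assoc,
      inv_mul_cancel₀ two_ne_zero, mul_one]
    exact inv_anti₀ (by positivity) (by linarith [not_lt.1 h1])

theorem decayInt_le_tsum (τ : Measure (Euc n)) (x₀ : Euc n) (l : ℕ) :
    decayInt τ x₀ l ≤ ∑' m : ℕ, ENNReal.ofReal (2 ^ (n + 1) * (2⁻¹) ^ m) *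
      (τ (ball x₀ (2 ^ m * (2 ^ l)⁻¹)) / ENNReal.ofReal ((2 ^ m * (2 ^ l)⁻¹ : ℝ) ^ n)) := by
  calc decayInt τ x₀ l
      ≤ ∫⁻ x, ∑' m : ℕ, ENNReal.ofReal (2 ^ (l * n)) *
          (ENNReal.ofReal (2 ^ (n + 1) * ((2 : ℝ) ^ (m * (n + 1)))⁻¹) *
            (ball x₀ (2 ^ m * (2 ^ l)⁻¹)).indicator 1 x) ∂τ := by
        refine lintegral_mono fun x => ?_
        rw [ENNReal.tsum_mul_left, decayWt, ENNReal.ofReal_mul (by positivity)]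
        gcongr
        refine (decay_le_tsum_shells (n + 1) (2 ^ l * ‖x - x₀‖) (by positivity)).trans
          (le_of_eq ?_)
        refine tsum_congr fun m => ?_
        congr 1
        have : 2 ^ l * ‖x - x₀‖ ∈ Set.Iio ((2 : ℝ) ^ m) ↔ x ∈ ball x₀ (2 ^ m * (2 ^ l)⁻¹) := by
          rw [mem_ball, dist_eq_norm, Set.mem_Iio, ← div_eq_mul_inv, lt_div_iff₀ (by positivity),
            mul_comm]
        by_cases h : x ∈ ball x₀ (2 ^ m * (2 ^ l)⁻¹)
        · rw [Set.indicator_of_mem h, Set.indicator_of_mem (this.2 h)]; rfl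
        · rw [Set.indicator_of_notMem h, Set.indicator_of_notMem (fun h' => h (this.1 h'))]
    _ = _ := by
        rw [lintegral_tsum]
        · refine tsum_congr fun m => ?_
          rw [lintegral_const_mul, lintegral_const_mul, lintegral_indicator_one measurableSet_ball]
          · rw [ENNReal.div_eq_inv_mul, ← mul_assoc, ← mul_assoc,
              ← ENNReal.ofReal_inv_of_pos (by positivity), ← ENNReal.ofReal_mul (by positivity),
              ← ENNReal.ofReal_mul (by positivity)]
            congr 2
            rw [mul_pow, pow_mul, pow_mul, inv_pow, inv_pow, mul_inv, inv_inv, pow_succ (2 ^ m)]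
            field_simp
          · exact measurable_one.indicator measurableSet_ball
          · exact (measurable_one.indicator measurableSet_ball).const_mul _
        · intro m
          exact (((measurable_one.indicator measurableSet_ball).const_mul _).const_mul
            _).aemeasurable

theorem ENNReal.tendsto_tsum_of_dominated_convergence' {f : ℕ → ℕ → ℝ≥0∞} (b : ℕ → ℝ≥0∞)
    (hb : ∑' m, b m ≠ ⊤) (hle : ∀ l m, f l m ≤ b m) (hlim : ∀ m, Tendsto (fun l => f l m) atTop
      (𝓝 0)) :
    Tendsto (fun l => ∑' m, f l m) atTop (𝓝 0) := by
  have := tendsto_lintegral_of_dominated_convergence (μ := Measure.count) (F := f) (f := fun _ => 0)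
    b (fun l => measurable_of_countable _) (fun l => Eventually.of_forall (hle l))
    (by rwa [lintegral_count]) (Eventually.of_forall hlim)
  simpa [lintegral_count] using this

theorem tsum_ofReal_shell_ne_top (n : ℕ) {Q : ℝ≥0∞} (hQ : Q ≠ ⊤) :
    ∑' m : ℕ, ENNReal.ofReal (2 ^ (n + 1) * (2⁻¹) ^ m) * Q ≠ ⊤ := by
  rw [ENNReal.tsum_mul_right]
  refine ENNReal.mul_ne_top ?_ hQ
  exact ((summable_geometric_of_lt_one (by norm_num) (by norm_num)).mul_left _).tsum_ofReal_ne_top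

theorem ZeroDensity.tendsto_decayInt {τ : Measure (Euc n)} {x₀ : Euc n} (h : ZeroDensity τ x₀) :
    Tendsto (decayInt τ x₀) atTop (𝓝 0) := by
  obtain ⟨Q, hQ, hQ'⟩ := h.growth
  refine tendsto_of_tendsto_of_tendsto_of_le_of_le tendsto_const_nhds ?_
    (fun _ => zero_le) (fun l => decayInt_le_tsum τ x₀ l)
  refine ENNReal.tendsto_tsum_of_dominated_convergence' _ (tsum_ofReal_shell_ne_top n hQ) ?_ ?_
  · intro l m
    gcongr
    refine ENNReal.div_le_of_le_mul (hQ' _ (by positivity))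
  · intro m
    have h1 : Tendsto (fun l : ℕ => (2 : ℝ) ^ m * (2 ^ l)⁻¹) atTop (𝓝[>] 0) := by
      refine tendsto_nhdsWithin_iff.2 ⟨?_, Eventually.of_forall fun l => by simp⟩
      have : Tendsto (fun l : ℕ => (2 : ℝ) ^ m * (2⁻¹) ^ l) atTop (𝓝 (2 ^ m * 0)) :=
        (tendsto_pow_atTop_nhds_zero_of_lt_one (by norm_num) (by norm_num)).const_mul _
      simpa using this
    have := ENNReal.Tendsto.const_mul (a := ENNReal.ofReal (2 ^ (n + 1) * (2⁻¹) ^ m))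
      (h.tendsto.comp h1) (Or.inr ENNReal.ofReal_ne_top)
    simpa using this

theorem ZeroDensity.decayInt_ne_top {τ : Measure (Euc n)} {x₀ : Euc n} (h : ZeroDensity τ x₀)
    (l : ℕ) : decayInt τ x₀ l ≠ ⊤ := by
  obtain ⟨Q, hQ, hQ'⟩ := h.growth
  refine ne_top_of_le_ne_top (tsum_ofReal_shell_ne_top n hQ) ((decayInt_le_tsum τ x₀ l).trans ?_)
  refine ENNReal.tsum_le_tsum fun m => ?_
  gcongr
  exact ENNReal.div_le_of_le_mul (hQ' _ (by positivity))

end Decay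

section GoodPoints

variable {n : ℕ} {F : Type*} [NormedAddCommGroup F]

theorem volume_ball_euc (x : Euc n) {r : ℝ} (hr : 0 < r) :
    volume (ball x r) = ENNReal.ofReal (r ^ n) * volume (ball (0 : Euc n) 1) := by
  rw [Measure.addHaar_ball_of_pos _ _ hr, finrank_euclideanSpace_fin]

theorem volume_closedBall_euc (x : Euc n) {r : ℝ} (hr : 0 < r) :
    volume (closedBall x r) = ENNReal.ofReal (r ^ n) * volume (ball (0 : Euc n) 1) := by
  rw [Measure.addHaar_closedBall _ _ hr.le, finrank_euclideanSpace_fin]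

theorem volume_unitBall_ne_top : volume (ball (0 : Euc n) 1) ≠ ⊤ := measure_ball_lt_top.ne

theorem volume_unitBall_ne_zero : volume (ball (0 : Euc n) 1) ≠ 0 :=
  (measure_ball_pos _ _ one_pos).ne'

theorem ZeroDensity.of_tendsto {τ : Measure (Euc n)} {x : Euc n} {Q : ℝ≥0∞} (hQ : Q ≠ ⊤)
    (hg : ∀ r : ℝ, 0 < r → τ (ball x r) ≤ Q * (1 + ENNReal.ofReal (r ^ n)))
    (ht : Tendsto (fun r : ℝ => τ (closedBall x r) / volume (closedBall x r)) (𝓝[>] 0) (𝓝 0)) :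
    ZeroDensity τ x := by
  have ht' : Tendsto (fun r : ℝ => τ (ball x r) / ENNReal.ofReal (r ^ n)) (𝓝[>] 0) (𝓝 0) := by
    have h2 := ENNReal.Tendsto.mul_const (b := volume (ball (0 : Euc n) 1)) ht
      (Or.inr volume_unitBall_ne_top)
    rw [zero_mul] at h2
    refine tendsto_of_tendsto_of_tendsto_of_le_of_le' tendsto_const_nhds h2
      (Eventually.of_forall fun _ => zero_le) ?_
    filter_upwards [self_mem_nhdsWithin] with r hr
    rw [volume_closedBall_euc x hr, ← ENNReal.mul_div_right_comm,
      ENNReal.mul_div_mul_right _ _ volume_unitBall_ne_zero volume_unitBall_ne_top]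
    gcongr
    exact ball_subset_closedBall
  refine ⟨?_, ht'⟩
  have hev : ∀ᶠ r in 𝓝[>] (0 : ℝ), τ (ball x r) / ENNReal.ofReal (r ^ n) ≤ 1 :=
    ht'.eventually (ge_mem_nhds zero_lt_one)
  obtain ⟨r₀, hr₀, h₀⟩ := mem_nhdsGT_iff_exists_Ioo_subset.1 hev
  have hr₀' : (0 : ℝ) < r₀ := hr₀
  refine ⟨1 + Q * (ENNReal.ofReal ((r₀ ^ n)⁻¹) + 1), by finiteness, fun r hr => ?_⟩
  have hrn : 0 < r ^ n := pow_pos hr n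
  rcases lt_or_ge r r₀ with h | h
  · have := h₀ ⟨hr, h⟩
    rw [Set.mem_ofPred_eq, ENNReal.div_le_iff (by simpa using hrn) ENNReal.ofReal_ne_top] at this
    refine this.trans ?_
    gcongr
    exact le_self_add
  · refine (hg r hr).trans ?_
    rw [add_mul, mul_assoc]
    refine le_trans ?_ le_add_self
    gcongr
    rw [add_mul, one_mul]
    gcongr
    rw [← ENNReal.ofReal_mul (by positivity), ← ENNReal.ofReal_one]
    refine ENNReal.ofReal_le_ofReal ?_
    rw [← div_eq_inv_mul, le_div_iff₀ (by positivity), one_mul]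
    gcongr

theorem ae_zeroDensity_sub {f : Euc n → F} (hf : LocallyIntegrable f volume)
    (hg : ∀ x : Euc n, ∃ Q : ℝ≥0∞, Q ≠ ⊤ ∧ ∀ r : ℝ, 0 < r →
      ∫⁻ y in ball x r, ‖f y‖ₑ ≤ Q * (1 + ENNReal.ofReal (r ^ n))) :
    ∀ᵐ x ∂(volume : Measure (Euc n)),
      ZeroDensity (volume.withDensity fun y => ‖f y - f x‖ₑ) x := by
  filter_upwards [(Besicovitch.vitaliFamily (volume : Measure
    (Euc n))).ae_tendsto_lintegral_enorm_sub_div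
    hf] with x hx
  obtain ⟨Q, hQ, hQ'⟩ := hg x
  refine ZeroDensity.of_tendsto (Q := Q + ‖f x‖ₑ * volume (ball (0 : Euc n) 1)) ?_ ?_ ?_
  · have := volume_unitBall_ne_top (n := n)
    finiteness
  · intro r hr
    rw [withDensity_apply _ measurableSet_ball, add_mul]
    calc ∫⁻ y in ball x r, ‖f y - f x‖ₑ ≤ ∫⁻ y in ball x r, (‖f y‖ₑ + ‖f x‖ₑ) :=
          lintegral_mono fun y => enorm_sub_le
      _ = (∫⁻ y in ball x r, ‖f y‖ₑ) + ‖f x‖ₑ * volume (ball x r) := by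
          rw [lintegral_add_right _ measurable_const, setLIntegral_const]
      _ ≤ _ := by
          refine add_le_add (hQ' r hr) ?_
          rw [volume_ball_euc x hr, mul_assoc, mul_comm (ENNReal.ofReal _)]
          gcongr
          exact le_add_self
  · refine (hx.comp (Besicovitch.tendsto_filterAt _ x)).congr fun r => ?_
    simp only [Function.comp]
    rw [withDensity_apply _ measurableSet_closedBall]

theorem ae_zeroDensity_singular {σ : Measure (Euc n)} [IsFiniteMeasure σ]
    (hσ : σ ⟂ₘ volume) : ∀ᵐ x ∂(volume : Measure (Euc n)), ZeroDensity σ x := by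
  have h0 : σ.rnDeriv volume =ᵐ[volume] 0 := (Measure.rnDeriv_eq_zero _ _).2 hσ
  filter_upwards [Besicovitch.ae_tendsto_rnDeriv σ (volume : Measure (Euc n)), h0] with x hx h0x
  rw [h0x] at hx
  refine ZeroDensity.of_tendsto (Q := σ Set.univ) (measure_ne_top _ _) (fun r _ => ?_) hx
  calc σ (ball x r) ≤ σ Set.univ * 1 := by rw [mul_one]; exact measure_mono (Set.subset_univ _)
    _ ≤ _ := by gcongr; exact le_self_add

/-- At almost every point, integrals of mean-zero kernels against a finite measure are controlled
by a measure of vanishing density. -/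
theorem ae_exists_zeroDensity (σ : Measure (Euc n)) [IsFiniteMeasure σ] :
    ∀ᵐ x ∂(volume : Measure (Euc n)), ∃ τ : Measure (Euc n), SFinite τ ∧ ZeroDensity τ x ∧
      ∀ {G : Type} [NormedAddCommGroup G] [NormedSpace ℝ G] (k : Euc n → G),
        Continuous k → Integrable k volume → Integrable k σ → ∫ y, k y = 0 →
          ‖∫ y, k y ∂σ‖ₑ ≤ ∫⁻ y, ‖k y‖ₑ ∂τ := by
  set ρ : Euc n → ℝ := fun y => (σ.rnDeriv volume y).toReal with hρ
  have hρi : Integrable ρ volume := Measure.integrable_toReal_rnDeriv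
  have h1 := ae_zeroDensity_sub hρi.locallyIntegrable (fun x => ⟨∫⁻ y, ‖ρ y‖ₑ, hρi.2.ne,
    fun r _ => by
    calc ∫⁻ y in ball x r, ‖ρ y‖ₑ ≤ (∫⁻ y, ‖ρ y‖ₑ) * 1 := by
          rw [mul_one]; exact setLIntegral_le_lintegral _ _
      _ ≤ _ := by gcongr; exact le_self_add⟩)
  have h2 := ae_zeroDensity_singular (σ := σ.singularPart volume)
    (Measure.mutuallySingular_singularPart σ volume)
  filter_upwards [h1, h2] with x h1 h2
  refine ⟨_, inferInstance, h2.add h1, fun {G} _ _ k hkc hkv hkσ hk0 => ?_⟩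
  have hdec : σ = σ.singularPart volume + volume.withDensity (σ.rnDeriv volume) :=
    Measure.haveLebesgueDecomposition_add σ volume
  have hks : Integrable k (σ.singularPart volume) :=
    hkσ.mono_measure (Measure.singularPart_le σ volume)
  have hkw : Integrable k (volume.withDensity (σ.rnDeriv volume)) :=
    hkσ.mono_measure (Measure.withDensity_rnDeriv_le σ volume)
  have hkρ : Integrable (fun y => ρ y • k y) volume :=
    (integrable_withDensity_iff_integrable_smul' (Measure.measurable_rnDeriv σ volume)
      (Measure.rnDeriv_lt_top σ volume)).1 hkw
  have hw : ∫ y, k y ∂(volume.withDensity (σ.rnDeriv volume)) = ∫ y, (ρ y - ρ x) • k y := by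
    rw [integral_withDensity_eq_integral_toReal_smul (Measure.measurable_rnDeriv σ volume)
      (Measure.rnDeriv_lt_top σ volume)]
    simp only [sub_smul]
    have hc : Integrable (fun y => ρ x • k y) volume := hkv.smul _
    rw [integral_sub hkρ hc, integral_smul, hk0, smul_zero, sub_zero]
  have : ∫ y, k y ∂σ = ∫ y, k y ∂(σ.singularPart volume) + ∫ y, (ρ y - ρ x) • k y := by
    conv_lhs => rw [hdec]
    rw [integral_add_measure hks hkw, hw]
  rw [this, lintegral_add_measure]
  refine (enorm_add_le _ _).trans (add_le_add (enorm_integral_le_lintegral_enorm _) ?_)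
  refine (enorm_integral_le_lintegral_enorm _).trans (le_of_eq ?_)
  rw [lintegral_withDensity_eq_lintegral_mul _ (by
    have : Measurable ρ := (Measure.measurable_rnDeriv σ volume).ennreal_toReal
    fun_prop) hkc.enorm.measurable]
  exact lintegral_congr fun y => by rw [enorm_smul]; rfl

end GoodPoints

section Dilation

open scoped SchwartzMap FourierTransform

variable {n : ℕ} {F : Type*} [NormedAddCommGroup F] [NormedSpace ℝ F]

/-- The `L¹`-normalised dilation of `Φ` to scale `2⁻ˡ`. -/
noncomputable def dil (l : ℕ) (Φ : Euc n → F) (x : Euc n) : F :=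
  ((2 : ℝ) ^ (l * n)) • Φ ((2 : ℝ) ^ l • x)

theorem SchwartzMap.exists_decay_bound (Φ : 𝓢(Euc n, F)) (m k : ℕ) :
    ∃ C : ℝ, 0 < C ∧ ∀ i ≤ k, ∀ x, ‖iteratedFDeriv ℝ i Φ x‖ ≤ C * ((1 + ‖x‖) ^ m)⁻¹ := by
  refine ⟨2 ^ m * (Finset.Iic (m, k)).sup (fun m => SchwartzMap.seminorm ℝ m.1 m.2) Φ + 1,
    by positivity, fun i hi x => ?_⟩
  have := SchwartzMap.one_add_le_sup_seminorm_apply (𝕜 := ℝ) (m := (m, k)) le_rfl hi Φ x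
  rw [← div_eq_mul_inv, le_div_iff₀ (by positivity), mul_comm]
  linarith

theorem norm_dil_le {Φ : Euc n → F} {C : ℝ} (hC : ∀ x, ‖Φ x‖ ≤ C * ((1 + ‖x‖) ^ (n + 1))⁻¹)
    (l : ℕ) (x : Euc n) : ‖dil l Φ x‖ ≤ C * decayWt n l x := by
  unfold dil decayWt
  rw [norm_smul, Real.norm_of_nonneg (by positivity), mul_left_comm]
  gcongr
  refine (hC _).trans (le_of_eq ?_)
  rw [norm_smul, Real.norm_of_nonneg (by positivity)]

theorem continuous_dil {Φ : Euc n → F} (h : Continuous Φ) (l : ℕ) : Continuous (dil l Φ) := by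
  unfold dil; fun_prop

theorem integral_dil (Φ : Euc n → F) (l : ℕ) : ∫ x, dil l Φ x = ∫ x, Φ x := by
  unfold dil
  rw [integral_smul, Measure.integral_comp_smul, finrank_euclideanSpace_fin, smul_smul,
    ← pow_mul, abs_of_pos (by positivity), mul_inv_cancel₀ (by positivity), one_smul]

theorem integral_sub_left_dil (Φ : Euc n → F) (l : ℕ) (x : Euc n) :
    ∫ y, dil l Φ (x - y) = ∫ x, Φ x := by
  rw [integral_sub_left_eq_self (dil l Φ) volume x, integral_dil]

/-- `dil` on Schwartz functions. -/
noncomputable def dilS (l : ℕ) (Φ : 𝓢(Euc n, F)) : 𝓢(Euc n, F) :=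
  ((2 : ℝ) ^ (l * n)) • SchwartzMap.compCLMOfContinuousLinearEquiv ℝ
    (ContinuousLinearEquiv.smulLeft (Units.mk0 ((2 : ℝ) ^ l) (by positivity))) Φ

theorem coe_dilS (l : ℕ) (Φ : 𝓢(Euc n, F)) : (dilS l Φ : Euc n → F) = dil l Φ := rfl

theorem integrable_dil (Φ : 𝓢(Euc n, F)) (l : ℕ) : Integrable (dil l Φ) volume := by
  rw [← coe_dilS]; exact (dilS l Φ).integrable

theorem integrable_dil_sub (Φ : 𝓢(Euc n, F)) (l : ℕ) (x : Euc n) :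
    Integrable (fun y => dil l Φ (x - y)) volume :=
  (integrable_dil Φ l).comp_sub_left x

theorem integrable_dil_measure (Φ : 𝓢(Euc n, F)) (l : ℕ) (x : Euc n) (σ : Measure (Euc n))
    [IsFiniteMeasure σ] : Integrable (fun y => dil l Φ (x - y)) σ := by
  obtain ⟨C, hC0, hC⟩ := (dilS l Φ).exists_decay_bound 0 0
  refine Integrable.of_bound (C := C) ?_ (Eventually.of_forall fun y => ?_)
  · exact ((continuous_dil Φ.continuous l).comp (continuous_sub_left x)).aestronglyMeasurable
  · simpa [coe_dilS] using hC 0 le_rfl (x - y)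

theorem tendsto_integral_dil_mul {κ : 𝓢(Euc n, ℂ)} {f : Euc n → ℂ} {x : Euc n}
    (h : ZeroDensity (volume.withDensity fun y => ‖f y - f x‖ₑ) x)
      (hf : AEStronglyMeasurable f volume)
    (hi : ∀ l, Integrable (fun y => dil l κ (x - y) * f y) volume) :
    Tendsto (fun l : ℕ => ∫ y, dil l κ (x - y) * f y) atTop (𝓝 ((∫ y, κ y) * f x)) := by
  obtain ⟨C, hC0, hC⟩ := κ.exists_decay_bound (n + 1) 0
  rw [tendsto_iff_edist_tendsto_0]
  have h1 := ENNReal.Tendsto.const_mul (a := ENNReal.ofReal C) h.tendsto_decayInt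
    (Or.inr ENNReal.ofReal_ne_top)
  rw [mul_zero] at h1
  refine tendsto_of_tendsto_of_tendsto_of_le_of_le tendsto_const_nhds h1 (fun _ => zero_le) ?_
  intro l
  have h2 : (∫ y, dil l κ (x - y) * f y) - (∫ y, κ y) * f x =
      ∫ y, dil l κ (x - y) * (f y - f x) := by
    simp only [mul_sub]
    rw [integral_sub (hi l) ((integrable_dil_sub κ l x).mul_const _), integral_mul_const,
      integral_sub_left_dil]
  beta_reduce
  rw [edist_eq_enorm_sub, h2]
  refine (enorm_integral_le_lintegral_enorm _).trans ?_
  unfold decayInt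
  rw [lintegral_withDensity_eq_lintegral_mul₀ (by fun_prop)
    (by have := continuous_decayWt (n := n) l; fun_prop)]
  rw [← lintegral_const_mul' _ _ ENNReal.ofReal_ne_top]
  refine lintegral_mono fun y => ?_
  rw [Pi.mul_apply, enorm_mul, mul_left_comm, mul_comm]
  gcongr
  rw [← ENNReal.ofReal_mul hC0.le, ← ofReal_norm, ← decayWt_neg, neg_sub]
  exact ENNReal.ofReal_le_ofReal (norm_dil_le (fun x => by simpa using hC 0 le_rfl x) l _)

theorem ae_zeroDensity_sub_of_memLp_two {f : Euc n → ℂ} (hf : MemLp f 2 volume) :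
    ∀ᵐ x ∂(volume : Measure (Euc n)),
      ZeroDensity (volume.withDensity fun y => ‖f y - f x‖ₑ) x := by
  refine ae_zeroDensity_sub (hf.locallyIntegrable (by norm_num)) fun x => ?_
  have h2 : ∫⁻ y, ‖f y‖ₑ ^ 2 ≠ ⊤ := by
    have := lintegral_rpow_enorm_lt_top_of_eLpNorm_lt_top (p := 2) (by norm_num) (by norm_num) hf.2
    simpa using this.ne
  have := volume_unitBall_ne_top (n := n)
  refine ⟨volume (ball (0 : Euc n) 1) + ∫⁻ y, ‖f y‖ₑ ^ 2, by finiteness, fun r hr => ?_⟩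
  calc ∫⁻ y in ball x r, ‖f y‖ₑ ≤ ∫⁻ y in ball x r, (1 + ‖f y‖ₑ ^ 2) := by
        refine lintegral_mono fun y => ?_
        rcases le_total ‖f y‖ₑ 1 with h | h
        · exact h.trans le_self_add
        · refine le_trans ?_ le_add_self
          rw [sq]; exact le_mul_of_one_le_left' h
    _ = volume (ball x r) + ∫⁻ y in ball x r, ‖f y‖ₑ ^ 2 := by
        rw [lintegral_add_left measurable_const, setLIntegral_const, one_mul]
    _ ≤ ENNReal.ofReal (r ^ n) * volume (ball (0 : Euc n) 1) + ∫⁻ y, ‖f y‖ₑ ^ 2 := by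
        rw [volume_ball_euc x hr]
        gcongr
        exact Measure.restrict_le_self
    _ ≤ _ := by
        rw [add_mul, mul_add, mul_one, mul_add, mul_one, mul_comm]
        refine add_le_add le_add_self le_self_add

end Dilation

section FourierL2

open scoped SchwartzMap FourierTransform

variable {n : ℕ}

theorem fourier_dilS (l : ℕ) (κ : 𝓢(Euc n, ℂ)) (ξ : Euc n) :
    𝓕 (dilS l κ) ξ = 𝓕 κ (((2 : ℝ) ^ l)⁻¹ • ξ) := by
  rw [SchwartzMap.fourier_coe, SchwartzMap.fourier_coe, Real.fourier_eq, Real.fourier_eq]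
  have h := Measure.integral_comp_smul (volume : Measure (Euc n))
    (fun v => Real.fourierChar (-(inner ℝ v (((2 : ℝ) ^ l)⁻¹ • ξ))) • κ v) ((2 : ℝ) ^ l)
  rw [finrank_euclideanSpace_fin, ← pow_mul, abs_of_pos (by positivity)] at h
  have h' : ∫ v, Real.fourierChar (-(inner ℝ v (((2 : ℝ) ^ l)⁻¹ • ξ))) • κ v =
      (2 : ℝ) ^ (l * n) • ∫ v : Euc n,
        Real.fourierChar (-(inner ℝ ((2 : ℝ) ^ l • v) (((2 : ℝ) ^ l)⁻¹ • ξ))) • κ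
          ((2 : ℝ) ^ l • v) := by
    rw [h, smul_smul, mul_inv_cancel₀ (by positivity), one_smul]
  rw [h', ← integral_smul]
  congr 1
  funext v
  rw [coe_dilS, dil, inner_smul_left, inner_smul_right, smul_comm]
  congr 3
  simp

/-- The kernel `y ↦ conj (κ (x - y))`. -/
noncomputable def conjRefl (κ : 𝓢(Euc n, ℂ)) (x : Euc n) : 𝓢(Euc n, ℂ) :=
  SchwartzMap.postcompCLM (𝕜 := ℝ) (Complex.conjCLE : ℂ →L[ℝ] ℂ)
    (SchwartzMap.compSubConstCLM ℝ x
      (SchwartzMap.compCLMOfContinuousLinearEquiv ℝ (ContinuousLinearEquiv.neg ℝ) κ))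

theorem conjRefl_apply (κ : 𝓢(Euc n, ℂ)) (x y : Euc n) :
    conjRefl κ x y = (starRingEnd ℂ) (κ (x - y)) := by
  change (starRingEnd ℂ) (κ (-(y - x))) = _
  rw [neg_sub]

theorem fourier_conjRefl (κ : 𝓢(Euc n, ℂ)) (x ξ : Euc n) :
    𝓕 (conjRefl κ x) ξ = (starRingEnd ℂ) (Real.fourierChar (inner ℝ x ξ) • 𝓕 κ ξ) := by
  rw [SchwartzMap.fourier_coe, SchwartzMap.fourier_coe, Real.fourier_eq, Real.fourier_eq,
    ← integral_sub_left_eq_self _ volume x, Circle.smul_def, ← integral_smul, ← integral_conj]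
  congr 1
  funext v
  rw [conjRefl_apply, sub_sub_cancel, Circle.smul_def, Circle.smul_def, smul_eq_mul, smul_eq_mul,
    smul_eq_mul, map_mul, map_mul, ← mul_assoc, inner_sub_left, neg_sub, sub_eq_add_neg,
    ← Circle.coe_inv_eq_conj, ← Circle.coe_inv_eq_conj, ← AddChar.map_neg_eq_inv,
    ← AddChar.map_neg_eq_inv, neg_neg, AddChar.map_add_eq_mul, Circle.coe_mul,
    mul_comm (Real.fourierChar (inner ℝ v ξ) : ℂ)]

theorem integral_mul_eq_fourier (κ : 𝓢(Euc n, ℂ)) (u : Lp (α := Euc n) ℂ 2) (x : Euc n) :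
    ∫ y, κ (x - y) * u y =
      ∫ ξ, (Real.fourierChar (inner ℝ x ξ) • 𝓕 κ ξ) * (𝓕 u : Lp (α := Euc n) ℂ 2) ξ := by
  have h := Lp.inner_fourier_eq ((conjRefl κ x).toLp 2) u
  rw [SchwartzMap.toLp_fourier_eq, L2.inner_def, L2.inner_def] at h
  have h1 : ∫ y, inner ℂ ((conjRefl κ x).toLp 2 volume y) (u y) = ∫ y, κ (x - y) * u y := by
    refine integral_congr_ae ?_
    filter_upwards [(conjRefl κ x).coeFn_toLp 2] with y hy
    rw [hy, conjRefl_apply, RCLike.inner_apply, RCLike.conj_conj, mul_comm]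
  have hf := fourier_conjRefl κ x
  generalize (𝓕 (conjRefl κ x) : 𝓢(Euc n, ℂ)) = κ' at h hf
  generalize (𝓕 u : Lp ℂ 2 (volume : Measure (Euc n))) = v at h ⊢
  have h2 : ∫ ξ, inner ℂ (κ'.toLp 2 volume ξ) (v ξ) =
      ∫ ξ, (Real.fourierChar (inner ℝ x ξ) • 𝓕 κ ξ) * v ξ := by
    refine integral_congr_ae ?_
    have hc : κ'.toLp 2 volume =ᵐ[volume] κ' := κ'.coeFn_toLp 2 volume
    filter_upwards [hc] with y hy
    rw [hy, hf, RCLike.inner_apply, RCLike.conj_conj, mul_comm]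
  rw [← h1, ← h2, h]

theorem memLp_char_smul (κ : 𝓢(Euc n, ℂ)) (x : Euc n) :
    MemLp (fun ξ => Real.fourierChar (inner ℝ x ξ) • 𝓕 κ ξ) 2 volume := by
  have h := ((𝓕 (conjRefl κ x) : 𝓢(Euc n, ℂ)).memLp 2 volume).star
  refine h.ae_eq (Eventually.of_forall fun ξ => ?_)
  simp [fourier_conjRefl]

theorem integrable_char_smul_mul (κ : 𝓢(Euc n, ℂ)) (x : Euc n) (u : Lp (α := Euc n) ℂ 2) :
    Integrable (fun ξ => (Real.fourierChar (inner ℝ x ξ) • 𝓕 κ ξ) * u ξ) volume :=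
  (memLp_char_smul κ x).integrable_mul (Lp.memLp u)

theorem integrable_dil_mul (κ : 𝓢(Euc n, ℂ)) (l : ℕ) (x : Euc n) {u : Euc n → ℂ}
    (hu : MemLp u 2 volume) : Integrable (fun y => dil l κ (x - y) * u y) volume := by
  have h := ((conjRefl (dilS l κ) x).memLp 2).star
  refine (h.ae_eq (Eventually.of_forall fun ξ => ?_)).integrable_mul hu
  simp [conjRefl_apply, coe_dilS]

/-- The dyadic multiplier `∑ₗ ψ̂(2⁻ˡ ξ)`. -/
noncomputable def dyadicMult (h : Euc n → ℂ) (ξ : Euc n) : ℂ :=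
  ∑' l : ℕ, h (((2 : ℝ) ^ l)⁻¹ • ξ)

variable {h : Euc n → ℂ}

theorem dyadic_eq_zero_of_le (h0 : ∀ ξ, ‖ξ‖ ≤ 1 → h ξ = 0)
    {ξ : Euc n} {l : ℕ} (hl : ‖ξ‖ ≤ 2 ^ l) :
    h (((2 : ℝ) ^ l)⁻¹ • ξ) = 0 := by
  apply h0
  rw [norm_smul, norm_inv, norm_pow, Real.norm_ofNat, inv_mul_le_iff₀ (by positivity)]
  simpa using hl

theorem dyadic_finite (h0 : ∀ ξ, ‖ξ‖ ≤ 1 → h ξ = 0)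
    (ξ : Euc n) : ∃ N : ℕ, ∀ l, N ≤ l → h (((2 : ℝ) ^ l)⁻¹ • ξ) = 0 := by
  obtain ⟨N, hN⟩ := pow_unbounded_of_one_lt ‖ξ‖ (one_lt_two)
  exact ⟨N, fun l hl => dyadic_eq_zero_of_le h0 (hN.le.trans (pow_le_pow_right₀ one_le_two hl))⟩

theorem hasSum_dyadicMult (h0 : ∀ ξ, ‖ξ‖ ≤ 1 → h ξ = 0)
    (ξ : Euc n) :
    HasSum (fun l : ℕ => h (((2 : ℝ) ^ l)⁻¹ • ξ)) (dyadicMult h ξ) := by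
  obtain ⟨N, hN⟩ := dyadic_finite h0 ξ
  exact (summable_of_ne_finset_zero (s := Finset.range N)
    fun l hl => hN l (by simpa using hl)).hasSum

theorem measurable_dyadicMult (h0 : ∀ ξ, ‖ξ‖ ≤ 1 → h ξ = 0)
    (hm : Measurable h) : Measurable (dyadicMult h) := by
  refine measurable_of_tendsto_metrizable (f := fun N ξ => ∑ l ∈ Finset.range N,
    h (((2 : ℝ) ^ l)⁻¹ • ξ)) (fun N => by fun_prop) ?_
  rw [tendsto_pi_nhds]
  exact fun ξ => (hasSum_dyadicMult h0 ξ).tendsto_sum_nat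

theorem dyadic_eq_zero_of_ge (h1 : ∀ ξ, 4 ≤ ‖ξ‖ → h ξ = 0)
    {ξ : Euc n} {l : ℕ} (hl : 2 ^ (l + 2) ≤ ‖ξ‖) :
    h (((2 : ℝ) ^ l)⁻¹ • ξ) = 0 := by
  apply h1
  rw [norm_smul, norm_inv, norm_pow, Real.norm_ofNat, le_inv_mul_iff₀ (by positivity)]
  linarith [pow_add (2 : ℝ) l 2]

theorem norm_dyadicMult_le (h0 : ∀ ξ, ‖ξ‖ ≤ 1 → h ξ = 0) (h1 : ∀ ξ, 4 ≤ ‖ξ‖ → h ξ = 0)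
    {C : ℝ} (hC : ∀ ξ, ‖h ξ‖ ≤ C) (ξ : Euc n) :
    ‖dyadicMult h ξ‖ ≤ 2 * C := by
  have hC0 : 0 ≤ C := (norm_nonneg _).trans (hC 0)
  classical
  by_cases hex : ∃ l : ℕ, h (((2 : ℝ) ^ l)⁻¹ • ξ) ≠ 0
  · set L := Nat.find hex
    have hL : h (((2 : ℝ) ^ L)⁻¹ • ξ) ≠ 0 := Nat.find_spec hex
    have hub : ‖ξ‖ < 2 ^ (L + 2) := by
      by_contra hc
      exact hL (dyadic_eq_zero_of_ge h1 (not_lt.1 hc))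
    have : dyadicMult h ξ = ∑ l ∈ {L, L + 1}, h (((2 : ℝ) ^ l)⁻¹ • ξ) := by
      refine tsum_eq_sum fun l hl => ?_
      simp only [Finset.mem_insert, Finset.mem_singleton, not_or] at hl
      rcases lt_or_ge l L with h' | h'
      · exact not_not.1 (Nat.find_min hex h')
      · refine dyadic_eq_zero_of_le h0 (hub.le.trans (pow_le_pow_right₀ one_le_two ?_))
        omega
    rw [this, Finset.sum_pair (by omega), two_mul]
    exact (norm_add_le _ _).trans (add_le_add (hC _) (hC _))
  · push Not at hex
    rw [dyadicMult]
    simp only [hex, tsum_zero, norm_zero]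
    positivity

theorem lowpass_mul_dyadicMult (h0 : ∀ ξ, ‖ξ‖ ≤ 1 → h ξ = 0) (h1 : ∀ ξ, 4 ≤ ‖ξ‖ → h ξ = 0)
    {b : Euc n → ℂ} (hb1 : ∀ ξ, ‖ξ‖ ≤ 2 → b ξ = 1)
    (hb0 : ∀ ξ, 4 ≤ ‖ξ‖ → b ξ = 0) (N : ℕ) (ξ : Euc n) :
    b (((2 : ℝ) ^ N)⁻¹ • ξ) * dyadicMult h ξ = (∑ l ∈ Finset.range N, h (((2 : ℝ) ^ l)⁻¹ • ξ)) +
      b (((2 : ℝ) ^ N)⁻¹ • ξ) * (h (((2 : ℝ) ^ N)⁻¹ • ξ) +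
        h (((2 : ℝ) ^ 1)⁻¹ • ((2 : ℝ) ^ N)⁻¹ • ξ)) := by
  have hs := (hasSum_dyadicMult h0 ξ).mul_left (b (((2 : ℝ) ^ N)⁻¹ • ξ))
  have h2 := hasSum_sum_of_ne_finset_zero (L := SummationFilter.unconditional ℕ) (s := Finset.range
    (N + 1 + 1))
    (f := fun l : ℕ => b (((2 : ℝ) ^ N)⁻¹ • ξ) * h (((2 : ℝ) ^ l)⁻¹ • ξ)) (by
      intro l hl
      rw [Finset.mem_range, not_lt] at hl
      rcases le_or_gt 4 ‖((2 : ℝ) ^ N)⁻¹ • ξ‖ with h' | h'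
      · rw [hb0 _ h', zero_mul]
      · rw [dyadic_eq_zero_of_le h0, mul_zero]
        rw [norm_smul, norm_inv, norm_pow, Real.norm_ofNat, inv_mul_lt_iff₀ (by positivity)] at h'
        refine h'.le.trans (le_trans (le_of_eq ?_) (pow_le_pow_right₀ one_le_two hl))
        rw [pow_add, pow_add]; ring)
  rw [hs.unique h2, Finset.sum_range_succ, Finset.sum_range_succ, mul_add, add_assoc]
  congr 1
  · refine Finset.sum_congr rfl fun l hl => ?_
    rw [Finset.mem_range] at hl
    rcases le_or_gt (2 ^ (l + 2)) ‖ξ‖ with h' | h'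
    · rw [dyadic_eq_zero_of_ge h1 h', mul_zero]
    · rw [hb1, one_mul]
      rw [norm_smul, norm_inv, norm_pow, Real.norm_ofNat, inv_mul_le_iff₀ (by positivity)]
      refine h'.le.trans ?_
      rw [← pow_succ]
      exact pow_le_pow_right₀ one_le_two (by omega)
  · rw [smul_smul, ← mul_inv, ← pow_add, add_comm 1 N]

end FourierL2

section L2Star

open scoped SchwartzMap FourierTransform

variable {n : ℕ}

/-- A smooth radial low-pass filter: one on the unit ball, supported in the ball of radius two. -/
noncomputable def lowBump (n : ℕ) : ContDiffBump (0 : Euc n) :=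
  ⟨1, 2, one_pos, one_lt_two⟩

theorem lowBump_one {ξ : Euc n} (h : ‖ξ‖ ≤ 1) : lowBump n ξ = 1 :=
  (lowBump n).one_of_mem_closedBall (by simpa [lowBump] using h)

theorem lowBump_zero {ξ : Euc n} (h : 2 ≤ ‖ξ‖) : lowBump n ξ = 0 :=
  (lowBump n).zero_of_le_dist (by simpa [lowBump] using h)

/-- `lowBump` as a complex Schwartz function. -/
noncomputable def lowBumpS (n : ℕ) : 𝓢(Euc n, ℂ) :=
  HasCompactSupport.toSchwartzMap (f := fun ξ => ((lowBump n ξ : ℝ) : ℂ))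
    ((lowBump n).hasCompactSupport.comp_left (g := fun t : ℝ => (t : ℂ)) Complex.ofReal_zero)
    (Complex.ofRealCLM.contDiff.comp (lowBump n).contDiff)

theorem lowBumpS_apply (ξ : Euc n) : lowBumpS n ξ = ((lowBump n ξ : ℝ) : ℂ) := rfl

/-- Pointwise product of Schwartz functions. -/
noncomputable def schwartzMul (a b : 𝓢(Euc n, ℂ)) : 𝓢(Euc n, ℂ) :=
  SchwartzMap.smulLeftCLM ℂ (a : Euc n → ℂ) b

theorem schwartzMul_apply (a b : 𝓢(Euc n, ℂ)) (ξ : Euc n) : schwartzMul a b ξ = a ξ * b ξ := by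
  rw [schwartzMul, SchwartzMap.smulLeftCLM_apply_apply a.hasTemperateGrowth, smul_eq_mul]

/-- Composition of a Schwartz function with `ξ ↦ ξ / 2`. -/
noncomputable def halfS (a : 𝓢(Euc n, ℂ)) : 𝓢(Euc n, ℂ) :=
  SchwartzMap.compCLMOfContinuousLinearEquiv ℝ
    (ContinuousLinearEquiv.smulLeft (Units.mk0 ((2 : ℝ)⁻¹) (by positivity))) a

theorem halfS_apply (a : 𝓢(Euc n, ℂ)) (ξ : Euc n) : halfS a ξ = a ((2 : ℝ)⁻¹ • ξ) := rfl

theorem ae_tendsto_dyadic_of_memLp_two (ψ : 𝓢(Euc n, ℂ)) (h0 : ∀ ξ, ‖ξ‖ ≤ 1 → 𝓕 ψ ξ = 0)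
    (h1 : ∀ ξ, 4 ≤ ‖ξ‖ → 𝓕 ψ ξ = 0) {g : Euc n → ℂ} (hg : MemLp g 2 volume) :
    ∀ᵐ x ∂(volume : Measure (Euc n)), ∃ c : ℂ, Tendsto
      (fun N : ℕ => ∑ l ∈ Finset.range N, ∫ y, dil l ψ (x - y) * g y) atTop (𝓝 c) := by
  set u : Lp ℂ 2 (volume : Measure (Euc n)) := hg.toLp g with hu
  have hug : u =ᵐ[volume] g := hg.coeFn_toLp
  set b : 𝓢(Euc n, ℂ) := halfS (lowBumpS n) with hb
  have hb1 : ∀ ξ, ‖ξ‖ ≤ 2 → b ξ = 1 := fun ξ hξ => by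
    rw [hb, halfS_apply, lowBumpS_apply, lowBump_one, Complex.ofReal_one]
    rw [norm_smul]; norm_num; linarith
  have hb0 : ∀ ξ, 4 ≤ ‖ξ‖ → b ξ = 0 := fun ξ hξ => by
    rw [hb, halfS_apply, lowBumpS_apply, lowBump_zero, Complex.ofReal_zero]
    rw [norm_smul]; norm_num; linarith
  set φ : 𝓢(Euc n, ℂ) := 𝓕⁻ b with hφ
  set w : 𝓢(Euc n, ℂ) := schwartzMul b (𝓕 ψ + halfS (𝓕 ψ)) with hw
  set ω : 𝓢(Euc n, ℂ) := 𝓕⁻ w with hω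
  have hFφ : 𝓕 φ = b := FourierTransform.fourier_fourierInv_eq b
  have hFω : 𝓕 ω = w := FourierTransform.fourier_fourierInv_eq w
  set m : Euc n → ℂ := dyadicMult (𝓕 ψ : 𝓢(Euc n, ℂ)) with hm
  have hmm : Measurable m := measurable_dyadicMult h0 (𝓕 ψ : 𝓢(Euc n, ℂ)).continuous.measurable
  obtain ⟨C, hC0, hC⟩ := (𝓕 ψ : 𝓢(Euc n, ℂ)).exists_decay_bound 0 0
  have hmb : ∀ ξ, ‖m ξ‖ ≤ 2 * C := norm_dyadicMult_le h0 h1 fun ξ => by simpa using hC 0 le_rfl ξ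
  have hmu : MemLp (fun ξ => m ξ * (𝓕 u : Lp ℂ 2 (volume : Measure (Euc n))) ξ) 2 volume := by
    refine (Lp.memLp (𝓕 u : Lp ℂ 2 (volume : Measure (Euc n)))).of_le_mul (c := 2 * C)
      (hmm.aestronglyMeasurable.mul (Lp.aestronglyMeasurable _)) (Eventually.of_forall fun ξ => ?_)
    rw [norm_mul]
    gcongr
    exact hmb ξ
  set f : Lp ℂ 2 (volume : Measure (Euc n)) := 𝓕⁻ (hmu.toLp _) with hf
  have hFf : (𝓕 f : Lp ℂ 2 (volume : Measure (Euc n))) = hmu.toLp _ :=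
    FourierTransform.fourier_fourierInv_eq _
  have key : ∀ (N : ℕ) (x : Euc n), ∫ y, dil N φ (x - y) * f y =
      (∑ l ∈ Finset.range N, ∫ y, dil l ψ (x - y) * g y) + ∫ y, dil N ω (x - y) * g y := by
    intro N x
    have hgu : ∀ κ : Euc n → ℂ, ∫ y, κ (x - y) * g y = ∫ y, κ (x - y) * u y := fun κ => by
      refine integral_congr_ae ?_
      filter_upwards [hug] with y hy
      rw [hy]
    simp only [hgu, ← coe_dilS]
    simp only [integral_mul_eq_fourier]
    rw [← integral_finsetSum _ fun l _ => integrable_char_smul_mul _ _ _,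
      ← integral_add (integrable_finsetSum _ fun l _ => integrable_char_smul_mul _ _ _)
        (integrable_char_smul_mul _ _ _)]
    refine integral_congr_ae ?_
    rw [hFf]
    filter_upwards [hmu.coeFn_toLp] with ξ hξ
    rw [hξ]
    simp only [fourier_dilS, hFφ, hFω, Circle.smul_def, smul_eq_mul]
    have := lowpass_mul_dyadicMult h0 h1 hb1 hb0 N ξ
    have hwe : w (((2 : ℝ) ^ N)⁻¹ • ξ) = b (((2 : ℝ) ^ N)⁻¹ • ξ) *
        (𝓕 ψ (((2 : ℝ) ^ N)⁻¹ • ξ) + 𝓕 ψ (((2 : ℝ) ^ 1)⁻¹ • ((2 : ℝ) ^ N)⁻¹ • ξ)) := by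
      rw [hw, schwartzMul_apply, add_apply, halfS_apply (𝓕 ψ), pow_one]
    rw [← hwe] at this
    rw [← Finset.sum_mul, ← Finset.mul_sum, ← add_mul, ← mul_add, ← this]
    ring
  filter_upwards [ae_zeroDensity_sub_of_memLp_two (Lp.memLp f), ae_zeroDensity_sub_of_memLp_two hg]
    with x hx1 hx2
  have t1 := tendsto_integral_dil_mul (κ := φ) hx1 (Lp.aestronglyMeasurable f)
    fun l => integrable_dil_mul φ l x (Lp.memLp f)
  have t2 := tendsto_integral_dil_mul (κ := ω) hx2 hg.1 fun l => integrable_dil_mul ω l x hg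
  refine ⟨_, (t1.sub t2).congr fun N => ?_⟩
  rw [key, add_sub_cancel_right]

end L2Star

section DyadicSum

theorem rpow_mul_one_add_le {a b s : ℝ} (ha : 0 < a) (hab : a < b) (hs : 0 < s) {m : ℤ}
    (h1 : (2 : ℝ) ^ m ≤ s) (h2 : s < 2 ^ (m + 1)) :
    s ^ a * ((1 + s) ^ b)⁻¹ ≤ 2 ^ a * (2 ^ (-(min a (b - a)))) ^ m.natAbs := by
  have hc : 0 < min a (b - a) := lt_min ha (by linarith)
  have hpow : ((2 : ℝ) ^ (-(min a (b - a)))) ^ m.natAbs = 2 ^ (-(min a (b - a)) * |(m : ℝ)|) := by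
    rw [← Real.rpow_natCast, ← Real.rpow_mul two_pos.le, Nat.cast_natAbs, Int.cast_abs]
  rw [hpow]
  rw [← Real.rpow_intCast] at h1 h2
  push_cast at h2
  have h1s : (1 + s) ^ b ≠ 0 := (Real.rpow_pos_of_pos (by linarith) _).ne'
  rcases le_or_gt 0 m with hm | hm
  · have hm' : (0 : ℝ) ≤ m := by exact_mod_cast hm
    rw [abs_of_nonneg hm']
    calc s ^ a * ((1 + s) ^ b)⁻¹ ≤ s ^ a * (s ^ b)⁻¹ := by
          gcongr
          · linarith
          · linarith
      _ = s ^ (a - b) := by rw [Real.rpow_sub hs, div_eq_mul_inv]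
      _ ≤ (2 ^ (m : ℝ)) ^ (a - b) := Real.rpow_le_rpow_of_nonpos (by positivity) h1 (by linarith)
      _ = 2 ^ ((m : ℝ) * (a - b)) := by rw [← Real.rpow_mul two_pos.le]
      _ ≤ 2 ^ (-(min a (b - a)) * (m : ℝ)) := by
          apply Real.rpow_le_rpow_of_exponent_le one_le_two
          nlinarith [min_le_right a (b - a)]
      _ ≤ _ := le_mul_of_one_le_left (by positivity) (Real.one_le_rpow one_le_two ha.le)
  · have hm' : (m : ℝ) < 0 := by exact_mod_cast hm
    rw [abs_of_neg hm']
    calc s ^ a * ((1 + s) ^ b)⁻¹ ≤ s ^ a * 1 := by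
          gcongr
          exact inv_le_one_of_one_le₀ (Real.one_le_rpow (by linarith) (by linarith))
      _ ≤ (2 ^ ((m : ℝ) + 1)) ^ a := by rw [mul_one]; gcongr
      _ = 2 ^ a * 2 ^ ((m : ℝ) * a) := by
          rw [← Real.rpow_mul two_pos.le, ← Real.rpow_add two_pos]; ring_nf
      _ ≤ _ := by
          gcongr 2 ^ a * ?_
          apply Real.rpow_le_rpow_of_exponent_le one_le_two
          nlinarith [min_le_left a (b - a)]

theorem exists_tsum_dyadic_le {a b : ℝ} (ha : 0 < a) (hab : a < b) :
    ∃ C : ℝ, 0 < C ∧ ∀ t : ℝ, 0 < t →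
      ∑' l : ℕ, ENNReal.ofReal ((2 ^ l) ^ a * ((1 + 2 ^ l * t) ^ b)⁻¹) ≤
        ENNReal.ofReal (C * t ^ (-a)) := by
  set q : ℝ := 2 ^ (-(min a (b - a))) with hq
  have hc : 0 < min a (b - a) := lt_min ha (by linarith)
  have hq0 : 0 < q := by positivity
  have hq1 : q < 1 := Real.rpow_lt_one_of_one_lt_of_neg one_lt_two (by linarith)
  have hsum : Summable fun m : ℤ => 2 ^ a * q ^ m.natAbs := by
    refine Summable.mul_left _ (Summable.of_nat_of_neg ?_ ?_)
    · simpa using summable_geometric_of_lt_one hq0.le hq1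
    · simpa using summable_geometric_of_lt_one hq0.le hq1
  refine ⟨(∑' m : ℤ, 2 ^ a * q ^ m.natAbs) + 1, ?_, fun t ht => ?_⟩
  · have : 0 ≤ ∑' m : ℤ, 2 ^ a * q ^ m.natAbs := tsum_nonneg fun m => by positivity
    linarith
  obtain ⟨M, hM1, hM2⟩ := exists_mem_Ico_zpow ht one_lt_two
  have hterm : ∀ l : ℕ, ENNReal.ofReal ((2 ^ l) ^ a * ((1 + 2 ^ l * t) ^ b)⁻¹) ≤
      ENNReal.ofReal (2 ^ a * q ^ ((l : ℤ) + M).natAbs) * ENNReal.ofReal (t ^ (-a)) := by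
    intro l
    rw [← ENNReal.ofReal_mul (by positivity)]
    apply ENNReal.ofReal_le_ofReal
    have h := rpow_mul_one_add_le ha hab (s := 2 ^ l * t) (by positivity) (m := (l : ℤ) + M)
      (by rw [zpow_add₀ two_ne_zero, zpow_natCast]; gcongr)
      (by rw [add_assoc, zpow_add₀ two_ne_zero, zpow_natCast]; gcongr)
    calc ((2 : ℝ) ^ l) ^ a * ((1 + 2 ^ l * t) ^ b)⁻¹
        = ((2 ^ l * t) ^ a * ((1 + 2 ^ l * t) ^ b)⁻¹) * t ^ (-a) := by
          rw [Real.mul_rpow (by positivity) ht.le, Real.rpow_neg ht.le]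
          have : t ^ a ≠ 0 := by positivity
          field_simp
      _ ≤ _ := by gcongr
  calc _ ≤ ∑' l : ℕ, ENNReal.ofReal (2 ^ a * q ^ ((l : ℤ) + M).natAbs) * ENNReal.ofReal (t ^
         (-a)) :=
        ENNReal.tsum_le_tsum hterm
    _ = (∑' l : ℕ, ENNReal.ofReal (2 ^ a * q ^ ((l : ℤ) + M).natAbs)) * ENNReal.ofReal (t ^ (-a)) :=
        ENNReal.tsum_mul_right
    _ ≤ (∑' m : ℤ, ENNReal.ofReal (2 ^ a * q ^ m.natAbs)) * ENNReal.ofReal (t ^ (-a)) := by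
        gcongr
        exact ENNReal.tsum_comp_le_tsum_of_injective (f := fun l : ℕ => (l : ℤ) + M)
          (fun x y h => by simpa using h) fun m : ℤ => ENNReal.ofReal (2 ^ a * q ^ m.natAbs)
    _ ≤ _ := by
        rw [← ENNReal.ofReal_tsum_of_nonneg (fun m => by positivity) hsum,
          ← ENNReal.ofReal_mul (tsum_nonneg fun m => by positivity)]
        apply ENNReal.ofReal_le_ofReal
        gcongr
        linarith

end DyadicSum

section Kernel

open scoped SchwartzMap

variable {n : ℕ}

theorem integrable_decayWt (l : ℕ) : Integrable (decayWt n l) volume := by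
  have h0 : Integrable (fun x : Euc n => ((1 + ‖x‖) ^ (n + 1))⁻¹) volume := by
    have := integrable_one_add_norm (E := Euc n) (μ := volume) (r := (n : ℝ) + 1) (by simp)
    refine this.congr (Eventually.of_forall fun x => ?_)
    change (1 + ‖x‖) ^ (-((n : ℝ) + 1)) = _
    rw [Real.rpow_neg (by positivity)]
    norm_cast
  have h1 := (h0.comp_smul (R := (2 : ℝ) ^ l) (by positivity)).const_mul ((2 : ℝ) ^ (l * n))
  refine h1.congr (Eventually.of_forall fun x => ?_)
  simp [decayWt, norm_smul]

theorem lintegral_decayWt (l : ℕ) : ∫⁻ x, ENNReal.ofReal (decayWt n l x) =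
    ENNReal.ofReal (∫ x, decayWt n 0 x) := by
  rw [← ofReal_integral_eq_lintegral_ofReal (integrable_decayWt l)
    (Eventually.of_forall (decayWt_nonneg l))]
  congr 1
  rw [← integral_dil (decayWt n 0) l]
  congr 1
  funext x
  simp [decayWt, dil, norm_smul]

theorem lintegral_decayWt_sub (l : ℕ) (y : Euc n) : ∫⁻ x, ENNReal.ofReal (decayWt n l (x - y)) =
    ENNReal.ofReal (∫ x, decayWt n 0 x) := by
  rw [lintegral_sub_right_eq_self (fun x => ENNReal.ofReal (decayWt n l x)), lintegral_decayWt]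

theorem exists_norm_dil_sub_le {F : Type*} [NormedAddCommGroup F] [NormedSpace ℝ F]
    (Φ : 𝓢(Euc n, F)) : ∃ C : ℝ, 0 < C ∧ ∀ (l : ℕ) (x h : Euc n), ‖h‖ ≤ ‖x‖ / 2 →
      ‖dil l Φ x - dil l Φ (x - h)‖ ≤
        C * (‖h‖ * (2 ^ l * ((1 + 2 ^ l * ‖x‖) ^ 2)⁻¹)) * decayWt n l x := by
  obtain ⟨C, hC0, hC⟩ := Φ.exists_decay_bound (n + 3) 1
  refine ⟨C * 2 ^ (n + 3), by positivity, fun l x h hh => ?_⟩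
  set X := (2 : ℝ) ^ l • x with hX
  have hXn : ‖X‖ = 2 ^ l * ‖x‖ := by rw [hX, norm_smul]; simp
  set H := (2 : ℝ) ^ l • h with hH
  have hHn : ‖H‖ = 2 ^ l * ‖h‖ := by rw [hH, norm_smul]; simp
  have hseg : ∀ w ∈ segment ℝ (X - H) X, ‖fderiv ℝ Φ w‖ ≤ C * 2 ^ (n + 3) * ((1 + ‖X‖) ^
    (n + 3))⁻¹ := by
    intro w hw
    rw [segment_eq_image'] at hw
    obtain ⟨t, ht, rfl⟩ := hw
    have hw : 1 + ‖X‖ ≤ 2 * (1 + ‖X - H + t • (X - (X - H))‖) := by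
      have e : X - H + t • (X - (X - H)) = X - (1 - t) • H := by module
      rw [e]
      have h1 := norm_sub_norm_le X ((1 - t) • H)
      have h2 : ‖(1 - t) • H‖ ≤ ‖H‖ := by
        rw [norm_smul, Real.norm_of_nonneg (by linarith [ht.2])]
        exact mul_le_of_le_one_left (norm_nonneg _) (by linarith [ht.1])
      have h3 : ‖H‖ ≤ ‖X‖ / 2 := by rw [hHn, hXn, mul_div_assoc]; gcongr
      linarith
    rw [← norm_iteratedFDeriv_one]
    refine (hC 1 le_rfl _).trans ?_
    rw [mul_assoc]
    gcongr
    rw [← div_eq_mul_inv, inv_le_iff_one_le_mul₀ (by positivity), ← mul_div_right_comm,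
      one_le_div (by positivity), ← mul_pow]
    gcongr
  have hmv := (convex_segment (𝕜 := ℝ) (X - H) X).norm_image_sub_le_of_norm_fderiv_le
    (fun w _ => Φ.differentiableAt) hseg (left_mem_segment ℝ _ _) (right_mem_segment ℝ _ _)
  unfold dil decayWt
  rw [← smul_sub, norm_smul, Real.norm_of_nonneg (by positivity), smul_sub, ← hX, ← hH]
  rw [sub_sub_cancel, hHn, hXn] at hmv
  refine (mul_le_mul_of_nonneg_left hmv (by positivity)).trans (le_of_eq ?_)
  have : (1 + 2 ^ l * ‖x‖) ≠ 0 := by positivity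
  field_simp
  ring

end Kernel

section Smear

variable {n : ℕ}

/-- The uniform probability density on the ball `B(y, dist(y, F) / 2)`. -/
noncomputable def smear (F : Set (Euc n)) (y z : Euc n) : ℝ :=
  (ball y (infDist y F / 2)).indicator
    (fun _ => ((infDist y F / 2) ^ n * volume.real (ball (0 : Euc n) 1))⁻¹) z

variable {F : Set (Euc n)}

theorem volume_real_unitBall_pos : 0 < volume.real (ball (0 : Euc n) 1) :=
  ENNReal.toReal_pos volume_unitBall_ne_zero volume_unitBall_ne_top

theorem smear_nonneg (y z : Euc n) : 0 ≤ smear F y z := by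
  refine Set.indicator_nonneg (fun _ _ => ?_) _
  have := infDist_nonneg (x := y) (s := F)
  positivity

theorem measurable_smear : Measurable fun q : Euc n × Euc n => smear F q.1 q.2 := by
  have : (fun q : Euc n × Euc n => smear F q.1 q.2) =
      {q : Euc n × Euc n | dist q.2 q.1 < infDist q.1 F / 2}.indicator
        (fun q => ((infDist q.1 F / 2) ^ n * volume.real (ball (0 : Euc n) 1))⁻¹) := by
    funext q
    simp only [smear, Set.indicator, mem_ball, Set.mem_ofPred_eq]
  rw [this]
  have h1 : Measurable fun q : Euc n × Euc n => infDist q.1 F / 2 :=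
    ((continuous_infDist_pt F).measurable.comp measurable_fst).div_const _
  refine Measurable.indicator (((h1.pow_const _).mul_const _).inv) ?_
  exact measurableSet_lt (measurable_snd.dist measurable_fst) h1

theorem measurable_smear_left (y : Euc n) : Measurable fun z => smear F y z := by
  have h := (measurable_smear (F := F)).comp (measurable_prodMk_left (x := y))
  simpa only [Function.comp_def] using h

theorem measurable_smear_right (z : Euc n) : Measurable fun y => smear F y z := by
  have h := (measurable_smear (F := F)).comp (measurable_prodMk_right (y := z))
  simpa only [Function.comp_def] using h

theorem infDist_pos_of_notMem (hF : IsClosed F) (hne : F.Nonempty) {y : Euc n} (hy : y ∉ F) :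
    0 < infDist y F := (hF.notMem_iff_infDist_pos hne).1 hy

theorem lintegral_smear (hF : IsClosed F) (hne : F.Nonempty) {y : Euc n} (hy : y ∉ F) :
    ∫⁻ z, ENNReal.ofReal (smear F y z) = 1 := by
  have hd := infDist_pos_of_notMem hF hne hy
  have : ∀ z, ENNReal.ofReal (smear F y z) = (ball y (infDist y F / 2)).indicator (fun _ =>
      ENNReal.ofReal ((infDist y F / 2) ^ n * volume.real (ball (0 : Euc n) 1))⁻¹) z := by
    intro z
    unfold smear
    by_cases hz : z ∈ ball y (infDist y F / 2) <;> simp [hz]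
  simp_rw [this]
  rw [lintegral_indicator measurableSet_ball, setLIntegral_const, volume_ball_euc _ (by positivity),
    ← ENNReal.ofReal_toReal (volume_unitBall_ne_top (n := n)), ← ENNReal.ofReal_mul (by positivity),
    ← ENNReal.ofReal_mul (by have := volume_real_unitBall_pos (n := n); positivity)]
  change ENNReal.ofReal (((infDist y F / 2) ^ n * volume.real (ball (0 : Euc n) 1))⁻¹ *
    ((infDist y F / 2) ^ n * volume.real (ball (0 : Euc n) 1))) = 1
  rw [inv_mul_cancel₀, ENNReal.ofReal_one]
  have := volume_real_unitBall_pos (n := n)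
  positivity

theorem integrable_smear (hF : IsClosed F) (hne : F.Nonempty) {y : Euc n} (hy : y ∉ F) :
    Integrable (smear F y) volume := by
  refine ⟨(measurable_smear_left y).aestronglyMeasurable, ?_⟩
  rw [hasFiniteIntegral_iff_ofReal (Eventually.of_forall (smear_nonneg y)),
    lintegral_smear hF hne hy]
  exact ENNReal.one_lt_top

theorem integral_smear (hF : IsClosed F) (hne : F.Nonempty) {y : Euc n} (hy : y ∉ F) :
    ∫ z, smear F y z = 1 := by
  rw [integral_eq_lintegral_of_nonneg_ae (Eventually.of_forall (smear_nonneg y))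
    (measurable_smear_left y).aestronglyMeasurable, lintegral_smear hF hne hy, ENNReal.toReal_one]

theorem smear_le (y z : Euc n) :
    smear F y z ≤ (ball z (infDist z F)).indicator
      (fun _ => ((infDist z F / 3) ^ n * volume.real (ball (0 : Euc n) 1))⁻¹) y := by
  have := volume_real_unitBall_pos (n := n)
  unfold smear
  by_cases hz : z ∈ ball y (infDist y F / 2)
  · have h1 := infDist_le_infDist_add_dist (s := F) (x := y) (y := z)
    have h2 := infDist_le_infDist_add_dist (s := F) (x := z) (y := y)
    have hz' := mem_ball.1 hz
    rw [dist_comm y z] at h1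
    have h3 : y ∈ ball z (infDist z F) := by rw [mem_ball, dist_comm]; linarith
    have h4 : 0 ≤ dist z y := dist_nonneg
    rw [Set.indicator_of_mem hz, Set.indicator_of_mem h3]
    have h5 : 0 < infDist z F := by linarith
    gcongr ((?_) ^ n * _)⁻¹
    linarith
  · rw [Set.indicator_of_notMem hz]
    refine Set.indicator_nonneg (fun _ _ => ?_) _
    have := infDist_nonneg (x := z) (s := F)
    positivity

variable {σ : Measure (Euc n)} {A : ℝ}

theorem lintegral_smear_measure_le (hne : F.Nonempty)
    (hσ : ∀ x ∈ F, ∀ r : ℝ, 0 < r → σ (ball x r) ≤ ENNReal.ofReal (A * r ^ n)) (z : Euc n) :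
    ∫⁻ y, ENNReal.ofReal (smear F y z) ∂σ ≤
      ENNReal.ofReal (A * 9 ^ n / volume.real (ball (0 : Euc n) 1)) := by
  have hω := volume_real_unitBall_pos (n := n)
  set d := infDist z F with hd
  have hd0 : 0 ≤ d := infDist_nonneg
  calc ∫⁻ y, ENNReal.ofReal (smear F y z) ∂σ
      ≤ ∫⁻ y, (ball z d).indicator (fun _ =>
          ENNReal.ofReal ((d / 3) ^ n * volume.real (ball (0 : Euc n) 1))⁻¹) y ∂σ := by
        refine lintegral_mono fun y => ?_
        refine (ENNReal.ofReal_le_ofReal (smear_le y z)).trans (le_of_eq ?_)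
        by_cases hy : y ∈ ball z d <;> simp [← hd, hy]
    _ = ENNReal.ofReal ((d / 3) ^ n * volume.real (ball (0 : Euc n) 1))⁻¹ * σ (ball z d) := by
        rw [lintegral_indicator measurableSet_ball, setLIntegral_const]
    _ ≤ _ := by
        rcases hd0.eq_or_lt with h0 | h0
        · rw [← h0, ball_zero, measure_empty, mul_zero]; exact zero_le
        · obtain ⟨x, hx, hxz⟩ := (infDist_lt_iff hne).1 (show infDist z F < 2 * d by linarith)
          have hb : ball z d ⊆ ball x (3 * d) := ball_subset_ball' (by linarith)
          calc _ ≤ ENNReal.ofReal ((d / 3) ^ n * volume.real (ball (0 : Euc n) 1))⁻¹ *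
                ENNReal.ofReal (A * (3 * d) ^ n) := by
                gcongr
                exact (measure_mono hb).trans (hσ x hx _ (by positivity))
            _ = _ := by
                rw [← ENNReal.ofReal_mul (by positivity)]
                congr 1
                rw [show (9 : ℝ) = 3 * 3 by norm_num, mul_pow, mul_pow, div_pow]
                field_simp

theorem norm_sub_integral_smear_le (hF : IsClosed F) (hne : F.Nonempty) {q : Euc n → ℝ}
    (hq : Continuous q) {C : ℝ} (hC : ∀ z, ‖q z‖ ≤ C) {y : Euc n} (hy : y ∉ F) {M : ℝ}
    (hM : ∀ z, dist z y < infDist y F / 2 → ‖q y - q z‖ ≤ M) :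
    ‖q y - ∫ z, q z * smear F y z‖ ≤ M := by
  have hi := integrable_smear hF hne hy
  have h1 : Integrable (fun z => q z * smear F y z) volume :=
    hi.bdd_mul hq.aestronglyMeasurable (Eventually.of_forall hC)
  have e : q y - ∫ z, q z * smear F y z = ∫ z, (q y - q z) * smear F y z := by
    simp_rw [sub_mul]
    rw [integral_sub (hi.const_mul _) h1, integral_const_mul, integral_smear hF hne hy, mul_one]
  rw [e]
  calc _ ≤ ∫ z, M * smear F y z := by
        refine norm_integral_le_of_norm_le (hi.const_mul _) (Eventually.of_forall fun z => ?_)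
        rw [norm_mul, Real.norm_of_nonneg (smear_nonneg y z)]
        by_cases hz : z ∈ ball y (infDist y F / 2)
        · gcongr
          · exact smear_nonneg y z
          · exact hM z hz
        · simp [smear, Set.indicator_of_notMem hz]
    _ = M := by rw [integral_const_mul, integral_smear hF hne hy, mul_one]

variable [IsFiniteMeasure σ]

theorem integrable_smear_prod (hF : IsClosed F) (hne : F.Nonempty) :
    Integrable (fun q : Euc n × Euc n => smear F q.1 q.2) ((σ.restrict Fᶜ).prod volume) := by
  refine ⟨measurable_smear.aestronglyMeasurable, ?_⟩
  rw [hasFiniteIntegral_iff_ofReal (Eventually.of_forall fun q => smear_nonneg _ _),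
    lintegral_prod _ measurable_smear.ennreal_ofReal.aemeasurable]
  calc ∫⁻ y in Fᶜ, ∫⁻ z, ENNReal.ofReal (smear F y z) ∂volume ∂σ = ∫⁻ y in Fᶜ, 1 ∂σ :=
        setLIntegral_congr_fun hF.measurableSet.compl fun y hy => lintegral_smear hF hne hy
    _ < ⊤ := by simp [measure_lt_top]

/-- The smeared density of `σ` restricted to the complement of `F`. -/
noncomputable def smearDensity (σ : Measure (Euc n)) (F : Set (Euc n)) (z : Euc n) : ℝ :=
  ∫ y in Fᶜ, smear F y z ∂σ

theorem memLp_smearDensity (hF : IsClosed F) (hne : F.Nonempty) (hA : 0 ≤ A)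
    (hσ : ∀ x ∈ F, ∀ r : ℝ, 0 < r → σ (ball x r) ≤ ENNReal.ofReal (A * r ^ n)) :
    MemLp (smearDensity σ F) 2 volume := by
  have hint : Integrable (smearDensity σ F) volume :=
    (integrable_smear_prod (σ := σ) hF hne).integral_prod_right
  have hω := volume_real_unitBall_pos (n := n)
  set B := A * 9 ^ n / volume.real (ball (0 : Euc n) 1) with hB
  have hb : ∀ z, ‖smearDensity σ F z‖ ≤ B := by
    intro z
    have h := lintegral_smear_measure_le hne hσ z
    rw [← hB] at h
    have h' : ∫⁻ y in Fᶜ, ENNReal.ofReal (smear F y z) ∂σ ≤ ENNReal.ofReal B :=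
      (setLIntegral_le_lintegral _ _).trans h
    rw [smearDensity, integral_eq_lintegral_of_nonneg_ae
      (Eventually.of_forall fun y => smear_nonneg y z)
      (measurable_smear_right z).aestronglyMeasurable,
      Real.norm_of_nonneg ENNReal.toReal_nonneg]
    exact ENNReal.toReal_le_of_le_ofReal (by positivity) h'
  rw [memLp_two_iff_integrable_sq hint.aestronglyMeasurable]
  refine (hint.bdd_mul hint.aestronglyMeasurable (Eventually.of_forall hb)).congr
    (Eventually.of_forall fun z => ?_)
  simp [sq]

theorem integral_mul_smearDensity (hF : IsClosed F) (hne : F.Nonempty) {q : Euc n → ℝ}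
    (hq : Continuous q) {C : ℝ} (hC : ∀ z, ‖q z‖ ≤ C) :
    ∫ z, q z * smearDensity σ F z = ∫ y in Fᶜ, ∫ z, q z * smear F y z ∂volume ∂σ := by
  simp_rw [smearDensity, ← integral_const_mul]
  refine (integral_integral_swap (f := fun y z => q z * smear F y z) ?_).symm
  exact (integrable_smear_prod (σ := σ) hF hne).bdd_mul
    (hq.comp continuous_snd).aestronglyMeasurable (Eventually.of_forall fun p => hC p.2)

theorem integrable_integral_mul_smear (hF : IsClosed F) (hne : F.Nonempty) {q : Euc n → ℝ}
    (hq : Continuous q) {C : ℝ} (hC : ∀ z, ‖q z‖ ≤ C) :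
    Integrable (fun y => ∫ z, q z * smear F y z) (σ.restrict Fᶜ) :=
  ((integrable_smear_prod hF hne).bdd_mul
    (hq.comp continuous_snd).aestronglyMeasurable
    (Eventually.of_forall fun p => hC p.2)).integral_prod_left

end Smear

section Star

open scoped SchwartzMap

variable {n : ℕ}

/-- The points where `σ` has at most `n`-dimensional growth with constant `A`. -/
def growthSet (σ : Measure (Euc n)) (A : ℝ) : Set (Euc n) :=
  {x | ∀ r : ℝ, 0 < r → σ (ball x r) ≤ ENNReal.ofReal (A * r ^ n)}

theorem isClosed_growthSet (σ : Measure (Euc n)) (A : ℝ) : IsClosed (growthSet σ A) := by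
  refine isClosed_of_closure_subset fun x hx r hr => ?_
  obtain ⟨u, hu, hux⟩ := mem_closure_iff_seq_limit.1 hx
  have h1 : ∀ m, σ (ball x r) ≤ ENNReal.ofReal (A * (r + dist x (u m)) ^ n) := fun m =>
    (measure_mono (ball_subset_ball' le_rfl)).trans (hu m _ (by positivity))
  have h2 : Tendsto (fun m => ENNReal.ofReal (A * (r + dist x (u m)) ^ n)) atTop
      (𝓝 (ENNReal.ofReal (A * (r + dist x x) ^ n))) := by
    have : Continuous fun y => ENNReal.ofReal (A * (r + dist x y) ^ n) :=
      ENNReal.continuous_ofReal.comp (by fun_prop)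
    exact (this.tendsto x).comp hux
  rw [dist_self, add_zero] at h2
  exact ge_of_tendsto' h2 h1

theorem ae_mem_growthSet (σ : Measure (Euc n)) [IsFiniteMeasure σ] :
    ∀ᵐ x ∂(volume : Measure (Euc n)), ∃ A : ℕ, x ∈ growthSet σ A := by
  filter_upwards [Besicovitch.ae_tendsto_rnDeriv σ (volume : Measure (Euc n)),
    Measure.rnDeriv_lt_top σ (volume : Measure (Euc n))] with x hx hlt
  obtain ⟨Q, hQ, hQt⟩ := exists_between hlt
  have hev := hx.eventually (Iio_mem_nhds hQ)
  rw [eventually_nhdsWithin_iff, Metric.eventually_nhds_iff] at hev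
  obtain ⟨δ, hδ, hev⟩ := hev
  set ω := volume (ball (0 : Euc n) 1)
  have hω : ω ≠ ⊤ := volume_unitBall_ne_top
  obtain ⟨A, hA⟩ := exists_nat_gt (max (Q * ω).toReal ((σ Set.univ).toReal / δ ^ n))
  refine ⟨A, fun r hr => ?_⟩
  rcases lt_or_ge r δ with h | h
  · have h3 : σ (closedBall x r) / volume (closedBall x r) < Q :=
      hev (by rwa [Real.dist_eq, sub_zero, abs_of_pos hr]) hr
    rw [ENNReal.div_lt_iff (Or.inl (measure_closedBall_pos _ _ hr).ne')
      (Or.inl measure_closedBall_lt_top.ne), volume_closedBall_euc _ hr] at h3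
    calc σ (ball x r) ≤ σ (closedBall x r) := measure_mono ball_subset_closedBall
      _ ≤ ENNReal.ofReal (Q * ω).toReal * ENNReal.ofReal (r ^ n) := by
          rw [ENNReal.ofReal_toReal (ENNReal.mul_ne_top hQt.ne hω)]
          refine h3.le.trans (le_of_eq ?_)
          ring
      _ ≤ _ := by
          rw [ENNReal.ofReal_mul (by positivity)]
          gcongr
          exact (le_max_left _ _).trans hA.le
  · have h1 : (σ Set.univ).toReal ≤ A * r ^ n := by
      have h2 : (σ Set.univ).toReal / δ ^ n ≤ A := (le_max_right _ _).trans hA.le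
      rw [div_le_iff₀ (by positivity)] at h2
      exact h2.trans (by gcongr)
    calc σ (ball x r) ≤ σ Set.univ := measure_mono (Set.subset_univ _)
      _ ≤ _ := by
          rw [← ENNReal.ofReal_toReal (measure_ne_top σ Set.univ)]
          exact ENNReal.ofReal_le_ofReal h1

theorem restrict_growthSet_le (σ : Measure (Euc n)) [IsFiniteMeasure σ] (A : ℝ) :
    σ.restrict (growthSet σ A) ≤
      (ENNReal.ofReal (A * 2 ^ n) / volume (ball (0 : Euc n) 1)) • (volume : Measure (Euc n)) := by
  set c := ENNReal.ofReal (A * 2 ^ n) / volume (ball (0 : Euc n) 1) with hc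
  have hct : c ≠ ⊤ := ENNReal.div_ne_top ENNReal.ofReal_ne_top volume_unitBall_ne_zero
  have : IsLocallyFiniteMeasure (c • (volume : Measure (Euc n))) := by
    rw [← ENNReal.coe_toNNReal hct]
    exact inferInstanceAs (IsLocallyFiniteMeasure (c.toNNReal • (volume : Measure (Euc n))))
  refine Measure.le_intro fun s hs _ => ?_
  rw [Measure.restrict_apply hs]
  refine le_trans ?_ (measure_mono (Set.inter_subset_left (t := growthSet σ A)))
  refine (Besicovitch.vitaliFamily σ).measure_le_of_frequently_le _ Measure.AbsolutelyContinuous.rfl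
    _ fun x hx => ?_
  have h := Besicovitch.tendsto_filterAt σ x
  refine h.frequently (Eventually.frequently ?_)
  filter_upwards [self_mem_nhdsWithin] with r hr
  have hr : 0 < r := hr
  calc σ (closedBall x r) ≤ σ (ball x (2 * r)) :=
        measure_mono (closedBall_subset_ball (by linarith))
    _ ≤ ENNReal.ofReal (A * (2 * r) ^ n) := hx.2 _ (by positivity)
    _ = _ := by
        rw [Measure.smul_apply, smul_eq_mul, volume_closedBall_euc _ hr, hc, mul_left_comm,
          ENNReal.div_mul_cancel volume_unitBall_ne_zero volume_unitBall_ne_top,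
          ← ENNReal.ofReal_mul (by positivity)]
        congr 1
        rw [mul_pow]; ring

theorem exists_memLp_density {ρ : Measure (Euc n)} [IsFiniteMeasure ρ] {c : ℝ≥0∞} (hc : c ≠ ⊤)
    (h : ρ ≤ c • (volume : Measure (Euc n))) : ∃ g : Euc n → ℝ, MemLp g 2 volume ∧
      ∀ q : Euc n → ℝ, ∫ y, q y ∂ρ = ∫ y, q y * g y := by
  have hac : ρ ≪ volume :=
    (Measure.absolutelyContinuous_of_le h).trans Measure.smul_absolutelyContinuous
  have hle : ρ.rnDeriv volume ≤ᵐ[volume] fun _ => c := by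
    refine ae_le_of_forall_setLIntegral_le_of_sigmaFinite (Measure.measurable_rnDeriv _ _)
      fun s hs _ => ?_
    rw [Measure.setLIntegral_rnDeriv hac, setLIntegral_const]
    exact h s
  have hint := Measure.integrable_toReal_rnDeriv (μ := ρ) (ν := (volume : Measure (Euc n)))
  refine ⟨fun y => (ρ.rnDeriv volume y).toReal, ?_, fun q => ?_⟩
  · rw [memLp_two_iff_integrable_sq hint.aestronglyMeasurable]
    refine (hint.bdd_mul (c := c.toReal) hint.aestronglyMeasurable ?_).congr
      (Eventually.of_forall fun z => (sq _).symm)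
    filter_upwards [hle] with y hy
    rw [Real.norm_of_nonneg ENNReal.toReal_nonneg]
    exact ENNReal.toReal_mono hc hy
  · rw [← integral_rnDeriv_smul hac]
    simp_rw [smul_eq_mul, mul_comm]

theorem exists_dilRemainder_bound (ψ : 𝓢(Euc n, ℝ)) : ∃ C : ℝ, 0 < C ∧
    ∀ {F : Set (Euc n)}, IsClosed F → F.Nonempty → ∀ x ∈ F, ∀ y ∉ F, ∀ l : ℕ,
      ‖dil l ψ (x - y) - ∫ z, dil l ψ (x - z) * smear F y z‖ ≤
        C * (infDist y F * (2 ^ l * ((1 + 2 ^ l * infDist y F) ^ 2)⁻¹)) * decayWt n l (x - y) := by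
  obtain ⟨C, hC0, hC⟩ := exists_norm_dil_sub_le ψ
  refine ⟨C, hC0, fun {F} hF hne x hx y hy l => ?_⟩
  have hd := infDist_pos_of_notMem hF hne hy
  have hxy : infDist y F ≤ ‖x - y‖ := by
    rw [← dist_eq_norm, dist_comm]; exact infDist_le_dist_of_mem hx
  obtain ⟨B, _, hB⟩ := (dilS l ψ).exists_decay_bound 0 0
  refine norm_sub_integral_smear_le (q := fun z => dil l ψ (x - z)) hF hne
    ((continuous_dil ψ.continuous l).comp (continuous_sub_left x)) (C := B)
    (fun z => by simpa [coe_dilS] using hB 0 le_rfl (x - z)) hy fun z hz => ?_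
  have hz' : ‖z - y‖ < infDist y F / 2 := by rwa [← dist_eq_norm]
  have h := hC l (x - y) (z - y) (by linarith)
  rw [sub_sub_sub_cancel_right] at h
  refine h.trans ?_
  have := decayWt_nonneg l (x - y)
  gcongr
  linarith

theorem tsum_ofReal_two_pow_le : ∃ D : ℝ, 0 < D ∧ ∀ C d : ℝ, 0 < C → 0 < d →
    ∑' l : ℕ, ENNReal.ofReal (C * (d * (2 ^ l * ((1 + 2 ^ l * d) ^ 2)⁻¹))) ≤
      ENNReal.ofReal (C * D) := by
  obtain ⟨D, hD0, hD⟩ := exists_tsum_dyadic_le (a := 1) (b := 2) one_pos one_lt_two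
  refine ⟨D, hD0, fun C d hC hd => ?_⟩
  calc _ = ENNReal.ofReal (C * d) *
        ∑' l : ℕ, ENNReal.ofReal ((2 ^ l) ^ (1 : ℝ) * ((1 + 2 ^ l * d) ^ (2 : ℝ))⁻¹) := by
        rw [← ENNReal.tsum_mul_left]
        refine tsum_congr fun l => ?_
        rw [← ENNReal.ofReal_mul (by positivity), Real.rpow_one, Real.rpow_ofNat]
        ring_nf
    _ ≤ ENNReal.ofReal (C * d) * ENNReal.ofReal (D * d ^ (-1 : ℝ)) := by
        gcongr; exact hD _ hd
    _ = _ := by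
        rw [← ENNReal.ofReal_mul (by positivity), Real.rpow_neg_one]
        congr 1
        field_simp

theorem measurable_mul_decayWt {w : Euc n → ℝ≥0∞} (hw : Measurable w) (l : ℕ) :
    Measurable fun q : Euc n × Euc n => w q.2 * ENNReal.ofReal (decayWt n l (q.1 - q.2)) :=
  (hw.comp measurable_snd).mul (ENNReal.measurable_ofReal.comp
    ((continuous_decayWt l).comp (continuous_fst.sub continuous_snd)).measurable)

theorem lintegral_tsum_mul_decayWt {w : ℕ → Euc n → ℝ≥0∞} (hw : ∀ l, Measurable (w l))
    (σ : Measure (Euc n)) [SFinite σ] :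
    ∫⁻ x, ∑' l, ∫⁻ y, w l y * ENNReal.ofReal (decayWt n l (x - y)) ∂σ =
      ∫⁻ y, (∑' l, w l y) * ENNReal.ofReal (∫ x, decayWt n 0 x) ∂σ := by
  calc _ = ∑' l, ∫⁻ x, ∫⁻ y, w l y * ENNReal.ofReal (decayWt n l (x - y)) ∂σ :=
        lintegral_tsum fun l => (measurable_mul_decayWt (hw l) l).lintegral_prod_right'.aemeasurable
    _ = ∑' l, ∫⁻ y, w l y * ENNReal.ofReal (∫ x, decayWt n 0 x) ∂σ := by
        refine tsum_congr fun l => ?_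
        rw [lintegral_lintegral_swap (measurable_mul_decayWt (hw l) l).aemeasurable]
        refine lintegral_congr fun y => ?_
        rw [lintegral_const_mul _ (by
          exact ENNReal.measurable_ofReal.comp ((continuous_decayWt l).comp
            (continuous_sub_right y)).measurable), lintegral_decayWt_sub]
    _ = _ := by
        rw [← lintegral_tsum fun l => ((hw l).mul_const _).aemeasurable]
        simp_rw [ENNReal.tsum_mul_right]

theorem ae_summable_dilRemainder (ψ : 𝓢(Euc n, ℝ)) {F : Set (Euc n)} (hF : IsClosed F)
    (hne : F.Nonempty) (σ : Measure (Euc n)) [IsFiniteMeasure σ] :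
    ∀ᵐ x ∂(volume : Measure (Euc n)), x ∈ F → Summable fun l : ℕ =>
      ∫ y in Fᶜ, (dil l ψ (x - y) - ∫ z, dil l ψ (x - z) * smear F y z) ∂σ := by
  obtain ⟨C, hC0, hC⟩ := exists_dilRemainder_bound ψ
  obtain ⟨D, hD0, hD⟩ := tsum_ofReal_two_pow_le
  set w : ℕ → Euc n → ℝ≥0∞ := fun l y => ENNReal.ofReal
    (C * (infDist y F * (2 ^ l * ((1 + 2 ^ l * infDist y F) ^ 2)⁻¹))) with hw
  have hwm : ∀ l, Measurable (w l) := fun l => by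
    have := (continuous_infDist_pt F).measurable
    exact ENNReal.measurable_ofReal.comp (by fun_prop)
  have hBm : Measurable fun x =>
      ∑' l, ∫⁻ y in Fᶜ, w l y * ENNReal.ofReal (decayWt n l (x - y)) ∂σ :=
    Measurable.tsum fun l => (measurable_mul_decayWt (hwm l) l).lintegral_prod_right'
  have hfin : ∫⁻ x, ∑' l, ∫⁻ y in Fᶜ, w l y * ENNReal.ofReal (decayWt n l (x - y)) ∂σ ≠ ⊤ := by
    rw [lintegral_tsum_mul_decayWt hwm]
    have h1 : ∫⁻ y in Fᶜ, (∑' l, w l y) * ENNReal.ofReal (∫ x, decayWt n 0 x) ∂σ ≤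
        ∫⁻ _ in Fᶜ, ENNReal.ofReal (C * D) * ENNReal.ofReal (∫ x, decayWt n 0 x) ∂σ :=
      setLIntegral_mono measurable_const fun y hy => by
        gcongr
        exact hD C _ hC0 (infDist_pos_of_notMem hF hne hy)
    rw [setLIntegral_const] at h1
    refine ne_top_of_le_ne_top ?_ h1
    exact ENNReal.mul_ne_top (ENNReal.mul_ne_top ENNReal.ofReal_ne_top ENNReal.ofReal_ne_top)
      (measure_ne_top _ _)
  filter_upwards [ae_lt_top hBm hfin] with x hx hxF
  refine Summable.of_enorm (ne_top_of_le_ne_top hx.ne (ENNReal.tsum_le_tsum fun l => ?_))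
  refine (enorm_integral_le_lintegral_enorm _).trans ?_
  have hm : Measurable fun y => w l y * ENNReal.ofReal (decayWt n l (x - y)) :=
    (hwm l).mul (ENNReal.measurable_ofReal.comp
      ((continuous_decayWt l).comp (continuous_sub_left x)).measurable)
  refine setLIntegral_mono hm fun y hy => ?_
  have h0 := infDist_nonneg (x := y) (s := F)
  rw [hw, ← ENNReal.ofReal_mul (by positivity), ← ofReal_norm]
  exact ENNReal.ofReal_le_ofReal (hC hF hne x hxF y hy l)

theorem ae_tendsto_dyadic_measure (ψ : 𝓢(Euc n, ℝ))
    (hψ : ∀ g : Euc n → ℝ, MemLp g 2 volume → ∀ᵐ x ∂(volume : Measure (Euc n)), ∃ c : ℝ,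
      Tendsto (fun N : ℕ => ∑ l ∈ Finset.range N, ∫ y, dil l ψ (x - y) * g y) atTop (𝓝 c))
    (σ : Measure (Euc n)) [IsFiniteMeasure σ] :
    ∀ᵐ x ∂(volume : Measure (Euc n)), ∃ c : ℝ,
      Tendsto (fun N : ℕ => ∑ l ∈ Finset.range N, ∫ y, dil l ψ (x - y) ∂σ) atTop (𝓝 c) := by
  suffices H : ∀ A : ℕ, ∀ᵐ x ∂(volume : Measure (Euc n)), x ∈ growthSet σ A → ∃ c : ℝ,
      Tendsto (fun N : ℕ => ∑ l ∈ Finset.range N, ∫ y, dil l ψ (x - y) ∂σ) atTop (𝓝 c) by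
    filter_upwards [ae_all_iff.2 H, ae_mem_growthSet σ] with x h1 ⟨A, hA⟩
    exact h1 A hA
  intro A
  set F := growthSet σ A with hFdef
  have hF : IsClosed F := isClosed_growthSet σ A
  rcases F.eq_empty_or_nonempty with h | hne
  · simp [h]
  obtain ⟨g1, hg1, hg1'⟩ := exists_memLp_density
    (ENNReal.div_ne_top ENNReal.ofReal_ne_top volume_unitBall_ne_zero)
    (restrict_growthSet_le σ A)
  have hg2 : MemLp (smearDensity σ F) 2 volume :=
    memLp_smearDensity hF hne (A := A) (by positivity) fun x hx => hx
  filter_upwards [hψ _ hg1, hψ _ hg2, ae_summable_dilRemainder ψ hF hne σ] with x ⟨c1, h1⟩ ⟨c2,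
    h2⟩ h3 hx
  refine ⟨_, ((h1.add h2).add (h3 hx).hasSum.tendsto_sum_nat).congr fun N => ?_⟩
  rw [← Finset.sum_add_distrib, ← Finset.sum_add_distrib]
  refine Finset.sum_congr rfl fun l _ => ?_
  have hq : Continuous fun z => dil l ψ (x - z) :=
    (continuous_dil ψ.continuous l).comp (continuous_sub_left x)
  obtain ⟨B, _, hB⟩ := (dilS l ψ).exists_decay_bound 0 0
  have hB' : ∀ z, ‖dil l ψ (x - z)‖ ≤ B := fun z => by simpa [coe_dilS] using hB 0 le_rfl (x - z)
  have hi := integrable_dil_measure ψ l x σ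
  rw [← hg1' fun y => dil l ψ (x - y), integral_mul_smearDensity hF hne hq hB',
    integral_sub hi.restrict (integrable_integral_mul_smear hF hne hq hB'),
    ← integral_add_compl hF.measurableSet hi]
  ring

end Star

section DyadicKernel

open scoped SchwartzMap

variable {n : ℕ} {G : Type*} [NormedAddCommGroup G]

theorem decayWt_le_two_pow (l : ℕ) (z : Euc n) : decayWt n l z ≤ 2 ^ (l * n) := by
  unfold decayWt
  refine mul_le_of_le_one_right (by positivity) (inv_le_one_of_one_le₀ (one_le_pow₀ ?_))
  have : 0 ≤ (2 : ℝ) ^ l * ‖z‖ := by positivity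
  linarith

theorem integrable_of_norm_le_decayWt [SecondCountableTopologyEither (Euc n) G] {k : Euc n → G}
    (hk : Continuous k) {C : ℝ} {l : ℕ} {x₀ : Euc n}
    (h : ∀ x, ‖k x‖ ≤ C * decayWt n l (x - x₀)) : Integrable k volume :=
  (((integrable_decayWt l).comp_sub_right x₀).const_mul C).mono' hk.aestronglyMeasurable
    (Eventually.of_forall h)

theorem integrable_measure_of_norm_le_decayWt [SecondCountableTopologyEither (Euc n) G]
    {k : Euc n → G} (hk : Continuous k) {C : ℝ}
    (hC : 0 ≤ C) {l : ℕ} {x₀ : Euc n} (h : ∀ x, ‖k x‖ ≤ C * decayWt n l (x - x₀))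
    (σ : Measure (Euc n)) [IsFiniteMeasure σ] : Integrable k σ :=
  Integrable.of_bound hk.aestronglyMeasurable (C * 2 ^ (l * n)) (Eventually.of_forall fun x =>
    (h x).trans (mul_le_mul_of_nonneg_left (decayWt_le_two_pow l _) hC))

theorem decayWt_le_of_half {l : ℕ} {z w : Euc n} (h : 1 + 2 ^ l * ‖w‖ ≤ 2 * (1 + 2 ^ l * ‖z‖)) :
    decayWt n l z ≤ 2 ^ (n + 1) * decayWt n l w := by
  unfold decayWt
  rw [mul_left_comm]
  gcongr
  rw [← div_eq_mul_inv, inv_le_comm₀ (by positivity) (by positivity), inv_div,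
    div_le_iff₀ (by positivity), ← mul_comm (2 ^ (n + 1) : ℝ), ← mul_pow]
  exact pow_le_pow_left₀ (by positivity) h _

/-- The rescaled kernel `2⁻ˡʲ 2ˡⁿ Φ(2ˡ ·)`. -/
noncomputable def dyKer (j l : ℕ) (Φ : Euc n → ℝ) (z : Euc n) : ℝ :=
  ((2 : ℝ) ^ (l * j))⁻¹ * dil l Φ z

theorem contDiff_dyKer {Φ : Euc n → ℝ} (hΦ : ContDiff ℝ (⊤ : ℕ∞) Φ) (j l : ℕ) :
    ContDiff ℝ (⊤ : ℕ∞) (dyKer j l Φ) := by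
  unfold dyKer dil
  fun_prop

theorem iteratedFDeriv_dyKer {Φ : Euc n → ℝ} (hΦ : ContDiff ℝ (⊤ : ℕ∞) Φ) (j l i : ℕ) (z : Euc n) :
    iteratedFDeriv ℝ i (dyKer j l Φ) z =
      (((2 : ℝ) ^ (l * j))⁻¹ * 2 ^ (l * i)) • dil l (iteratedFDeriv ℝ i Φ) z := by
  have hi : ContDiff ℝ i Φ := hΦ.of_le (by exact_mod_cast le_top)
  have h1 : dyKer j l Φ = fun z =>
      (((2 : ℝ) ^ (l * j))⁻¹ * 2 ^ (l * n)) • (fun z => Φ ((2 : ℝ) ^ l • z)) z := by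
    funext z; simp [dyKer, dil, mul_assoc]
  rw [h1, iteratedFDeriv_const_smul_apply' (by fun_prop), iteratedFDeriv_comp_const_smul _ hi]
  simp only [dil, smul_smul, ← pow_mul]
  congr 1
  ring

theorem exists_dyKer_bound (Φ : 𝓢(Euc n, ℝ)) (j : ℕ) : ∃ C : ℝ, 0 < C ∧
    ∀ i ≤ j + 1, ∀ l z, ‖iteratedFDeriv ℝ i (dyKer j l Φ) z‖ ≤
      C * (((2 : ℝ) ^ (l * j))⁻¹ * 2 ^ (l * i)) * decayWt n l z := by
  obtain ⟨C, hC0, hC⟩ := Φ.exists_decay_bound (n + 1) (j + 1)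
  refine ⟨C, hC0, fun i hi l z => ?_⟩
  rw [iteratedFDeriv_dyKer (Φ.smooth ⊤), norm_smul, Real.norm_of_nonneg (by positivity), mul_comm C,
    mul_assoc _ C]
  exact mul_le_mul_of_nonneg_left (norm_dil_le (hC i hi) l z) (by positivity)

theorem integral_iteratedFDeriv_dyKer (Φ : 𝓢(Euc n, ℝ)) {i : ℕ}
    (h : ∫ z, iteratedFDeriv ℝ i Φ z = 0) (j l : ℕ) (x : Euc n) :
    ∫ y, iteratedFDeriv ℝ i (dyKer j l Φ) (x - y) = 0 := by
  simp_rw [iteratedFDeriv_dyKer (Φ.smooth ⊤)]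
  rw [integral_smul, integral_sub_left_dil, h, smul_zero]

end DyadicKernel

section TaylorEstimates

open scoped SchwartzMap

variable {n : ℕ}

/-- Testing `σ` with a mean-zero kernel is controlled by `τ`. -/
def ControlsMeanZero (τ σ : Measure (Euc n)) : Prop :=
  ∀ {G : Type} [NormedAddCommGroup G] [NormedSpace ℝ G] (k : Euc n → G),
    Continuous k → Integrable k volume → Integrable k σ → ∫ y, k y = 0 →
      ‖∫ y, k y ∂σ‖ₑ ≤ ∫⁻ y, ‖k y‖ₑ ∂τ

theorem lintegral_le_decayInt {G : Type*} [NormedAddCommGroup G] {k : Euc n → G} {C : ℝ}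
    (hC : 0 ≤ C) {l : ℕ} {x₀ : Euc n}
    (h : ∀ x, ‖k x‖ ≤ C * decayWt n l (x - x₀)) (τ : Measure (Euc n)) :
    ∫⁻ x, ‖k x‖ₑ ∂τ ≤ ENNReal.ofReal C * decayInt τ x₀ l := by
  rw [decayInt, ← lintegral_const_mul' _ _ ENNReal.ofReal_ne_top]
  refine lintegral_mono fun x => ?_
  rw [← ofReal_norm, ← ENNReal.ofReal_mul hC]
  exact ENNReal.ofReal_le_ofReal (h x)

/-- The `i`-th Taylor coefficient at `x₀` of the convolution of `dyKer j l Φ` with `σ`. -/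
noncomputable def dyCoef (σ : Measure (Euc n)) (j l i : ℕ) (Φ : Euc n → ℝ) (x₀ : Euc n) :
    ContinuousMultilinearMap ℝ (fun _ : Fin i => Euc n) ℝ :=
  ∫ x, iteratedFDeriv ℝ i (dyKer j l Φ) (x₀ - x) ∂σ

theorem continuous_iteratedFDeriv_dyKer (Φ : 𝓢(Euc n, ℝ)) (j l i : ℕ) (x₀ : Euc n) :
    Continuous fun x => iteratedFDeriv ℝ i (dyKer j l Φ) (x₀ - x) :=
  ((contDiff_dyKer (Φ.smooth ⊤) j l).continuous_iteratedFDeriv (m := i)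
    (by exact_mod_cast le_top)).comp (continuous_sub_left x₀)

theorem exists_enorm_dyCoef_le (Φ : 𝓢(Euc n, ℝ)) (j : ℕ)
    (hmean : ∀ i ≤ j, ∫ z, iteratedFDeriv ℝ i Φ z = 0) : ∃ C : ℝ, 0 < C ∧
    ∀ (σ : Measure (Euc n)) [IsFiniteMeasure σ] (τ : Measure (Euc n)), ControlsMeanZero τ σ →
      ∀ i ≤ j, ∀ l x₀, ‖dyCoef σ j l i Φ x₀‖ₑ ≤
        ENNReal.ofReal (C * ((2 : ℝ) ^ (l * (j - i)))⁻¹) * decayInt τ x₀ l := by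
  obtain ⟨C, hC0, hC⟩ := exists_dyKer_bound Φ j
  refine ⟨C, hC0, fun σ _ τ hτ i hi l x₀ => ?_⟩
  have hexp : ((2 : ℝ) ^ (l * j))⁻¹ * 2 ^ (l * i) = ((2 : ℝ) ^ (l * (j - i)))⁻¹ := by
    rw [inv_mul_eq_iff_eq_mul₀ (by positivity), ← div_eq_mul_inv, eq_div_iff (by positivity),
      ← pow_add, ← mul_add]
    congr 2; omega
  have hb : ∀ x, ‖iteratedFDeriv ℝ i (dyKer j l Φ) (x₀ - x)‖ ≤
      C * ((2 : ℝ) ^ (l * (j - i)))⁻¹ * decayWt n l (x - x₀) := fun x => by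
    rw [← hexp, ← decayWt_neg l (x - x₀), neg_sub]
    exact hC i (by omega) l _
  have hc := continuous_iteratedFDeriv_dyKer Φ j l i x₀
  exact (hτ _ hc (integrable_of_norm_le_decayWt hc hb)
    (integrable_measure_of_norm_le_decayWt hc (by positivity) hb σ)
    (integral_iteratedFDeriv_dyKer Φ (hmean i hi) j l x₀)).trans
    (lintegral_le_decayInt (by positivity) hb τ)

theorem exists_enorm_sub_taylor_dyKer_le (Φ : 𝓢(Euc n, ℝ)) (j : ℕ)
    (hmean : ∀ i ≤ j, ∫ z, iteratedFDeriv ℝ i Φ z = 0) : ∃ C : ℝ, 0 < C ∧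
    ∀ (σ : Measure (Euc n)) [IsFiniteMeasure σ] (τ : Measure (Euc n)), ControlsMeanZero τ σ →
      ∀ l x₀ (h : Euc n), 2 ^ l * ‖h‖ ≤ 1 →
        ‖(∫ x, dyKer j l Φ (x₀ + h - x) ∂σ) - ∑ i ∈ Finset.range (j + 1),
          ((i.factorial : ℝ)⁻¹) • dyCoef σ j l i Φ x₀ (fun _ => h)‖ₑ ≤
        ENNReal.ofReal (C * 2 ^ l * ‖h‖ ^ (j + 1)) * decayInt τ x₀ l := by
  obtain ⟨C, hC0, hC⟩ := exists_dyKer_bound Φ j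
  refine ⟨C * 2 ^ (n + 1), by positivity, fun σ _ τ hτ l x₀ h hh => ?_⟩
  have hexp : ((2 : ℝ) ^ (l * j))⁻¹ * 2 ^ (l * (j + 1)) = 2 ^ l := by
    rw [inv_mul_eq_iff_eq_mul₀ (by positivity), ← pow_add]
    congr 1
  have hb : ∀ i ≤ j, ∀ x, ‖iteratedFDeriv ℝ i (dyKer j l Φ) (x₀ - x)‖ ≤
      C * (((2 : ℝ) ^ (l * j))⁻¹ * 2 ^ (l * i)) * decayWt n l (x - x₀) := fun i hi x => by
    rw [← decayWt_neg l (x - x₀), neg_sub]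
    exact hC i (by omega) l _
  have hint : ∀ i ≤ j, ∀ (ρ : Measure (Euc n)), (ρ = volume ∨ ρ = σ) →
      Integrable (fun x => iteratedFDeriv ℝ i (dyKer j l Φ) (x₀ - x)) ρ := by
    rintro i hi ρ (rfl | rfl)
    · exact integrable_of_norm_le_decayWt (continuous_iteratedFDeriv_dyKer Φ j l i x₀) (hb i hi)
    · exact integrable_measure_of_norm_le_decayWt (continuous_iteratedFDeriv_dyKer Φ j l i x₀)
        (by positivity) (hb i hi) _
  have hint' : ∀ i ≤ j, ∀ (ρ : Measure (Euc n)), (ρ = volume ∨ ρ = σ) →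
      Integrable (fun x => ((i.factorial : ℝ)⁻¹) •
        iteratedFDeriv ℝ i (dyKer j l Φ) (x₀ - x) (fun _ => h)) ρ := fun i hi ρ hρ =>
    ((ContinuousMultilinearMap.apply ℝ (fun _ : Fin i => Euc n) ℝ
      (fun _ => h)).integrable_comp (hint i hi ρ hρ)).fun_smul _
  have hK : ∀ (ρ : Measure (Euc n)), (ρ = volume ∨ ρ = σ) →
      Integrable (fun x => dyKer j l Φ (x₀ + h - x)) ρ := by
    have hcont : Continuous fun x => dyKer j l Φ (x₀ + h - x) :=
      (contDiff_dyKer (Φ.smooth ⊤) j l).continuous.comp (continuous_sub_left _)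
    have hb0 : ∀ x, ‖dyKer j l Φ (x₀ + h - x)‖ ≤
        C * (((2 : ℝ) ^ (l * j))⁻¹ * 2 ^ (l * 0)) * decayWt n l (x - (x₀ + h)) := fun x => by
      rw [← decayWt_neg l (x - (x₀ + h)), neg_sub]
      simpa using hC 0 (by omega) l (x₀ + h - x)
    rintro ρ (rfl | rfl)
    · exact integrable_of_norm_le_decayWt hcont hb0
    · exact integrable_measure_of_norm_le_decayWt hcont (by positivity) hb0 _
  set R : Euc n → ℝ := fun x => dyKer j l Φ (x₀ + h - x) - ∑ i ∈ Finset.range (j + 1),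
    ((i.factorial : ℝ)⁻¹) • iteratedFDeriv ℝ i (dyKer j l Φ) (x₀ - x) (fun _ => h) with hR
  have hRint : ∀ (ρ : Measure (Euc n)), (ρ = volume ∨ ρ = σ) →
      Integrable R ρ ∧ ∫ x, R x ∂ρ = (∫ x, dyKer j l Φ (x₀ + h - x) ∂ρ) -
        ∑ i ∈ Finset.range (j + 1), ((i.factorial : ℝ)⁻¹) •
          (∫ x, iteratedFDeriv ℝ i (dyKer j l Φ) (x₀ - x) ∂ρ) (fun _ => h) := by
    intro ρ hρ
    have hs : Integrable (fun x => ∑ i ∈ Finset.range (j + 1),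
        ((i.factorial : ℝ)⁻¹) • iteratedFDeriv ℝ i (dyKer j l Φ) (x₀ - x) (fun _ => h)) ρ :=
      integrable_finsetSum _ fun i hi => hint' i (Nat.lt_succ_iff.1 (Finset.mem_range.1 hi)) ρ hρ
    refine ⟨(hK ρ hρ).sub hs, ?_⟩
    rw [hR, integral_sub (hK ρ hρ) hs, integral_finsetSum _ fun i hi =>
      hint' i (Nat.lt_succ_iff.1 (Finset.mem_range.1 hi)) ρ hρ]
    congr 1
    refine Finset.sum_congr rfl fun i hi => ?_
    rw [integral_smul, ContinuousMultilinearMap.integral_apply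
      (hint i (Nat.lt_succ_iff.1 (Finset.mem_range.1 hi)) ρ hρ)]
  have hRbound : ∀ x, ‖R x‖ ≤ C * 2 ^ (n + 1) * 2 ^ l * ‖h‖ ^ (j + 1) * decayWt n l (x - x₀) := by
    intro x
    have := norm_sub_taylor_le (contDiff_dyKer (Φ.smooth ⊤) j l) j (x₀ - x) h
      (C := C * 2 ^ l * (2 ^ (n + 1) * decayWt n l (x₀ - x))) fun t ht => by
        have h1 := hC (j + 1) le_rfl l (x₀ - x + t • h)
        rw [hexp] at h1
        refine h1.trans (mul_le_mul_of_nonneg_left (decayWt_le_of_half ?_) (by positivity))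
        have h2 : ‖x₀ - x‖ ≤ ‖x₀ - x + t • h‖ + ‖t • h‖ := by
          simpa using norm_sub_le (x₀ - x + t • h) (t • h)
        have h3 : ‖t • h‖ ≤ ‖h‖ := by
          rw [norm_smul, Real.norm_of_nonneg ht.1]
          exact mul_le_of_le_one_left (norm_nonneg _) ht.2
        have h4 : (2 : ℝ) ^ l * ‖x₀ - x‖ ≤ 2 ^ l * ‖x₀ - x + t • h‖ + 2 ^ l * ‖h‖ := by
          rw [← mul_add]; gcongr; linarith
        have : (0 : ℝ) ≤ 2 ^ l * ‖x₀ - x + t • h‖ := by positivity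
        linarith
    rw [hR]
    have e : x₀ + h - x = x₀ - x + h := by abel
    rw [← decayWt_neg l (x - x₀), neg_sub]
    simp only [e]
    refine this.trans (le_of_eq ?_)
    ring
  have hRc : Continuous R := by
    refine ((contDiff_dyKer (Φ.smooth ⊤) j l).continuous.comp (continuous_sub_left _)).sub
      (continuous_finsetSum _ fun i _ => ((ContinuousMultilinearMap.apply ℝ
        (fun _ : Fin i => Euc n) ℝ (fun _ => h)).continuous.comp
        (continuous_iteratedFDeriv_dyKer Φ j l i x₀)).fun_const_smul _)
  have hR0 : ∫ x, R x = 0 := by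
    rw [(hRint volume (Or.inl rfl)).2]
    have h0 := integral_iteratedFDeriv_dyKer Φ (hmean 0 (by omega)) j l (x₀ + h)
    have h0' : ∫ x, dyKer j l Φ (x₀ + h - x) = 0 := by
      have := congrArg (fun M => M (fun _ => 0)) h0
      simp only [iteratedFDeriv_zero_eq_comp] at this
      rw [ContinuousMultilinearMap.integral_apply] at this
      · simpa using this
      · have := hint 0 (by omega) volume (Or.inl rfl)
        refine (this.comp_sub_right h).congr (Eventually.of_forall fun y => ?_)
        beta_reduce
        rw [show x₀ - (y - h) = x₀ + h - y by abel, iteratedFDeriv_zero_eq_comp]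
    rw [h0', zero_sub, neg_eq_zero]
    refine Finset.sum_eq_zero fun i hi => ?_
    rw [integral_iteratedFDeriv_dyKer Φ (hmean i (Nat.lt_succ_iff.1 (Finset.mem_range.1 hi)))]
    simp
  have hfin := hτ R hRc (hRint volume (Or.inl rfl)).1 (hRint σ (Or.inr rfl)).1 hR0
  rw [(hRint σ (Or.inr rfl)).2] at hfin
  exact hfin.trans (lintegral_le_decayInt (by positivity) hRbound τ)

end TaylorEstimates

section RieszPotential

variable {n : ℕ}

theorem lintegral_ball_enorm_rpow_neg_lt_top {q : ℝ} (hn : 0 < n) (hq : q < n) :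
    ∫⁻ y in ball (0 : Euc n) 1, ‖y‖ₑ ^ (-q) < ⊤ := by
  have : Nonempty (Fin n) := ⟨⟨0, hn⟩⟩
  have h1 : IntegrableOn (fun x : Euc n => ‖x‖ ^ (-q)) (ball 0 1) volume := by
    refine (integrableOn_fun_norm_addHaar (f := fun t : ℝ => t ^ (-q)) (r := 1)
      (volume : Measure (Euc n))).2 ?_
    have h2 : IntegrableOn (fun x : ℝ => x ^ ((n : ℝ) - 1 - q)) (Set.Ioo 0 1) volume :=
      (intervalIntegral.integrableOn_Ioo_rpow_iff one_pos).2 (by linarith)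
    refine h2.congr_fun (fun t ht => ?_) measurableSet_Ioo
    simp only [finrank_euclideanSpace, Fintype.card_fin, smul_eq_mul]
    rw [← Real.rpow_natCast, ← Real.rpow_add ht.1, Nat.cast_sub hn]
    congr 1
    simp; ring
  refine lt_of_le_of_lt (lintegral_mono_ae ?_) h1.2
  have h0 : ∀ᵐ x : Euc n ∂volume, x ≠ 0 := by simp [ae_iff]
  filter_upwards [ae_restrict_of_ae h0] with x hx
  have hx' : 0 < ‖x‖ := norm_pos_iff.2 hx
  rw [← ofReal_norm, ENNReal.ofReal_rpow_of_pos hx', ← ofReal_norm,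
    Real.norm_of_nonneg (by positivity)]

theorem lintegral_ball_enorm_rpow_neg {q r : ℝ} (hr : 0 < r) :
    ∫⁻ y in ball (0 : Euc n) r, ‖y‖ₑ ^ (-q) =
      ENNReal.ofReal (r ^ ((n : ℝ) - q)) * ∫⁻ y in ball (0 : Euc n) 1, ‖y‖ₑ ^ (-q) := by
  have h1 := Measure.map_addHaar_smul (volume : Measure (Euc n)) (inv_ne_zero hr.ne')
  have hm : Measurable ((ball (0 : Euc n) 1).indicator fun y => ‖y‖ₑ ^ (-q)) :=
    (measurable_enorm.pow_const _).indicator measurableSet_ball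
  have h2 := lintegral_map (μ := volume) hm (measurable_const_smul (r⁻¹ : ℝ))
  rw [h1, lintegral_smul_measure, lintegral_indicator measurableSet_ball] at h2
  have h3 : ∀ y : Euc n, (ball (0 : Euc n) 1).indicator (fun y => ‖y‖ₑ ^ (-q)) (r⁻¹ • y) =
      ENNReal.ofReal (r ^ q) * (ball (0 : Euc n) r).indicator (fun y => ‖y‖ₑ ^ (-q)) y := by
    intro y
    have hmem : r⁻¹ • y ∈ ball (0 : Euc n) 1 ↔ y ∈ ball (0 : Euc n) r := by
      simp [norm_smul, abs_of_pos hr, inv_mul_lt_iff₀ hr]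
    by_cases hy : y ∈ ball (0 : Euc n) r
    · rw [Set.indicator_of_mem (hmem.2 hy), Set.indicator_of_mem hy, enorm_smul,
        ENNReal.mul_rpow_of_ne_top (by simp) (by simp), ← ofReal_norm (r⁻¹),
        Real.norm_of_nonneg (by positivity), ENNReal.ofReal_rpow_of_pos (by positivity),
        Real.inv_rpow hr.le, Real.rpow_neg hr.le, inv_inv]
    · rw [Set.indicator_of_notMem (mt hmem.1 hy), Set.indicator_of_notMem hy, mul_zero]
  simp_rw [h3] at h2
  rw [lintegral_const_mul' _ _ ENNReal.ofReal_ne_top, lintegral_indicator measurableSet_ball] at h2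
  have hc : |((r⁻¹ ^ Module.finrank ℝ (Euc n))⁻¹ : ℝ)| = r ^ (n : ℝ) := by
    simp [abs_of_pos hr]
  rw [hc, smul_eq_mul] at h2
  rw [Real.rpow_sub hr, div_eq_mul_inv, mul_comm (r ^ (n : ℝ)),
    ENNReal.ofReal_mul (by positivity), mul_assoc, h2, ← mul_assoc,
    ← ENNReal.ofReal_mul (by positivity), inv_mul_cancel₀ (by positivity)]
  simp

theorem exists_lintegral_ball_enorm_sub_rpow_neg_le {q : ℝ} (hn : 0 < n) (hq : q < n) :
    ∃ C : ℝ≥0∞, C ≠ ⊤ ∧ ∀ (r : ℝ), 0 < r → ∀ x₀ x : Euc n, x ∈ ball x₀ (2 * r) →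
      ∫⁻ y in ball x₀ r, ‖y - x‖ₑ ^ (-q) ≤ C * ENNReal.ofReal (r ^ ((n : ℝ) - q)) := by
  refine ⟨ENNReal.ofReal (3 ^ ((n : ℝ) - q)) * ∫⁻ y in ball (0 : Euc n) 1, ‖y‖ₑ ^ (-q),
    ENNReal.mul_ne_top ENNReal.ofReal_ne_top (lintegral_ball_enorm_rpow_neg_lt_top hn hq).ne,
    fun r hr x₀ x hx => ?_⟩
  have hsub : ball x₀ r ⊆ ball x (3 * r) := fun y hy => by
    rw [mem_ball] at *
    calc dist y x ≤ dist y x₀ + dist x x₀ := dist_triangle_right _ _ _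
      _ < 3 * r := by linarith
  calc _ ≤ ∫⁻ y in ball x (3 * r), ‖y - x‖ₑ ^ (-q) := lintegral_mono_set hsub
    _ = ∫⁻ y in ball (0 : Euc n) (3 * r), ‖y‖ₑ ^ (-q) := by
        rw [← lintegral_indicator measurableSet_ball, ← lintegral_indicator measurableSet_ball,
          ← lintegral_sub_right_eq_self
            ((ball (0 : Euc n) (3 * r)).indicator fun y => ‖y‖ₑ ^ (-q)) x]
        refine lintegral_congr fun y => ?_
        have : y - x ∈ ball (0 : Euc n) (3 * r) ↔ y ∈ ball x (3 * r) := by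
          simp [dist_eq_norm]
        by_cases hy : y ∈ ball x (3 * r)
        · rw [Set.indicator_of_mem hy, Set.indicator_of_mem (this.2 hy)]
        · rw [Set.indicator_of_notMem hy, Set.indicator_of_notMem (mt this.1 hy)]
    _ = _ := by
        rw [lintegral_ball_enorm_rpow_neg (by positivity), Real.mul_rpow (by norm_num) hr.le,
          ENNReal.ofReal_mul (by positivity)]
        ring

theorem lintegral_rpow_le_measure_rpow_mul {α : Type*} [MeasurableSpace α] {μ : Measure α}
    {f : α → ℝ≥0∞} (hf : AEMeasurable f μ) {p : ℝ} (hp : 1 ≤ p) :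
    (∫⁻ x, f x ∂μ) ^ p ≤ μ Set.univ ^ (p - 1) * ∫⁻ x, f x ^ p ∂μ := by
  have hp0 : 0 < p := by linarith
  have h := eLpNorm'_le_eLpNorm'_mul_rpow_measure_univ (p := 1) one_pos hp
    hf.aestronglyMeasurable
  simp only [eLpNorm', enorm_eq_self, ENNReal.rpow_one, div_one] at h
  refine (ENNReal.rpow_le_rpow h hp0.le).trans (le_of_eq ?_)
  rw [ENNReal.mul_rpow_of_nonneg _ _ hp0.le, ← ENNReal.rpow_mul, ← ENNReal.rpow_mul,
    one_div_mul_cancel hp0.ne', ENNReal.rpow_one, mul_comm]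
  congr 2
  field_simp

theorem exists_rieszPotential_ballAvg_le {a p : ℝ} (hn : 0 < n) (hp : 1 ≤ p)
    (hap : a * p < n) : ∃ C : ℝ≥0∞, C ≠ ⊤ ∧ ∀ (r : ℝ), 0 < r → ∀ (x₀ : Euc n)
      (τ : Measure (Euc n)) [SFinite τ],
      (∫⁻ y, (∫⁻ x in ball x₀ (2 * r), ‖y - x‖ₑ ^ (-a) ∂τ) ^ p ∂(ballAvg x₀ r)) ^ (1 / p) ≤
        C * ENNReal.ofReal (r ^ (-a)) * τ (ball x₀ (2 * r)) := by
  have hp0 : 0 < p := by linarith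
  obtain ⟨C, hC, hC'⟩ := exists_lintegral_ball_enorm_sub_rpow_neg_le (n := n) hn hap
  refine ⟨((volume (ball (0 : Euc n) 1))⁻¹ * C) ^ (1 / p), ?_, fun r hr x₀ τ _ => ?_⟩
  · exact ENNReal.rpow_ne_top_of_nonneg (by positivity)
      (ENNReal.mul_ne_top (ENNReal.inv_ne_top.2 volume_unitBall_ne_zero) hC)
  set B := ball x₀ (2 * r)
  have hm : Measurable fun z : Euc n × Euc n => ‖z.1 - z.2‖ₑ ^ (-(a * p)) :=
    (measurable_fst.sub measurable_snd).enorm.pow_const _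
  have h1 : ∀ y, (∫⁻ x in B, ‖y - x‖ₑ ^ (-a) ∂τ) ^ p ≤
      τ B ^ (p - 1) * ∫⁻ x in B, ‖y - x‖ₑ ^ (-(a * p)) ∂τ := fun y => by
    refine (lintegral_rpow_le_measure_rpow_mul (μ := τ.restrict B) (p := p)
      (f := fun x => ‖y - x‖ₑ ^ (-a)) ?_ hp).trans (le_of_eq ?_)
    · exact ((measurable_const.sub measurable_id).enorm.pow_const _).aemeasurable
    · rw [Measure.restrict_apply_univ]
      congr 1
      refine lintegral_congr fun x => ?_
      rw [← ENNReal.rpow_mul, neg_mul]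
  have h2 : ∫⁻ y, (∫⁻ x in B, ‖y - x‖ₑ ^ (-a) ∂τ) ^ p ∂(ballAvg x₀ r) ≤
      ((volume (ball (0 : Euc n) 1))⁻¹ * C) *
        (ENNReal.ofReal (r ^ (-a)) * τ B) ^ p := by
    calc _ ≤ ∫⁻ y, τ B ^ (p - 1) * (∫⁻ x in B, ‖y - x‖ₑ ^ (-(a * p)) ∂τ) ∂(ballAvg x₀ r) :=
          lintegral_mono h1
      _ = (volume (ball x₀ r))⁻¹ * (τ B ^ (p - 1) *
          ∫⁻ y in ball x₀ r, ∫⁻ x in B, ‖y - x‖ₑ ^ (-(a * p)) ∂τ ∂volume) := by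
          rw [lintegral_const_mul _ hm.lintegral_prod_right', ballAvg, lintegral_smul_measure,
            smul_eq_mul]
          ring
      _ = (volume (ball x₀ r))⁻¹ * (τ B ^ (p - 1) *
          ∫⁻ x in B, ∫⁻ y in ball x₀ r, ‖y - x‖ₑ ^ (-(a * p)) ∂volume ∂τ) := by
          rw [lintegral_lintegral_swap hm.aemeasurable]
      _ ≤ (volume (ball x₀ r))⁻¹ * (τ B ^ (p - 1) *
          ∫⁻ x in B, C * ENNReal.ofReal (r ^ ((n : ℝ) - a * p)) ∂τ) := by
          gcongr _ * (_ * ?_)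
          exact setLIntegral_mono measurable_const fun x hx => hC' r hr x₀ x hx
      _ = _ := by
          rw [setLIntegral_const, volume_ball_euc x₀ hr,
            ENNReal.mul_rpow_of_nonneg _ _ hp0.le,
            ENNReal.ofReal_rpow_of_nonneg (by positivity) hp0.le, ← Real.rpow_mul hr.le,
            ENNReal.mul_inv (Or.inl (by simp [hr])) (Or.inl ENNReal.ofReal_ne_top)]
          have e1 : τ B ^ p = τ B ^ (p - 1) * τ B := by
            conv_rhs => rw [← ENNReal.rpow_one (τ B), ← ENNReal.rpow_mul, one_mul,
              ← ENNReal.rpow_add_of_nonneg _ _ (by linarith) zero_le_one]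
            simp
          have e2 : (ENNReal.ofReal (r ^ n))⁻¹ * ENNReal.ofReal (r ^ ((n : ℝ) - a * p)) =
              ENNReal.ofReal (r ^ (-a * p)) := by
            rw [← ENNReal.ofReal_inv_of_pos (by positivity), ← ENNReal.ofReal_mul (by positivity),
              Real.rpow_sub hr, Real.rpow_natCast, neg_mul, Real.rpow_neg hr.le]
            congr 1
            field_simp
          rw [e1, ← e2]
          ring
  refine (ENNReal.rpow_le_rpow h2 (by positivity)).trans (le_of_eq ?_)
  rw [ENNReal.mul_rpow_of_nonneg _ _ (by positivity), ← ENNReal.rpow_mul,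
    mul_one_div_cancel hp0.ne', ENNReal.rpow_one]
  ring

end RieszPotential

section DyadicLimits

theorem SmallO.of_dyadic {Q H : ℝ → ℝ≥0∞} {g : ℕ → ℝ≥0∞} {a : ℝ} (hg : Tendsto g atTop (𝓝 0))
    (hH : SmallO H a) (h : ∀ (N : ℕ) (r : ℝ), (1 / 2 : ℝ) ^ (N + 1) < r → r ≤ (1 / 2) ^ N →
      Q r ≤ g N * ENNReal.ofReal (r ^ a) + H r) : SmallO Q a := by
  have hG : SmallO (fun r => Q r - H r) a := by
    refine ENNReal.tendsto_nhds_zero.2 fun ε hε => ?_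
    obtain ⟨N₀, hN₀⟩ := eventually_atTop.1 (ENNReal.tendsto_nhds_zero.1 hg ε hε)
    have hpos : (0 : ℝ) < (1 / 2) ^ N₀ := by positivity
    filter_upwards [Ioo_mem_nhdsGT hpos] with r hr
    obtain ⟨N, hN1, hN2⟩ := exists_nat_pow_near_of_lt_one hr.1
      (hr.2.le.trans (pow_le_one₀ (by norm_num) (by norm_num))) (by norm_num : (0 : ℝ) < 1 / 2)
      (by norm_num)
    have hN : N₀ ≤ N := by
      by_contra! hlt
      have := pow_le_pow_of_le_one (by norm_num : (0 : ℝ) ≤ 1 / 2) (by norm_num) hlt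
      exact absurd (hN1.trans hr.2) (not_lt.2 this)
    refine ENNReal.div_le_of_le_mul (tsub_le_iff_right.2 ((h N r hN1 hN2).trans ?_))
    gcongr
    exact hN₀ N hN
  exact (hG.add hH).mono (Eventually.of_forall fun r => le_tsub_add)

theorem tendsto_iSup_tail {e : ℕ → ℝ≥0∞} (he : Tendsto e atTop (𝓝 0)) :
    Tendsto (fun N => ⨆ m, e (N + m)) atTop (𝓝 0) := by
  refine ENNReal.tendsto_nhds_zero.2 fun ε hε => ?_
  obtain ⟨N₀, hN₀⟩ := eventually_atTop.1 (ENNReal.tendsto_nhds_zero.1 he ε hε)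
  filter_upwards [eventually_ge_atTop N₀] with N hN
  exact iSup_le fun m => hN₀ _ (by omega)

theorem tsum_ofReal_half_pow : ∑' m : ℕ, ENNReal.ofReal ((1 / 2 : ℝ) ^ m) = 2 := by
  rw [← ENNReal.ofReal_tsum_of_nonneg (fun _ => by positivity) summable_geometric_two,
    tsum_geometric_two]
  simp

theorem tendsto_sum_half_pow_mul {e : ℕ → ℝ≥0∞} (he : Tendsto e atTop (𝓝 0))
    (hfin : ∀ l, e l ≠ ⊤) :
    Tendsto (fun N => ∑ l ∈ Finset.range (N + 1), ENNReal.ofReal ((1 / 2 : ℝ) ^ (N - l)) * e l)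
      atTop (𝓝 0) := by
  obtain ⟨B, hB, hB'⟩ : ∃ B : ℝ≥0∞, B ≠ ⊤ ∧ ∀ l, e l ≤ B := by
    obtain ⟨N₀, hN₀⟩ := eventually_atTop.1 (ENNReal.tendsto_nhds_zero.1 he 1 one_pos)
    refine ⟨∑ l ∈ Finset.range N₀, e l + 1, ENNReal.add_ne_top.2
      ⟨ENNReal.sum_ne_top.2 fun l _ => hfin l, ENNReal.one_ne_top⟩, fun l => ?_⟩
    rcases lt_or_ge l N₀ with h | h
    · exact (Finset.single_le_sum (fun _ _ => zero_le) (Finset.mem_range.2 h)).trans le_self_add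
    · exact (hN₀ l h).trans le_add_self
  have h1 : ∀ N, ∑ l ∈ Finset.range (N + 1), ENNReal.ofReal ((1 / 2 : ℝ) ^ (N - l)) * e l =
      ∑' m, if m ≤ N then ENNReal.ofReal ((1 / 2 : ℝ) ^ m) * e (N - m) else 0 := fun N => by
    rw [tsum_eq_sum (s := Finset.range (N + 1)) fun m hm => if_neg (by
      simpa [Nat.lt_succ_iff] using hm), ← Finset.sum_range_reflect]
    refine Finset.sum_congr rfl fun m hm => ?_
    have hm' : m ≤ N := Nat.lt_succ_iff.1 (Finset.mem_range.1 hm)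
    rw [if_pos hm', show N + 1 - 1 - m = N - m by omega, Nat.sub_sub_self hm']
  simp_rw [h1]
  refine ENNReal.tendsto_tsum_of_dominated_convergence'
    (fun m => ENNReal.ofReal ((1 / 2 : ℝ) ^ m) * B) ?_ ?_ ?_
  · rw [ENNReal.tsum_mul_right, tsum_ofReal_half_pow]
    exact ENNReal.mul_ne_top (by simp) hB
  · intro N m
    split_ifs
    · gcongr; exact hB' _
    · exact zero_le
  · intro m
    have h2 : Tendsto (fun N => ENNReal.ofReal ((1 / 2 : ℝ) ^ m) * e (N - m)) atTop (𝓝 0) := by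
      simpa using ENNReal.Tendsto.const_mul (a := ENNReal.ofReal ((1 / 2 : ℝ) ^ m))
        (he.comp (tendsto_sub_atTop_nat m)) (Or.inr ENNReal.ofReal_ne_top)
    refine h2.congr' ?_
    filter_upwards [eventually_ge_atTop m] with N hN
    rw [if_pos hN]

end DyadicLimits

section KernelSums

open scoped SchwartzMap

variable {n : ℕ}

theorem exists_tsum_dyKer_le (Φ : 𝓢(Euc n, ℝ)) (j : ℕ) {a δ : ℝ} (ha : a = n - j + δ)
    (ha0 : 0 < a) (hδ : 0 < δ) (han : a < n + 1) : ∃ C : ℝ, 0 < C ∧ ∀ (N : ℕ) (z : Euc n),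
      ∑' m : ℕ, ‖dyKer j (N + m) Φ z‖ₑ ≤
        ENNReal.ofReal (C * ((1 / 2 : ℝ) ^ N) ^ δ) * ‖z‖ₑ ^ (-a) := by
  obtain ⟨C, hC0, hC⟩ := exists_dyKer_bound Φ j
  obtain ⟨D, hD0, hD⟩ := exists_tsum_dyadic_le ha0 han
  refine ⟨C * D, by positivity, fun N z => ?_⟩
  rcases eq_or_ne z 0 with rfl | hz
  · rw [enorm_zero, ENNReal.zero_rpow_of_neg (by linarith), ENNReal.mul_top]
    · exact le_top
    · simp only [ne_eq, ENNReal.ofReal_eq_zero, not_le]; positivity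
  have hz' : 0 < ‖z‖ := norm_pos_iff.2 hz
  set t : ℕ → ℝ≥0∞ := fun l =>
    ENNReal.ofReal (((2 : ℝ) ^ l) ^ a * ((1 + 2 ^ l * ‖z‖) ^ ((n : ℝ) + 1))⁻¹) with ht
  have h1 : ∀ m, ‖dyKer j (N + m) Φ z‖ₑ ≤
      ENNReal.ofReal (C * ((1 / 2 : ℝ) ^ N) ^ δ) * t (N + m) := fun m => by
    rw [ht, ← ofReal_norm, ← ENNReal.ofReal_mul (by positivity)]
    refine ENNReal.ofReal_le_ofReal ?_
    have h2 := hC 0 (by omega) (N + m) z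
    rw [norm_iteratedFDeriv_zero, Nat.mul_zero, pow_zero, mul_one] at h2
    refine h2.trans ?_
    set L : ℝ := (2 : ℝ) ^ (N + m) with hL
    have hL0 : 0 < L := by positivity
    have e1 : ((2 : ℝ) ^ ((N + m) * j))⁻¹ * 2 ^ ((N + m) * n) = L ^ (-δ) * L ^ a := by
      rw [← Real.rpow_add hL0, ha, pow_mul, pow_mul, ← hL, ← Real.rpow_natCast,
        ← Real.rpow_natCast L n, ← Real.rpow_neg hL0.le, ← Real.rpow_add hL0]
      congr 1; ring
    have e2 : L ^ (-δ) ≤ ((1 / 2 : ℝ) ^ N) ^ δ := by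
      rw [Real.rpow_neg hL0.le, ← Real.inv_rpow hL0.le]
      refine Real.rpow_le_rpow (by positivity) ?_ hδ.le
      rw [hL, one_div, inv_pow]
      exact inv_anti₀ (by positivity) (pow_le_pow_right₀ one_le_two (by omega))
    have e3 : (1 + L * ‖z‖) ^ ((n : ℝ) + 1) = (1 + L * ‖z‖) ^ (n + 1) := by norm_cast
    rw [e3, decayWt, ← hL]
    calc _ = C * (((2 : ℝ) ^ ((N + m) * j))⁻¹ * 2 ^ ((N + m) * n)) *
          ((1 + L * ‖z‖) ^ (n + 1))⁻¹ := by ring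
      _ = C * L ^ (-δ) * (L ^ a * ((1 + L * ‖z‖) ^ (n + 1))⁻¹) := by rw [e1]; ring
      _ ≤ _ := by gcongr
  calc _ ≤ ∑' m, ENNReal.ofReal (C * ((1 / 2 : ℝ) ^ N) ^ δ) * t (N + m) := ENNReal.tsum_le_tsum h1
    _ = ENNReal.ofReal (C * ((1 / 2 : ℝ) ^ N) ^ δ) * ∑' m, t (N + m) := ENNReal.tsum_mul_left
    _ ≤ ENNReal.ofReal (C * ((1 / 2 : ℝ) ^ N) ^ δ) * ∑' l, t l := by
        gcongr _ * ?_
        exact ENNReal.tsum_comp_le_tsum_of_injective (add_right_injective N) t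
    _ ≤ ENNReal.ofReal (C * ((1 / 2 : ℝ) ^ N) ^ δ) * ENNReal.ofReal (D * ‖z‖ ^ (-a)) := by
        gcongr; exact hD _ hz'
    _ = _ := by
        rw [← ofReal_norm, ENNReal.ofReal_rpow_of_pos hz', ← ENNReal.ofReal_mul (by positivity),
          ← ENNReal.ofReal_mul (by positivity)]
        congr 1; ring

/-- The contribution of the scales `≥ N` splits into a near field and a far field. -/
theorem exists_tsum_lintegral_dyKer_le (Φ : 𝓢(Euc n, ℝ)) {j : ℕ} (hj : 1 ≤ j) {a δ : ℝ}
    (ha : a = n - j + δ) (ha0 : 0 < a) (hδ : 0 < δ) (han : a < n + 1) : ∃ C : ℝ, 0 < C ∧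
      ∀ (τ : Measure (Euc n)) (N : ℕ) (r : ℝ) (x₀ y : Euc n), y ∈ ball x₀ r →
        ∑' m : ℕ, ∫⁻ x, ‖dyKer j (N + m) Φ (y - x)‖ₑ ∂τ ≤
          ENNReal.ofReal (C * ((1 / 2 : ℝ) ^ N) ^ j) * (⨆ m, decayInt τ x₀ (N + m)) +
          ENNReal.ofReal (C * ((1 / 2 : ℝ) ^ N) ^ δ) *
            ∫⁻ x in ball x₀ (2 * r), ‖y - x‖ₑ ^ (-a) ∂τ := by
  obtain ⟨C, hC0, hC⟩ := exists_dyKer_bound Φ j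
  obtain ⟨D, hD0, hD⟩ := exists_tsum_dyKer_le Φ j ha ha0 hδ han
  refine ⟨max D (2 * (C * 2 ^ (n + 1))), lt_max_of_lt_left hD0, fun τ N r x₀ y hy => ?_⟩
  set B := ball x₀ (2 * r)
  set e := fun m => decayInt τ x₀ (N + m)
  have hmeas : ∀ l, Measurable fun x => ‖dyKer j l Φ (y - x)‖ₑ := fun l =>
    ((contDiff_dyKer (Φ.smooth ⊤) j l).continuous.comp (continuous_sub_left y)).measurable.enorm
  have hfar : ∀ m, ∫⁻ x in Bᶜ, ‖dyKer j (N + m) Φ (y - x)‖ₑ ∂τ ≤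
      ENNReal.ofReal (C * 2 ^ (n + 1) * ((1 / 2 : ℝ) ^ N) ^ j * (1 / 2) ^ m) * ⨆ m, e m := by
    intro m
    have h1 : ∫⁻ x in Bᶜ, ‖dyKer j (N + m) Φ (y - x)‖ₑ ∂τ ≤
        ∫⁻ x in Bᶜ, ENNReal.ofReal (C * 2 ^ (n + 1) * ((1 / 2 : ℝ) ^ N) ^ j * (1 / 2) ^ m) *
          ENNReal.ofReal (decayWt n (N + m) (x - x₀)) ∂τ := by
      refine setLIntegral_mono (measurable_const.mul (ENNReal.measurable_ofReal.comp
        ((continuous_decayWt (N + m)).comp (continuous_sub_right x₀)).measurable)) fun x hx => ?_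
      rw [← ofReal_norm, ← ENNReal.ofReal_mul (by positivity)]
      refine ENNReal.ofReal_le_ofReal ?_
      have h2 := hC 0 (by omega) (N + m) (y - x)
      rw [norm_iteratedFDeriv_zero, Nat.mul_zero, pow_zero, mul_one] at h2
      have h3 : ‖x - x₀‖ ≤ 2 * ‖y - x‖ := by
        have hx' : 2 * r ≤ dist x x₀ := not_lt.1 hx
        have := dist_triangle_left x x₀ y
        rw [mem_ball] at hy
        rw [← dist_eq_norm, ← dist_eq_norm]
        linarith
      have h4 : decayWt n (N + m) (y - x) ≤ 2 ^ (n + 1) * decayWt n (N + m) (x - x₀) := by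
        refine decayWt_le_of_half ?_
        have : (2 : ℝ) ^ (N + m) * ‖x - x₀‖ ≤ 2 ^ (N + m) * (2 * ‖y - x‖) := by gcongr
        linarith
      have h5 : ((2 : ℝ) ^ ((N + m) * j))⁻¹ ≤ ((1 / 2 : ℝ) ^ N) ^ j * (1 / 2) ^ m := by
        rw [add_mul, pow_add, mul_inv, ← pow_mul, one_div, inv_pow, inv_pow]
        gcongr
        · norm_num
        · exact Nat.le_mul_of_pos_right m hj
      calc _ ≤ C * ((2 : ℝ) ^ ((N + m) * j))⁻¹ * decayWt n (N + m) (y - x) := h2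
        _ ≤ C * (((1 / 2 : ℝ) ^ N) ^ j * (1 / 2) ^ m) *
            (2 ^ (n + 1) * decayWt n (N + m) (x - x₀)) := by
            have := decayWt_nonneg (N + m) (y - x)
            gcongr
        _ = _ := by ring
    refine h1.trans ((setLIntegral_le_lintegral _ _).trans ?_)
    rw [lintegral_const_mul' _ _ ENNReal.ofReal_ne_top]
    gcongr
    exact le_iSup e m
  have hsum : ∑' m : ℕ, ∫⁻ x in Bᶜ, ‖dyKer j (N + m) Φ (y - x)‖ₑ ∂τ ≤
      ENNReal.ofReal (2 * (C * 2 ^ (n + 1)) * ((1 / 2 : ℝ) ^ N) ^ j) * ⨆ m, e m := by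
    refine (ENNReal.tsum_le_tsum hfar).trans (le_of_eq ?_)
    simp_rw [ENNReal.ofReal_mul (show 0 ≤ C * 2 ^ (n + 1) * ((1 / 2 : ℝ) ^ N) ^ j by positivity)]
    rw [ENNReal.tsum_mul_right, ENNReal.tsum_mul_left, tsum_ofReal_half_pow, mul_assoc 2,
      ENNReal.ofReal_mul (p := 2) (by norm_num)]
    simp only [ENNReal.ofReal_ofNat]
    ring
  have hnear : ∑' m : ℕ, ∫⁻ x in B, ‖dyKer j (N + m) Φ (y - x)‖ₑ ∂τ ≤
      ENNReal.ofReal (D * ((1 / 2 : ℝ) ^ N) ^ δ) * ∫⁻ x in B, ‖y - x‖ₑ ^ (-a) ∂τ := by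
    rw [← lintegral_tsum fun m => (hmeas _).aemeasurable,
      ← lintegral_const_mul' _ _ ENNReal.ofReal_ne_top]
    exact lintegral_mono fun x => hD N (y - x)
  calc _ = (∑' m : ℕ, ∫⁻ x in B, ‖dyKer j (N + m) Φ (y - x)‖ₑ ∂τ) +
        ∑' m : ℕ, ∫⁻ x in Bᶜ, ‖dyKer j (N + m) Φ (y - x)‖ₑ ∂τ := by
        rw [← ENNReal.tsum_add]
        exact tsum_congr fun m => (lintegral_add_compl _ measurableSet_ball).symm
    _ ≤ _ := by
        rw [add_comm]
        refine add_le_add (hsum.trans ?_) (hnear.trans ?_)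
        · gcongr; exact le_max_right _ _
        · gcongr; exact le_max_left _ _

end KernelSums

section DyadicPotential

open scoped SchwartzMap

variable {n : ℕ}

theorem exists_dyCoef_limit (Φ : 𝓢(Euc n, ℝ)) {j : ℕ}
    (hmean : ∀ i ≤ j, ∫ z, iteratedFDeriv ℝ i Φ z = 0) {σ τ : Measure (Euc n)} [IsFiniteMeasure σ]
    {x₀ : Euc n} (hτ : ZeroDensity τ x₀) (hστ : ControlsMeanZero τ σ)
    (hstar : ∃ M, Tendsto (fun N => ∑ l ∈ Finset.range N, dyCoef σ j l j Φ x₀) atTop (𝓝 M))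
    {i : ℕ} (hi : i ≤ j) : ∃ c : ContinuousMultilinearMap ℝ (fun _ : Fin i => Euc n) ℝ,
      Tendsto (fun N => ‖c - ∑ l ∈ Finset.range N, dyCoef σ j l i Φ x₀‖ₑ *
        ENNReal.ofReal (2 ^ (N * (j - i)))) atTop (𝓝 0) := by
  rcases hi.eq_or_lt with rfl | hlt
  · obtain ⟨M, hM⟩ := hstar
    refine ⟨M, ?_⟩
    have := (tendsto_iff_edist_tendsto_0.1 hM)
    simp_rw [edist_comm _ M, edist_eq_enorm_sub] at this
    simpa using this
  obtain ⟨C, hC0, hC⟩ := exists_enorm_dyCoef_le Φ j hmean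
  replace hC := hC σ τ hστ i hi
  set s : ℕ → ℝ≥0∞ := fun N => ⨆ m, decayInt τ x₀ (N + m) with hs
  have hs0 : Tendsto s atTop (𝓝 0) := tendsto_iSup_tail hτ.tendsto_decayInt
  have hbound : ∀ N, ∑' m, ‖dyCoef σ j (m + N) i Φ x₀‖ₑ ≤
      ENNReal.ofReal (C * ((2 : ℝ) ^ (N * (j - i)))⁻¹) * 2 * s N := fun N => by
    calc _ ≤ ∑' m, ENNReal.ofReal (C * ((2 : ℝ) ^ (N * (j - i)))⁻¹) *
          ENNReal.ofReal ((1 / 2 : ℝ) ^ m) * s N := by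
          refine ENNReal.tsum_le_tsum fun m => (hC (m + N) x₀).trans ?_
          rw [← ENNReal.ofReal_mul (by positivity), mul_assoc C]
          refine mul_le_mul' (ENNReal.ofReal_le_ofReal ?_) ?_
          · gcongr
            rw [add_mul, pow_add, mul_inv, mul_comm, one_div, inv_pow]
            gcongr
            · norm_num
            · exact Nat.le_mul_of_pos_right m (by omega)
          · rw [add_comm]; exact le_iSup (fun m => decayInt τ x₀ (N + m)) m
      _ = _ := by rw [ENNReal.tsum_mul_right, ENNReal.tsum_mul_left, tsum_ofReal_half_pow]
  obtain ⟨N₀, hN₀⟩ := eventually_atTop.1 (ENNReal.tendsto_nhds_zero.1 hs0 1 one_pos)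
  have hsum : Summable fun l => dyCoef σ j l i Φ x₀ := by
    refine (summable_nat_add_iff N₀).1 (Summable.of_enorm (ne_top_of_le_ne_top ?_ (hbound N₀)))
    exact ENNReal.mul_ne_top (ENNReal.mul_ne_top ENNReal.ofReal_ne_top (by simp))
      (ne_top_of_le_ne_top ENNReal.one_ne_top (hN₀ N₀ le_rfl))
  refine ⟨∑' l, dyCoef σ j l i Φ x₀, ?_⟩
  have hlim : Tendsto (fun N => ENNReal.ofReal C * 2 * s N) atTop (𝓝 0) := by
    simpa using ENNReal.Tendsto.const_mul (a := ENNReal.ofReal C * 2) hs0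
      (Or.inr (ENNReal.mul_ne_top ENNReal.ofReal_ne_top (by simp)))
  refine tendsto_of_tendsto_of_tendsto_of_le_of_le tendsto_const_nhds hlim (fun _ => zero_le)
    fun N => ?_
  beta_reduce
  rw [← hsum.sum_add_tsum_nat_add N, add_sub_cancel_left]
  have htail : ‖∑' m, dyCoef σ j (m + N) i Φ x₀‖ₑ ≤ ∑' m, ‖dyCoef σ j (m + N) i Φ x₀‖ₑ :=
    enorm_tsum_le_tsum_enorm (f := fun m => dyCoef σ j (m + N) i Φ x₀)
  refine (mul_le_mul_left (htail.trans (hbound N)) _).trans (le_of_eq ?_)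
  rw [mul_right_comm, mul_right_comm (ENNReal.ofReal _), ← ENNReal.ofReal_mul (by positivity),
    mul_assoc C, inv_mul_cancel₀ (by positivity), mul_one]

/-- The convolution of `∑ₗ dyKer j l Φ` with `σ`. -/
noncomputable def dyPot (j : ℕ) (Φ : Euc n → ℝ) (σ : Measure (Euc n)) (y : Euc n) : ℝ :=
  ∑' l, ∫ x, dyKer j l Φ (y - x) ∂σ

theorem integral_dyKer_sub {Φ : Euc n → ℝ} (h0 : ∫ z, Φ z = 0) (j l : ℕ) (y : Euc n) :
    ∫ x, dyKer j l Φ (y - x) = 0 := by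
  simp_rw [dyKer]
  rw [integral_const_mul, integral_sub_left_dil, h0, mul_zero]

theorem enorm_integral_dyKer_le (Φ : 𝓢(Euc n, ℝ)) (h0 : ∫ z, Φ z = 0) {σ τ : Measure (Euc n)}
    [IsFiniteMeasure σ] (hστ : ControlsMeanZero τ σ) (j l : ℕ) (y : Euc n) :
    ‖∫ x, dyKer j l Φ (y - x) ∂σ‖ₑ ≤ ∫⁻ x, ‖dyKer j l Φ (y - x)‖ₑ ∂τ :=
  hστ _ ((contDiff_dyKer (Φ.smooth ⊤) j l).continuous.comp (continuous_sub_left y))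
    ((integrable_dil_sub Φ l y).const_mul _) ((integrable_dil_measure Φ l y σ).const_mul _)
    (integral_dyKer_sub h0 j l y)

theorem enorm_dyPot_sub_le (Φ : 𝓢(Euc n, ℝ)) (h0 : ∫ z, Φ z = 0) {σ τ : Measure (Euc n)}
    [IsFiniteMeasure σ] (hστ : ControlsMeanZero τ σ) (j N : ℕ) (x₀ y : Euc n)
    (c : ∀ i, ContinuousMultilinearMap ℝ (fun _ : Fin i => Euc n) ℝ) :
    ‖dyPot j Φ σ y - ∑ i ∈ Finset.range (j + 1), ((i.factorial : ℝ)⁻¹) • c i (fun _ => y - x₀)‖ₑ ≤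
      ∑ l ∈ Finset.range N, ‖(∫ x, dyKer j l Φ (y - x) ∂σ) - ∑ i ∈ Finset.range (j + 1),
          ((i.factorial : ℝ)⁻¹) • dyCoef σ j l i Φ x₀ (fun _ => y - x₀)‖ₑ +
        ∑ i ∈ Finset.range (j + 1), ‖c i - ∑ l ∈ Finset.range N, dyCoef σ j l i Φ x₀‖ₑ *
          ENNReal.ofReal (‖y - x₀‖ ^ i) +
        ∑' m, ∫⁻ x, ‖dyKer j (N + m) Φ (y - x)‖ₑ ∂τ := by
  by_cases hS : ∑' m, ∫⁻ x, ‖dyKer j (N + m) Φ (y - x)‖ₑ ∂τ = ⊤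
  · rw [hS, add_top]; exact le_top
  have hle : ∑' m, ‖∫ x, dyKer j (m + N) Φ (y - x) ∂σ‖ₑ ≤
      ∑' m, ∫⁻ x, ‖dyKer j (N + m) Φ (y - x)‖ₑ ∂τ := ENNReal.tsum_le_tsum fun m => by
    rw [add_comm]; exact enorm_integral_dyKer_le Φ h0 hστ j _ y
  have hsum : Summable fun l => ∫ x, dyKer j l Φ (y - x) ∂σ :=
    (summable_nat_add_iff N).1 (Summable.of_enorm (ne_top_of_le_ne_top hS hle))
  set T : ℕ → ℝ := fun l => ∑ i ∈ Finset.range (j + 1),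
    ((i.factorial : ℝ)⁻¹) • dyCoef σ j l i Φ x₀ (fun _ => y - x₀) with hT
  have hTs : ∑ l ∈ Finset.range N, T l = ∑ i ∈ Finset.range (j + 1), ((i.factorial : ℝ)⁻¹) •
      (∑ l ∈ Finset.range N, dyCoef σ j l i Φ x₀) (fun _ => y - x₀) := by
    rw [hT, Finset.sum_comm]
    refine Finset.sum_congr rfl fun i _ => ?_
    rw [sum_apply, Finset.smul_sum]
  have hsplit : dyPot j Φ σ y -
      ∑ i ∈ Finset.range (j + 1), ((i.factorial : ℝ)⁻¹) • c i (fun _ => y - x₀) =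
      ∑ l ∈ Finset.range N, ((∫ x, dyKer j l Φ (y - x) ∂σ) - T l) -
      ∑ i ∈ Finset.range (j + 1), ((i.factorial : ℝ)⁻¹) •
        (c i - ∑ l ∈ Finset.range N, dyCoef σ j l i Φ x₀) (fun _ => y - x₀) +
      ∑' m, ∫ x, dyKer j (m + N) Φ (y - x) ∂σ := by
    rw [dyPot, ← hsum.sum_add_tsum_nat_add N, Finset.sum_sub_distrib, hTs]
    simp only [sub_apply, smul_sub, Finset.sum_sub_distrib]
    ring
  rw [hsplit]
  refine (enorm_add_le _ _).trans (add_le_add ((enorm_sub_le).trans (add_le_add ?_ ?_)) ?_)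
  · exact enorm_sum_le _ _
  · refine (enorm_sum_le _ _).trans (Finset.sum_le_sum fun i _ => ?_)
    rw [← ofReal_norm, ← ofReal_norm, ← ENNReal.ofReal_mul (norm_nonneg _), norm_smul]
    refine ENNReal.ofReal_le_ofReal ?_
    have h1 : ‖((i.factorial : ℝ)⁻¹)‖ ≤ 1 := by
      rw [Real.norm_of_nonneg (by positivity)]
      exact inv_le_one_of_one_le₀ (by exact_mod_cast i.factorial_pos)
    refine (mul_le_of_le_one_left (norm_nonneg _) h1).trans ?_
    simpa using ContinuousMultilinearMap.le_opNorm
      (c i - ∑ l ∈ Finset.range N, dyCoef σ j l i Φ x₀) (fun _ => y - x₀)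
  · exact enorm_tsum_le_tsum_enorm.trans hle

end DyadicPotential

section DyadicPotentialMemT

open scoped SchwartzMap

variable {n : ℕ}

theorem lintegral_rpow_add_const_mul_le {p : ℝ} (hp : 1 ≤ p) {x : Euc n} {r : ℝ} (A b : ℝ≥0∞)
    {R : Euc n → ℝ≥0∞} (hR : Measurable R) :
    (∫⁻ y, (A + b * R y) ^ p ∂(ballAvg x r)) ^ (1 / p) ≤
      A + b * (∫⁻ y, R y ^ p ∂(ballAvg x r)) ^ (1 / p) := by
  have hp0 : 0 < p := by linarith
  refine (ENNReal.lintegral_Lp_add_le (μ := ballAvg x r) (f := fun _ => A)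
    (g := fun y => b * R y) aemeasurable_const (hR.const_mul b).aemeasurable hp).trans
    (add_le_add ?_ (le_of_eq ?_))
  · rw [lintegral_const]
    calc (A ^ p * ballAvg x r Set.univ) ^ (1 / p) ≤ (A ^ p * 1) ^ (1 / p) := by
          gcongr; exact ballAvg_univ_le x r
      _ = A := by rw [mul_one, ← ENNReal.rpow_mul, mul_one_div_cancel hp0.ne', ENNReal.rpow_one]
  · simp_rw [ENNReal.mul_rpow_of_nonneg _ _ hp0.le]
    rw [lintegral_const_mul _ (hR.pow_const p), ENNReal.mul_rpow_of_nonneg _ _ (by positivity),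
      ← ENNReal.rpow_mul, mul_one_div_cancel hp0.ne', ENNReal.rpow_one]

theorem ZeroDensity.smallO_double {τ : Measure (Euc n)} {x₀ : Euc n} (hτ : ZeroDensity τ x₀)
    {j : ℕ} {a δ : ℝ} (ha : a = n - j + δ) {C : ℝ} (hC : 0 ≤ C) {D : ℝ≥0∞} (hD : D ≠ ⊤) :
    SmallO (fun r => ENNReal.ofReal (C * r ^ δ) *
      (D * ENNReal.ofReal (r ^ (-a)) * τ (ball x₀ (2 * r)))) (j : ℝ) := by
  have hlim : Tendsto (fun r : ℝ => 2 * r) (𝓝[>] 0) (𝓝[>] 0) := by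
    refine tendsto_nhdsWithin_iff.2 ⟨?_, ?_⟩
    · have : Tendsto (fun r : ℝ => 2 * r) (𝓝 0) (𝓝 (2 * 0)) := tendsto_id.const_mul 2
      rw [mul_zero] at this
      exact this.mono_left nhdsWithin_le_nhds
    · filter_upwards [self_mem_nhdsWithin] with r hr
      simpa using hr
  have h := ENNReal.Tendsto.const_mul (a := ENNReal.ofReal (C * 2 ^ n) * D) (hτ.tendsto.comp hlim)
    (Or.inr (ENNReal.mul_ne_top ENNReal.ofReal_ne_top hD))
  rw [mul_zero] at h
  refine h.congr' ?_
  filter_upwards [self_mem_nhdsWithin] with r hr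
  have hr : 0 < r := hr
  have key : C * r ^ δ * r ^ (-a) = C * 2 ^ n * r ^ (j : ℝ) / (2 * r) ^ n := by
    rw [mul_assoc C, ← Real.rpow_add hr, ha, show δ + -((n : ℝ) - j + δ) = j - n by ring,
      Real.rpow_sub hr, Real.rpow_natCast, Real.rpow_natCast, mul_pow]
    field_simp
  have hj : ENNReal.ofReal (r ^ (j : ℝ)) ≠ 0 :=
    (ENNReal.ofReal_pos.2 (Real.rpow_pos_of_pos hr _)).ne'
  rw [Function.comp_apply, ENNReal.eq_div_iff hj ENNReal.ofReal_ne_top]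
  calc ENNReal.ofReal (r ^ (j : ℝ)) * (ENNReal.ofReal (C * 2 ^ n) * D *
        (τ (ball x₀ (2 * r)) / ENNReal.ofReal ((2 * r) ^ n)))
      = (ENNReal.ofReal (C * 2 ^ n) * ENNReal.ofReal (r ^ (j : ℝ)) / ENNReal.ofReal ((2 * r) ^ n))
        * (D * τ (ball x₀ (2 * r))) := by simp only [div_eq_mul_inv]; ring
    _ = ENNReal.ofReal (C * r ^ δ) * ENNReal.ofReal (r ^ (-a)) * (D * τ (ball x₀ (2 * r))) := by
      rw [← ENNReal.ofReal_mul (by positivity), ← ENNReal.ofReal_mul (by positivity),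
        ← ENNReal.ofReal_div_of_pos (by positivity), key]
    _ = _ := by ring

theorem memT_dyPot (Φ : 𝓢(Euc n, ℝ)) {j : ℕ} {p : ℝ} (hj : 1 ≤ j) (hjn : j < n) (hp : 1 ≤ p)
    (hpn : p * ((n : ℝ) - j) < n) (hmean : ∀ i ≤ j, ∫ z, iteratedFDeriv ℝ i Φ z = 0)
    (h0 : ∫ z, Φ z = 0) {σ τ : Measure (Euc n)} [IsFiniteMeasure σ] [SFinite τ] {x₀ : Euc n}
    (hτ : ZeroDensity τ x₀) (hστ : ControlsMeanZero τ σ)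
    (hstar : ∃ M, Tendsto (fun N => ∑ l ∈ Finset.range N, dyCoef σ j l j Φ x₀) atTop (𝓝 M)) :
    MemT n j p (dyPot j Φ σ) x₀ := by
  have hp0 : 0 < p := by linarith
  have hlim := fun (i : ℕ) (hi : i ≤ j) => exists_dyCoef_limit Φ hmean hτ hστ hstar hi
  choose! c hc using hlim
  obtain ⟨C₁, hC₁0, hC₁⟩ := exists_enorm_sub_taylor_dyKer_le Φ j hmean
  replace hC₁ := hC₁ σ τ hστ
  have hnj : (0 : ℝ) < n - j := by
    have : (j : ℝ) < n := by exact_mod_cast hjn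
    linarith
  have hgap : (n : ℝ) - j < n / p := by rwa [lt_div_iff₀ hp0, mul_comm]
  set δ : ℝ := (n / p - (n - j)) / 2 with hδ
  set a : ℝ := n - j + δ with ha
  have hδ0 : 0 < δ := by linarith
  have hanp : a < n / p := by linarith
  have han : a < n + 1 := by
    have : (n : ℝ) / p ≤ n := div_le_self (by positivity) hp
    linarith
  obtain ⟨C₃, hC₃0, hC₃⟩ := exists_tsum_lintegral_dyKer_le Φ hj ha (by linarith) hδ0 han
  obtain ⟨D, hD, hD'⟩ := exists_rieszPotential_ballAvg_le (n := n) (by omega) hp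
    ((lt_div_iff₀ hp0).1 hanp)
  set e : ℕ → ℝ≥0∞ := decayInt τ x₀ with he
  set s : ℕ → ℝ≥0∞ := fun N => ⨆ m, e (N + m) with hs
  set E : ℕ → ℕ → ℝ≥0∞ := fun i N => ‖c i - ∑ l ∈ Finset.range N, dyCoef σ j l i Φ x₀‖ₑ *
        ENNReal.ofReal (2 ^ (N * (j - i))) with hE
  set G : ℕ → ℝ≥0∞ := fun N => ENNReal.ofReal C₁ *
      ∑ l ∈ Finset.range (N + 1), ENNReal.ofReal ((1 / 2 : ℝ) ^ (N - l)) * e l +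
      ∑ i ∈ Finset.range (j + 1), E i (N + 1) + ENNReal.ofReal C₃ * s (N + 1) with hG
  have hGlim : Tendsto G atTop (𝓝 0) := by
    have g1 := ENNReal.Tendsto.const_mul (a := ENNReal.ofReal C₁)
      (tendsto_sum_half_pow_mul hτ.tendsto_decayInt fun l => hτ.decayInt_ne_top l)
      (Or.inr ENNReal.ofReal_ne_top)
    have g2 : Tendsto (fun N => ∑ i ∈ Finset.range (j + 1), E i (N + 1)) atTop (𝓝 0) := by
      rw [← Finset.sum_const_zero (s := Finset.range (j + 1))]
      exact tendsto_finsetSum _ fun i hi =>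
        (hc i (Finset.mem_range_succ_iff.1 hi)).comp (tendsto_add_atTop_nat 1)
    have g3 := ENNReal.Tendsto.const_mul (a := ENNReal.ofReal C₃)
      ((tendsto_iSup_tail hτ.tendsto_decayInt).comp (tendsto_add_atTop_nat 1))
      (Or.inr ENNReal.ofReal_ne_top)
    have g := (g1.add g2).add g3
    rwa [mul_zero, mul_zero, add_zero, add_zero] at g
  set P : Euc n → ℝ := fun y => ∑ i ∈ Finset.range (j + 1),
    ((i.factorial : ℝ)⁻¹) • c i (fun _ => y - x₀) with hP
  have hpoint : ∀ (N : ℕ) (r : ℝ), (1 / 2 : ℝ) ^ (N + 1) < r → r ≤ (1 / 2) ^ N →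
      ∀ y ∈ ball x₀ r, ‖dyPot j Φ σ y - P y‖ₑ ≤ G N * ENNReal.ofReal (r ^ j) +
        ENNReal.ofReal (C₃ * r ^ δ) * ∫⁻ x in ball x₀ (2 * r), ‖y - x‖ₑ ^ (-a) ∂τ := by
    intro N r hr1 hr2 y hy
    have hr : 0 < r := lt_trans (by positivity) hr1
    have hyr : ‖y - x₀‖ ≤ r := (mem_ball_iff_norm.1 hy).le
    refine (enorm_dyPot_sub_le Φ h0 hστ j (N + 1) x₀ y c).trans ?_
    have k1 : ∑ l ∈ Finset.range (N + 1), ‖(∫ x, dyKer j l Φ (y - x) ∂σ) -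
        ∑ i ∈ Finset.range (j + 1),
          ((i.factorial : ℝ)⁻¹) • dyCoef σ j l i Φ x₀ (fun _ => y - x₀)‖ₑ ≤
        ENNReal.ofReal C₁ *
          (∑ l ∈ Finset.range (N + 1), ENNReal.ofReal ((1 / 2 : ℝ) ^ (N - l)) * e l) *
          ENNReal.ofReal (r ^ j) := by
      rw [Finset.mul_sum, Finset.sum_mul]
      refine Finset.sum_le_sum fun l hl => ?_
      have hl : l ≤ N := Finset.mem_range_succ_iff.1 hl
      have h2 : (2 : ℝ) ^ l * r ≤ (1 / 2) ^ (N - l) := by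
        calc (2 : ℝ) ^ l * r ≤ 2 ^ l * (1 / 2) ^ N := by gcongr
          _ = (2 * (1 / 2)) ^ l * (1 / 2) ^ (N - l) := by
            rw [mul_pow, mul_assoc, ← pow_add, Nat.add_sub_cancel' hl]
          _ = _ := by norm_num
      have := hC₁ l x₀ (y - x₀) <| calc
        (2 : ℝ) ^ l * ‖y - x₀‖ ≤ 2 ^ l * r := by gcongr
        _ ≤ (1 / 2) ^ (N - l) := h2
        _ ≤ 1 := pow_le_one₀ (by norm_num) (by norm_num)
      rw [add_sub_cancel] at this
      refine this.trans ?_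
      calc ENNReal.ofReal (C₁ * 2 ^ l * ‖y - x₀‖ ^ (j + 1)) * e l
          ≤ ENNReal.ofReal (C₁ * ((1 / 2) ^ (N - l)) * r ^ j) * e l := by
            gcongr ENNReal.ofReal ?_ * _
            calc C₁ * 2 ^ l * ‖y - x₀‖ ^ (j + 1) ≤ C₁ * 2 ^ l * r ^ (j + 1) := by gcongr
              _ = C₁ * (2 ^ l * r) * r ^ j := by ring
              _ ≤ _ := by gcongr
        _ = _ := by
            rw [ENNReal.ofReal_mul (by positivity), ENNReal.ofReal_mul (by positivity)]; ring
    have k2 : ∑ i ∈ Finset.range (j + 1), ‖c i - ∑ l ∈ Finset.range (N + 1), dyCoef σ j l i Φ x₀‖ₑ *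
          ENNReal.ofReal (‖y - x₀‖ ^ i) ≤
        (∑ i ∈ Finset.range (j + 1), E i (N + 1)) * ENNReal.ofReal (r ^ j) := by
      rw [Finset.sum_mul]
      refine Finset.sum_le_sum fun i hi => ?_
      have hi : i ≤ j := Finset.mem_range_succ_iff.1 hi
      rw [hE]
      beta_reduce
      rw [mul_assoc, ← ENNReal.ofReal_mul (by positivity)]
      refine mul_le_mul_right (ENNReal.ofReal_le_ofReal ?_) _
      have h1 : 1 ≤ 2 ^ (N + 1) * r := by
        have : (2 : ℝ) ^ (N + 1) * (1 / 2) ^ (N + 1) ≤ 2 ^ (N + 1) * r := by gcongr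
        rwa [← mul_pow, mul_one_div_cancel two_ne_zero, one_pow] at this
      calc ‖y - x₀‖ ^ i ≤ r ^ i := by gcongr
        _ ≤ (2 ^ (N + 1) * r) ^ (j - i) * r ^ i :=
            le_mul_of_one_le_left (by positivity) (one_le_pow₀ h1)
        _ = _ := by rw [mul_pow, ← pow_mul, mul_assoc, ← pow_add, Nat.sub_add_cancel hi]
    have k3 : ∑' m, ∫⁻ x, ‖dyKer j (N + 1 + m) Φ (y - x)‖ₑ ∂τ ≤
        ENNReal.ofReal C₃ * s (N + 1) * ENNReal.ofReal (r ^ j) + ENNReal.ofReal (C₃ * r ^ δ) *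
          ∫⁻ x in ball x₀ (2 * r), ‖y - x‖ₑ ^ (-a) ∂τ := by
      refine (hC₃ τ (N + 1) r x₀ y hy).trans (add_le_add ?_ ?_)
      · rw [mul_right_comm, ← ENNReal.ofReal_mul hC₃0.le]
        gcongr
      · refine mul_le_mul_left (ENNReal.ofReal_le_ofReal ?_) _
        gcongr
    refine (add_le_add (add_le_add k1 k2) k3).trans (le_of_eq ?_)
    rw [hG]
    ring
  refine memT_iff.2 ⟨P, ?_, SmallO.of_dyadic hGlim
    (hτ.smallO_double (C := C₃) ha hC₃0.le hD) fun N r hr1 hr2 => ?_⟩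
  · refine IsPolyDeg.sum _ fun i hi => ?_
    exact ((isPolyDeg_multilinear x₀ i (c i)).mono (Finset.mem_range_succ_iff.1 hi)).clm
      (((i.factorial : ℝ)⁻¹) • ContinuousLinearMap.id ℝ ℝ)
  · have hr : 0 < r := lt_trans (by positivity) hr1
    have hR : Measurable fun y => ∫⁻ x in ball x₀ (2 * r), ‖y - x‖ₑ ^ (-a) ∂τ := by
      refine Measurable.lintegral_prod_right' (f := fun q : Euc n × Euc n => ‖q.1 - q.2‖ₑ ^ (-a)) ?_
      fun_prop
    calc eLpNorm' (fun y => dyPot j Φ σ y - P y) p (ballAvg x₀ r)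
        ≤ (∫⁻ y, (G N * ENNReal.ofReal (r ^ j) + ENNReal.ofReal (C₃ * r ^ δ) *
            ∫⁻ x in ball x₀ (2 * r), ‖y - x‖ₑ ^ (-a) ∂τ) ^ p ∂(ballAvg x₀ r)) ^ (1 / p) := by
          unfold eLpNorm'
          gcongr ?_ ^ _
          refine lintegral_mono_ae ((ballAvg_ac_restrict x₀ r).ae_le ?_)
          filter_upwards [ae_restrict_mem measurableSet_ball] with y hy
          gcongr
          exact hpoint N r hr1 hr2 y hy
      _ ≤ _ := lintegral_rpow_add_const_mul_le hp _ _ hR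
      _ ≤ _ := by
          rw [Real.rpow_natCast]
          gcongr
          exact hD' r hr x₀ τ

end DyadicPotentialMemT

section AnnularKernel

open scoped SchwartzMap FourierTransform LineDeriv

variable {n : ℕ}

/-- Schwartz functions whose Fourier transform is supported in an annulus. -/
def IsAnnular (κ : 𝓢(Euc n, ℂ)) : Prop :=
  (∀ ξ, ‖ξ‖ ≤ 1 → 𝓕 κ ξ = 0) ∧ ∀ ξ, 4 ≤ ‖ξ‖ → 𝓕 κ ξ = 0

theorem IsAnnular.lineDerivOp {κ : 𝓢(Euc n, ℂ)} (h : IsAnnular κ) (v : Euc n) :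
    IsAnnular (∂_{v} κ) := by
  have key : ∀ ξ, 𝓕 κ ξ = 0 → 𝓕 (∂_{v} κ) ξ = 0 := fun ξ hξ => by
    have ht : (inner ℝ · v : Euc n → ℝ).HasTemperateGrowth :=
      ((innerSL ℝ).flip v).hasTemperateGrowth
    rw [SchwartzMap.fourier_lineDerivOp_eq, smul_apply, SchwartzMap.smulLeftCLM_apply_apply ht, hξ]
    simp
  exact ⟨fun ξ hξ => key ξ (h.1 ξ hξ), fun ξ hξ => key ξ (h.2 ξ hξ)⟩

theorem IsAnnular.iteratedLineDerivOp {κ : 𝓢(Euc n, ℂ)} (h : IsAnnular κ) {m : ℕ}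
    (v : Fin m → Euc n) : IsAnnular (∂^{v} κ) := by
  induction m with
  | zero => simpa using h
  | succ m ih => rw [LineDeriv.iteratedLineDerivOp_succ_left]; exact (ih _).lineDerivOp _

theorem IsAnnular.integral_eq_zero {κ : 𝓢(Euc n, ℂ)} (h : IsAnnular κ) : ∫ z, κ z = 0 := by
  have := h.1 0 (by simp)
  rw [SchwartzMap.fourier_coe, Real.fourier_eq] at this
  simpa using this

/-- The real part of a complex Schwartz function. -/
noncomputable def reS (κ : 𝓢(Euc n, ℂ)) : 𝓢(Euc n, ℝ) :=
  SchwartzMap.postcompCLM (𝕜 := ℝ) Complex.reCLM κ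

theorem reS_apply (κ : 𝓢(Euc n, ℂ)) (z : Euc n) : reS κ z = (κ z).re := rfl

theorem iteratedFDeriv_reS (κ : 𝓢(Euc n, ℂ)) {i : ℕ} (v : Fin i → Euc n) (z : Euc n) :
    iteratedFDeriv ℝ i (reS κ) z v = reS (∂^{v} κ) z := by
  rw [reS_apply, SchwartzMap.iteratedLineDerivOp_eq_iteratedFDeriv]
  have : (reS κ : Euc n → ℝ) = Complex.reCLM ∘ κ := rfl
  rw [this, ContinuousLinearMap.iteratedFDeriv_comp_left _ (κ.smooth i).contDiffAt le_rfl]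
  rfl

theorem IsAnnular.integral_reS {κ : 𝓢(Euc n, ℂ)} (h : IsAnnular κ) : ∫ z, reS κ z = 0 := by
  simp_rw [reS_apply]
  have := integral_re (𝕜 := ℂ) κ.integrable (μ := volume)
  simp only [RCLike.re_to_complex] at this
  rw [this, h.integral_eq_zero, Complex.zero_re]

theorem integrable_iteratedFDeriv_schwartz (Φ : 𝓢(Euc n, ℝ)) (i : ℕ) :
    Integrable (iteratedFDeriv ℝ i Φ) volume := by
  have h := Φ.integrable_pow_mul_iteratedFDeriv (volume : Measure (Euc n)) 0 i
  simp only [pow_zero, one_mul] at h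
  exact (integrable_norm_iff ((Φ.smooth i).continuous_iteratedFDeriv
    le_rfl).aestronglyMeasurable).1 h

theorem IsAnnular.integral_iteratedFDeriv_reS {κ : 𝓢(Euc n, ℂ)} (h : IsAnnular κ) (i : ℕ) :
    ∫ z, iteratedFDeriv ℝ i (reS κ) z = 0 := by
  ext v
  rw [ContinuousMultilinearMap.integral_apply (integrable_iteratedFDeriv_schwartz _ i)]
  simp_rw [iteratedFDeriv_reS]
  exact (h.iteratedLineDerivOp v).integral_reS

theorem IsAnnular.ae_tendsto_dyadic {κ : 𝓢(Euc n, ℂ)} (h : IsAnnular κ) (σ : Measure (Euc n))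
    [IsFiniteMeasure σ] : ∀ᵐ x ∂(volume : Measure (Euc n)), ∃ c : ℝ,
      Tendsto (fun N : ℕ => ∑ l ∈ Finset.range N, ∫ y, dil l (reS κ) (x - y) ∂σ) atTop (𝓝 c) := by
  refine ae_tendsto_dyadic_measure _ (fun g hg => ?_) σ
  have hg' : MemLp (fun y => (g y : ℂ)) 2 volume := hg.ofReal
  filter_upwards [ae_tendsto_dyadic_of_memLp_two κ h.1 h.2 hg'] with x ⟨c, hc⟩
  refine ⟨c.re, ((Complex.continuous_re.tendsto c).comp hc).congr fun N => ?_⟩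
  rw [Function.comp_apply, Complex.re_sum]
  refine Finset.sum_congr rfl fun l _ => ?_
  have := integral_re (𝕜 := ℂ) (integrable_dil_mul κ l x hg')
  simp only [RCLike.re_to_complex] at this
  rw [← this]
  simp only [dil, Complex.re_mul_ofReal, Complex.smul_re, reS_apply]

theorem norm_multilinear_le_sum {i : ℕ} (M : ContinuousMultilinearMap ℝ
    (fun _ : Fin i => Euc n) ℝ) :
    ‖M‖ ≤ ∑ J : Fin i → Fin n, ‖M fun a => stdVec n (J a)‖ := by
  refine ContinuousMultilinearMap.opNorm_le_bound (by positivity) fun v => ?_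
  have hv : v = fun a => ∑ b, v a b • stdVec n b := funext fun a => eq_sum_stdVec (v a)
  conv_lhs => rw [hv]
  rw [ContinuousMultilinearMap.map_sum, Finset.sum_mul]
  refine (norm_sum_le _ _).trans (Finset.sum_le_sum fun J _ => ?_)
  rw [ContinuousMultilinearMap.map_smul_univ, norm_smul, mul_comm, norm_prod]
  gcongr with a
  exact PiLp.norm_apply_le (v a) (J a)

theorem integrable_iteratedFDeriv_dyKer_measure (Φ : 𝓢(Euc n, ℝ)) (j l i : ℕ) (x : Euc n)
    (σ : Measure (Euc n)) [IsFiniteMeasure σ] :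
    Integrable (fun y => iteratedFDeriv ℝ i (dyKer j l Φ) (x - y)) σ := by
  obtain ⟨C, hC0, hC⟩ := (dilS l Φ).exists_decay_bound 0 i
  refine Integrable.of_bound (C := ((2 : ℝ) ^ (l * j))⁻¹ * C)
    (continuous_iteratedFDeriv_dyKer Φ j l i x).aestronglyMeasurable
    (Eventually.of_forall fun y => ?_)
  have h1 : dyKer j l Φ = fun z => (((2 : ℝ) ^ (l * j))⁻¹) • (dilS l Φ) z := rfl
  rw [h1, iteratedFDeriv_const_smul_apply' ((dilS l Φ).smooth i).contDiffAt, norm_smul,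
    Real.norm_of_nonneg (by positivity)]
  gcongr
  simpa using hC i le_rfl (x - y)

theorem IsAnnular.ae_exists_tendsto_dyCoef {κ : 𝓢(Euc n, ℂ)} (h : IsAnnular κ) (j : ℕ)
    (σ : Measure (Euc n)) [IsFiniteMeasure σ] : ∀ᵐ x ∂(volume : Measure (Euc n)),
      ∃ M, Tendsto (fun N => ∑ l ∈ Finset.range N, dyCoef σ j l j (reS κ) x) atTop (𝓝 M) := by
  filter_upwards [ae_all_iff.2 fun J : Fin j → Fin n =>
    (h.iteratedLineDerivOp fun a => stdVec n (J a)).ae_tendsto_dyadic σ] with x hx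
  have hval : ∀ (l : ℕ) (J : Fin j → Fin n), dyCoef σ j l j (reS κ) x (fun a => stdVec n (J a)) =
      ∫ y, dil l (reS (∂^{fun a => stdVec n (J a)} κ)) (x - y) ∂σ := fun l J => by
    have hi : Integrable (fun y => iteratedFDeriv ℝ j (dyKer j l (reS κ)) (x - y)) σ :=
      integrable_iteratedFDeriv_dyKer_measure _ j l j x σ
    rw [dyCoef, ContinuousMultilinearMap.integral_apply hi]
    congr 1 with y
    rw [iteratedFDeriv_dyKer ((reS κ).smooth ⊤), inv_mul_cancel₀ (by positivity), one_smul]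
    simp [dil, ← iteratedFDeriv_reS]
  refine cauchySeq_tendsto_of_complete ?_
  rw [Metric.cauchySeq_iff]
  intro ε hε
  have hJ : ∀ J : Fin j → Fin n, ∃ N₀, ∀ m ≥ N₀, ∀ m' ≥ N₀,
      ‖(∑ l ∈ Finset.range m, dyCoef σ j l j (reS κ) x - ∑ l ∈ Finset.range m',
        dyCoef σ j l j (reS κ) x) (fun a => stdVec n (J a))‖ <
          ε / (Fintype.card (Fin j → Fin n) + 1) := fun J => by
    obtain ⟨c, hc⟩ := hx J
    obtain ⟨N₀, hN₀⟩ := Metric.cauchySeq_iff.1 hc.cauchySeq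
      (ε / (Fintype.card (Fin j → Fin n) + 1)) (by positivity)
    refine ⟨N₀, fun m hm m' hm' => ?_⟩
    rw [sub_apply, sum_apply, sum_apply, ← dist_eq_norm]
    simp_rw [hval]
    exact hN₀ m hm m' hm'
  choose N₀ hN₀ using hJ
  refine ⟨Finset.univ.sup N₀, fun m hm m' hm' => ?_⟩
  rw [dist_eq_norm]
  refine (norm_multilinear_le_sum _).trans_lt ?_
  calc _ ≤ ∑ _J : Fin j → Fin n, ε / (Fintype.card (Fin j → Fin n) + 1) :=
        Finset.sum_le_sum fun J _ => (hN₀ J m ((Finset.le_sup (Finset.mem_univ J)).trans hm) m'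
          ((Finset.le_sup (Finset.mem_univ J)).trans hm')).le
    _ < ε := by
        rw [Finset.sum_const, Finset.card_univ, nsmul_eq_mul, mul_div_assoc', div_lt_iff₀
          (by positivity)]
        nlinarith

theorem IsAnnular.ae_memT_dyPot {κ : 𝓢(Euc n, ℂ)} (h : IsAnnular κ) {j : ℕ} {p : ℝ} (hj : 1 ≤ j)
    (hjn : j < n) (hp : 1 ≤ p) (hpn : p * ((n : ℝ) - j) < n) (σ : Measure (Euc n))
    [IsFiniteMeasure σ] :
    ∀ᵐ x ∂(volume : Measure (Euc n)), MemT n j p (dyPot j (reS κ) σ) x := by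
  filter_upwards [ae_exists_zeroDensity σ, h.ae_exists_tendsto_dyCoef j σ] with x ⟨τ, _, hτ, hστ⟩ hM
  exact memT_dyPot _ hj hjn hp hpn (fun i _ => h.integral_iteratedFDeriv_reS i) h.integral_reS hτ
    hστ hM

end AnnularKernel

section SymbolInverse

variable {n k : ℕ} {V W : Type*}
  [NormedAddCommGroup V] [InnerProductSpace ℝ V] [FiniteDimensional ℝ V]
  [NormedAddCommGroup W] [InnerProductSpace ℝ W] [FiniteDimensional ℝ W]

theorem IsElliptic.exists_leftInverse {A : CoeffOp n k V W} (hA : IsElliptic n k A) :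
    ∃ L : Euc n → W →L[ℝ] V, (∀ ξ ≠ 0, ContDiffAt ℝ (⊤ : ℕ∞) L ξ) ∧
      ∀ ξ ≠ 0, ∀ v, L ξ (symbolMap n k A ξ v) = v := by
  set S : Euc n → V →L[ℝ] W := fun ξ => ∑ I : Fin k → Fin n,
    (∏ i, ξ (I i)) • LinearMap.toContinuousLinearMap (A I) with hS
  set T : Euc n → W →L[ℝ] V := fun ξ => ∑ I : Fin k → Fin n,
    (∏ i, ξ (I i)) • LinearMap.toContinuousLinearMap (LinearMap.adjoint (A I)) with hT
  have hcoord : ∀ I : Fin k → Fin n, ContDiff ℝ (⊤ : ℕ∞) fun ξ : Euc n => ∏ i, ξ (I i) := fun I =>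
    contDiff_prod fun i _ => by fun_prop
  have hSc : ContDiff ℝ (⊤ : ℕ∞) S := ContDiff.sum fun I _ => (hcoord I).smul contDiff_const
  have hTc : ContDiff ℝ (⊤ : ℕ∞) T := ContDiff.sum fun I _ => (hcoord I).smul contDiff_const
  have hSv : ∀ ξ v, S ξ v = symbolMap n k A ξ v := fun ξ v => by
    simp [hS, symbolMap, sum_apply, LinearMap.sum_apply]
  have hTw : ∀ ξ w v, ⟪T ξ w, v⟫ = ⟪w, S ξ v⟫ := fun ξ w v => by
    simp [hS, hT, sum_apply, sum_inner, inner_sum, inner_smul_left, inner_smul_right,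
      LinearMap.adjoint_inner_left]
  have hunit : ∀ ξ ≠ 0, IsUnit (T ξ ∘L S ξ) := fun ξ hξ => by
    have hinj : Function.Injective (T ξ ∘L S ξ : V →ₗ[ℝ] V) := by
      refine (injective_iff_map_eq_zero _).2 fun v hv => ?_
      have h0 : ⟪T ξ (S ξ v), v⟫ = 0 := by
        have : T ξ (S ξ v) = 0 := hv
        rw [this, inner_zero_left]
      rw [hTw, inner_self_eq_zero, hSv] at h0
      exact hA ξ hξ (h0.trans (map_zero _).symm)
    have := (LinearMap.isUnit_iff_ker_eq_bot _).2 (LinearMap.ker_eq_bot.2 hinj)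
    exact this.map (Module.End.toContinuousLinearMap V)
  refine ⟨fun ξ => Ring.inverse (T ξ ∘L S ξ) ∘L T ξ, fun ξ hξ => ?_, fun ξ hξ v => ?_⟩
  · obtain ⟨u, hu⟩ := hunit ξ hξ
    have h1 : ContDiffAt ℝ (⊤ : ℕ∞) (fun ξ => Ring.inverse (T ξ ∘L S ξ)) ξ := by
      have h2 := contDiffAt_ringInverse ℝ (n := (⊤ : ℕ∞)) u
      rw [hu] at h2
      exact h2.comp ξ (hTc.clm_comp hSc).contDiffAt
    exact h1.clm_comp hTc.contDiffAt
  · have := Ring.inverse_mul_cancel _ (hunit ξ hξ)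
    have h2 := congrArg (fun M : V →L[ℝ] V => M v) this
    rw [← hSv]
    exact h2

end SymbolInverse

section EllipticKernel

open scoped SchwartzMap FourierTransform LineDeriv

variable {n k : ℕ} {V W : Type*}
  [NormedAddCommGroup V] [InnerProductSpace ℝ V] [FiniteDimensional ℝ V]
  [NormedAddCommGroup W] [InnerProductSpace ℝ W] [FiniteDimensional ℝ W]

theorem fourier_iteratedLineDerivOp (κ : 𝓢(Euc n, ℂ)) {m : ℕ} (v : Fin m → Euc n) (ξ : Euc n) :
    𝓕 (∂^{v} κ) ξ = (2 * Real.pi * Complex.I) ^ m * (∏ i, ((inner ℝ ξ (v i) : ℝ) : ℂ)) * 𝓕 κ ξ := by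
  induction m with
  | zero => simp
  | succ m ih =>
    have ht : (inner ℝ · (v 0) : Euc n → ℝ).HasTemperateGrowth :=
      ((innerSL ℝ).flip (v 0)).hasTemperateGrowth
    rw [LineDeriv.iteratedLineDerivOp_succ_left, SchwartzMap.fourier_lineDerivOp_eq, smul_apply,
      SchwartzMap.smulLeftCLM_apply_apply ht, ih, Fin.prod_univ_succ]
    simp only [Fin.tail, smul_eq_mul, Complex.real_smul]
    ring

theorem inner_stdVec (ξ : Euc n) (i : Fin n) : inner ℝ ξ (stdVec n i) = ξ i := by
  simp [stdVec, EuclideanSpace.inner_single_right]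

/-- Smooth functions supported in the annulus `1 ≤ ‖ξ‖ ≤ 4`, as Fourier transforms. -/
theorem exists_annular_fourier_eq {g : Euc n → ℝ} (hg : ContDiff ℝ (⊤ : ℕ∞) g) (C : ℂ)
    (h0 : ∀ ξ, ‖ξ‖ ≤ 1 → g ξ = 0) (h1 : ∀ ξ, 4 ≤ ‖ξ‖ → g ξ = 0) :
    ∃ κ : 𝓢(Euc n, ℂ), IsAnnular κ ∧ ∀ ξ, 𝓕 κ ξ = C * g ξ := by
  have hc : HasCompactSupport fun ξ => C * (g ξ : ℂ) :=
    HasCompactSupport.intro (isCompact_closedBall 0 4) fun ξ hξ => by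
      rw [h1 ξ (by simpa using (not_le.1 (fun h => hξ (by simpa using h))).le)]; simp
  have hs : ContDiff ℝ (⊤ : ℕ∞) fun ξ => C * (g ξ : ℂ) :=
    contDiff_const.mul (Complex.ofRealCLM.contDiff.comp hg)
  have hF : ∀ ξ, 𝓕 (𝓕⁻ (hc.toSchwartzMap hs)) ξ = C * g ξ := fun ξ => by
    rw [FourierTransform.fourier_fourierInv_eq]; rfl
  refine ⟨𝓕⁻ (hc.toSchwartzMap hs), ⟨fun ξ hξ => ?_, fun ξ hξ => ?_⟩, hF⟩
  · rw [hF, h0 ξ hξ]; simp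
  · rw [hF, h1 ξ hξ]; simp

/-- The dyadic decomposition of a left parametrix of an elliptic operator. -/
theorem IsElliptic.exists_kernel {A : CoeffOp n k V W} (hA : IsElliptic n k A) {ι ι' : Type*}
    [Fintype ι] [DecidableEq ι] [Fintype ι'] (bV : OrthonormalBasis ι ℝ V)
    (bW : OrthonormalBasis ι' ℝ W) :
    ∃ (κ : ι → ι' → 𝓢(Euc n, ℂ)) (φ : 𝓢(Euc n, ℝ)), ∫ z, φ z = 1 ∧ (∀ a b, IsAnnular (κ a b)) ∧
      ∀ a c z, ∑ I : Fin k → Fin n, ∑ b, ⟪bW b, A I (bV c)⟫ * dirDeriv n k I (reS (κ a b)) z =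
        if a = c then dil 1 φ z - φ z else 0 := by
  obtain ⟨L, hLs, hL⟩ := hA.exists_leftInverse
  set η : Euc n → ℝ := fun ξ => lowBump n ((2 : ℝ)⁻¹ • ξ) - lowBump n ξ with hη
  have hηs : ContDiff ℝ (⊤ : ℕ∞) η :=
    ((lowBump n).contDiff.comp (contDiff_const_smul _)).sub (lowBump n).contDiff
  have hη0 : ∀ ξ, ‖ξ‖ ≤ 1 → η ξ = 0 := fun ξ hξ => by
    rw [hη]
    beta_reduce
    rw [lowBump_one hξ, lowBump_one, sub_self]
    rw [norm_smul, norm_inv, Real.norm_ofNat]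
    linarith
  have hη1 : ∀ ξ, 4 ≤ ‖ξ‖ → η ξ = 0 := fun ξ hξ => by
    rw [hη]
    beta_reduce
    rw [lowBump_zero (ξ := ξ) (by linarith), lowBump_zero, sub_self]
    rw [norm_smul, norm_inv, Real.norm_ofNat]
    linarith
  have hgs : ∀ a b, ContDiff ℝ (⊤ : ℕ∞) fun ξ => η ξ * ⟪bV a, L ξ (bW b)⟫ := fun a b => by
    refine contDiff_iff_contDiffAt.2 fun ξ => ?_
    rcases eq_or_ne ξ 0 with rfl | hξ
    · refine (contDiffAt_const (c := (0 : ℝ))).congr_of_eventuallyEq ?_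
      filter_upwards [closedBall_mem_nhds (0 : Euc n) one_pos] with ξ hξ
      rw [hη0 ξ (by simpa using hξ), zero_mul]
    · exact hηs.contDiffAt.mul (contDiffAt_const.inner ℝ ((hLs ξ hξ).clm_apply contDiffAt_const))
  have hκ := fun a b => exists_annular_fourier_eq (hgs a b) ((2 * Real.pi * Complex.I) ^ k)⁻¹
    (fun ξ hξ => by rw [hη0 ξ hξ, zero_mul]) (fun ξ hξ => by rw [hη1 ξ hξ, zero_mul])
  choose κ hκa hκF using hκ
  set φ : 𝓢(Euc n, ℂ) := 𝓕⁻ (lowBumpS n) with hφ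
  have hφF : 𝓕 φ = lowBumpS n := FourierTransform.fourier_fourierInv_eq _
  have hpi : ((2 * Real.pi * Complex.I) ^ k : ℂ) ≠ 0 :=
    pow_ne_zero _ (by simp [Real.pi_ne_zero])
  have key : ∀ a c, ∑ I : Fin k → Fin n, ∑ b, ((⟪bW b, A I (bV c)⟫ : ℝ) : ℂ) •
      ∂^{fun i => stdVec n (I i)} (κ a b) = if a = c then dilS 1 φ - φ else 0 := fun a c => by
    refine (FourierTransform.fourierEquiv ℂ 𝓢(Euc n, ℂ)).injective ?_
    ext ξ
    have hsum : ∑ I : Fin k → Fin n, ∑ b, ((∏ i, ξ (I i)) * ⟪bW b, A I (bV c)⟫) *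
        (η ξ * ⟪bV a, L ξ (bW b)⟫) = if a = c then η ξ else 0 := by
      have h1 : ∀ b, ∑ I : Fin k → Fin n, (∏ i, ξ (I i)) * ⟪bW b, A I (bV c)⟫ =
          ⟪bW b, symbolMap n k A ξ (bV c)⟫ := fun b => by
        simp [symbolMap, LinearMap.sum_apply, inner_sum, inner_smul_right]
      rw [Finset.sum_comm]
      simp_rw [← Finset.sum_mul, h1]
      rcases eq_or_ne (η ξ) 0 with h | h
      · simp [h]
      have hξ : ξ ≠ 0 := fun h' => h (hη0 ξ (by simp [h']))
      calc ∑ b, ⟪bW b, symbolMap n k A ξ (bV c)⟫ * (η ξ * ⟪bV a, L ξ (bW b)⟫)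
          = η ξ * ⟪bV a, L ξ (∑ b, ⟪bW b, symbolMap n k A ξ (bV c)⟫ • bW b)⟫ := by
            simp only [map_sum, map_smul, inner_sum, inner_smul_right, Finset.mul_sum]
            exact Finset.sum_congr rfl fun b _ => by ring
        _ = η ξ * ⟪bV a, bV c⟫ := by rw [bW.sum_repr' (symbolMap n k A ξ (bV c)), hL ξ hξ]
        _ = _ := by rw [orthonormal_iff_ite.1 bV.orthonormal]; split_ifs <;> simp
    have hR : 𝓕 (if a = c then dilS 1 φ - φ else 0) ξ = if a = c then (η ξ : ℂ) else 0 := by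
      split_ifs
      · change FourierTransform.fourierEquiv ℂ 𝓢(Euc n, ℂ) (dilS 1 φ - φ) ξ = _
        rw [map_sub, sub_apply,
          FourierTransform.fourierEquiv_apply, FourierTransform.fourierEquiv_apply, fourier_dilS,
          hφF, lowBumpS_apply, lowBumpS_apply, pow_one, ← Complex.ofReal_sub]
      · change FourierTransform.fourierEquiv ℂ 𝓢(Euc n, ℂ) 0 ξ = _
        rw [map_zero, zero_apply]
    simp only [map_sum, map_smul, FourierTransform.fourierEquiv_apply]
    rw [hR, show (if a = c then (η ξ : ℂ) else 0) = ((if a = c then η ξ else 0 : ℝ) : ℂ) by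
      split_ifs <;> simp, ← hsum]
    push_cast
    simp only [Finset.sum_apply, Pi.smul_apply, fourier_iteratedLineDerivOp, hκF, inner_stdVec]
    refine Finset.sum_congr rfl fun I _ => Finset.sum_congr rfl fun b _ => ?_
    rw [smul_eq_mul]
    field_simp
    rw [Complex.ofReal_mul]
    ring
  refine ⟨κ, reS φ, ?_, hκa, fun a c z => ?_⟩
  · simp_rw [reS_apply]
    have := integral_re (𝕜 := ℂ) φ.integrable (μ := volume)
    simp only [RCLike.re_to_complex] at this
    rw [this]
    have h2 : 𝓕 φ 0 = 1 := by rw [hφF, lowBumpS_apply, lowBump_one (by simp), Complex.ofReal_one]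
    rw [SchwartzMap.fourier_coe, Real.fourier_eq] at h2
    simp only [inner_zero_right, neg_zero, AddChar.map_zero_eq_one, one_smul] at h2
    rw [h2, Complex.one_re]
  · have := congrArg (fun Φ : 𝓢(Euc n, ℂ) => (Φ z).re) (key a c)
    simp only [dirDeriv, iteratedFDeriv_reS, reS_apply]
    simp only [sum_apply, smul_apply, Complex.re_sum, smul_eq_mul, Complex.re_ofReal_mul] at this
    rw [this]
    split_ifs
    · rw [sub_apply, Complex.sub_re, coe_dilS]
      simp only [dil, Complex.smul_re, reS_apply]
    · simp

end EllipticKernel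

section SumConvolution

variable {n : ℕ}

/-- The convolution of a kernel `H` with the measure `f σ`. -/
noncomputable def mconv (H f : Euc n → ℝ) (σ : Measure (Euc n)) (y : Euc n) : ℝ :=
  ∫ x, H (y - x) * f x ∂σ

theorem hasCompactSupport_of_norm {H : Euc n → ℝ} {R : ℝ} (hR : ∀ z, R < ‖z‖ → H z = 0) :
    HasCompactSupport H :=
  HasCompactSupport.intro (isCompact_closedBall (0 : Euc n) R) fun z hz => hR z (by simpa using hz)

theorem exists_norm_le_of_support {H : Euc n → ℝ} (hH : Continuous H) {R : ℝ}
    (hR : ∀ z, R < ‖z‖ → H z = 0) : ∃ C, 0 ≤ C ∧ ∀ z, ‖H z‖ ≤ C := by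
  obtain ⟨C, hC⟩ := (hasCompactSupport_of_norm hR).exists_bound_of_continuous hH
  exact ⟨C, (norm_nonneg _).trans (hC 0), hC⟩

theorem HasCompactSupport.exists_norm_radius {H : Euc n → ℝ} (h : HasCompactSupport H) :
    ∃ R : ℝ, 0 ≤ R ∧ ∀ z, R < ‖z‖ → H z = 0 := by
  obtain ⟨R, hR⟩ := h.isCompact.isBounded.subset_closedBall (0 : Euc n)
  refine ⟨max R 0, le_max_right _ _, fun z hz => image_eq_zero_of_notMem_tsupport fun hz' => ?_⟩
  have := hR hz'
  rw [mem_closedBall_zero_iff] at this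
  exact absurd hz (not_lt.2 (this.trans (le_max_left _ _)))

theorem integrable_comp_sub_mul {H f : Euc n → ℝ} {σ : Measure (Euc n)} (hH : Continuous H) {R : ℝ}
    (hR : ∀ z, R < ‖z‖ → H z = 0) (hf : LocallyIntegrable f σ) (y : Euc n) :
    Integrable (fun x => H (y - x) * f x) σ := by
  obtain ⟨C, hC0, hC⟩ := exists_norm_le_of_support hH hR
  have hi : Integrable ((closedBall y R).indicator f) σ :=
    (integrable_indicator_iff measurableSet_closedBall).2
      (hf.integrableOn_isCompact (isCompact_closedBall y R))
  refine (hi.norm.const_mul C).mono' ?_ (Eventually.of_forall fun x => ?_)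
  · exact (hH.comp (continuous_sub_left y)).aestronglyMeasurable.mul hf.aestronglyMeasurable
  · by_cases hx : x ∈ closedBall y R
    · rw [Set.indicator_of_mem hx, norm_mul]
      gcongr
      exact hC _
    · rw [hR (y - x) (by simpa [dist_eq_norm, norm_sub_rev] using hx), zero_mul, norm_zero]
      positivity

theorem ContDiff.mconv {H f : Euc n → ℝ} {σ : Measure (Euc n)} (hH : IsTestFun n H)
    (hf : LocallyIntegrable f σ) : ContDiff ℝ (⊤ : ℕ∞) (mconv H f σ) := by
  have := hH.2.contDiff_convolution_right (ContinuousLinearMap.mul ℝ ℝ) hf hH.1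
  refine (congrArg (ContDiff ℝ (⊤ : ℕ∞)) (funext fun y => ?_)).mpr this
  exact integral_congr_ae (Eventually.of_forall fun x => mul_comm _ _)

theorem integrable_prod_mul_mconv {ψ H f : Euc n → ℝ} {σ : Measure (Euc n)} [SFinite σ]
    (hψ : Continuous ψ) {S : ℝ} (hS : ∀ z, S < ‖z‖ → ψ z = 0) (hH : Continuous H) {R : ℝ}
    (hR : ∀ z, R < ‖z‖ → H z = 0) (hf : LocallyIntegrable f σ) :
    Integrable (fun z : Euc n × Euc n => ψ z.1 * (H (z.1 - z.2) * f z.2)) (volume.prod σ) := by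
  obtain ⟨C, hC0, hC⟩ := exists_norm_le_of_support hH hR
  have hi : Integrable ((closedBall (0 : Euc n) (S + R)).indicator f) σ :=
    (integrable_indicator_iff measurableSet_closedBall).2
      (hf.integrableOn_isCompact (isCompact_closedBall _ _))
  have hψi : Integrable ψ volume :=
    hψ.integrable_of_hasCompactSupport (hasCompactSupport_of_norm hS)
  refine ((hψi.norm.mul_prod hi.norm).const_mul C).mono' ?_ (Eventually.of_forall fun z => ?_)
  · exact (hψ.comp continuous_fst).aestronglyMeasurable.mul
      ((hH.comp (continuous_fst.sub continuous_snd)).aestronglyMeasurable.mul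
        hf.aestronglyMeasurable.comp_snd)
  · rcases lt_or_ge S ‖z.1‖ with h1 | h1
    · rw [hS _ h1, zero_mul, norm_zero]
      positivity
    rcases lt_or_ge R ‖z.1 - z.2‖ with h2 | h2
    · rw [hR _ h2, zero_mul, mul_zero, norm_zero]
      positivity
    rw [Set.indicator_of_mem]
    · rw [norm_mul, norm_mul]
      nlinarith [hC (z.1 - z.2), mul_nonneg (norm_nonneg (ψ z.1)) (norm_nonneg (f z.2))]
    · rw [mem_closedBall_zero_iff]
      have := norm_sub_norm_le z.2 z.1
      rw [norm_sub_rev] at this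
      linarith

theorem integrable_mul_mconv {ψ H f : Euc n → ℝ} {σ : Measure (Euc n)} [SFinite σ]
    (hψ : Continuous ψ) {S : ℝ} (hS : ∀ z, S < ‖z‖ → ψ z = 0) (hH : Continuous H) {R : ℝ}
    (hR : ∀ z, R < ‖z‖ → H z = 0) (hf : LocallyIntegrable f σ) :
    Integrable (fun y => ψ y * mconv H f σ y) volume := by
  have := (integrable_prod_mul_mconv hψ hS hH hR hf).integral_prod_left
  simp only [integral_const_mul] at this
  exact this

theorem integral_mul_mconv {ψ H f : Euc n → ℝ} {σ : Measure (Euc n)} [SFinite σ]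
    (hψ : Continuous ψ) {S : ℝ} (hS : ∀ z, S < ‖z‖ → ψ z = 0) (hH : Continuous H) {R : ℝ}
    (hR : ∀ z, R < ‖z‖ → H z = 0) (hf : LocallyIntegrable f σ) :
    ∫ y, ψ y * mconv H f σ y = ∫ x, (∫ y, ψ y * H (y - x)) * f x ∂σ := by
  have := integral_integral_swap (f := fun y x => ψ y * (H (y - x) * f x))
    (integrable_prod_mul_mconv hψ hS hH hR hf)
  simp only [integral_const_mul] at this
  rw [show (fun y => ψ y * mconv H f σ y) = fun y => ψ y * ∫ x, H (y - x) * f x ∂σ from rfl, this]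
  congr 1 with x
  rw [← integral_mul_const]
  congr 1 with y
  ring

theorem lintegral_tsum_mconv_le {H : ℕ → Euc n → ℝ} {f : Euc n → ℝ} {σ : Measure (Euc n)}
    [SFinite σ] (hH : ∀ l, Continuous (H l)) {R : ℝ} (hR : ∀ l z, R < ‖z‖ → H l z = 0)
    (hf : LocallyIntegrable f σ) (S : ℝ) :
    ∑' l, ∫⁻ y in closedBall (0 : Euc n) S, ∫⁻ x, ‖H l (y - x) * f x‖ₑ ∂σ ≤
      (∑' l, ∫⁻ z, ‖H l z‖ₑ) * ∫⁻ x in closedBall (0 : Euc n) (S + R), ‖f x‖ₑ ∂σ := by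
  rw [← ENNReal.tsum_mul_right]
  refine ENNReal.tsum_le_tsum fun l => ?_
  rw [lintegral_lintegral_swap]
  · rw [← lintegral_indicator measurableSet_closedBall, ← lintegral_const_mul'']
    · refine lintegral_mono fun x => ?_
      by_cases hx : x ∈ closedBall (0 : Euc n) (S + R)
      · rw [Set.indicator_of_mem hx]
        simp_rw [enorm_mul]
        rw [lintegral_mul_const'' _ (by fun_prop)]
        gcongr ?_ * _
        refine (setLIntegral_le_lintegral _ _).trans_eq ?_
        exact lintegral_sub_right_eq_self (fun z => ‖H l z‖ₑ) x
      · rw [Set.indicator_of_notMem hx, mul_zero, nonpos_iff_eq_zero]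
        refine (setLIntegral_congr_fun measurableSet_closedBall fun y hy => ?_).trans
          lintegral_zero
        rw [hR l, zero_mul, enorm_zero]
        rw [mem_closedBall_zero_iff] at hx hy
        have := norm_sub_norm_le x y
        rw [norm_sub_rev] at this
        linarith
    · exact (hf.aestronglyMeasurable.enorm).indicator measurableSet_closedBall
  · refine AEStronglyMeasurable.enorm (f := fun z : Euc n × Euc n => H l (z.1 - z.2) * f z.2) ?_
    exact ((hH l).comp (continuous_fst.sub continuous_snd)).aestronglyMeasurable.mul
        hf.aestronglyMeasurable.comp_snd

end SumConvolution

section SumConvolution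

variable {n : ℕ}

theorem enorm_mconv_le (H f : Euc n → ℝ) (σ : Measure (Euc n)) (y : Euc n) :
    ‖mconv H f σ y‖ₑ ≤ ∫⁻ x, ‖H (y - x) * f x‖ₑ ∂σ :=
  enorm_integral_le_lintegral_enorm _

theorem aemeasurable_lintegral_mconv {H f : Euc n → ℝ} {σ : Measure (Euc n)} [SFinite σ]
    (hH : Continuous H) (hf : LocallyIntegrable f σ) :
    AEMeasurable (fun y => ∫⁻ x, ‖H (y - x) * f x‖ₑ ∂σ) volume := by
  refine AEMeasurable.lintegral_prod_right'
    (f := fun z : Euc n × Euc n => ‖H (z.1 - z.2) * f z.2‖ₑ) (AEStronglyMeasurable.enorm ?_)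
  exact (hH.comp (continuous_fst.sub continuous_snd)).aestronglyMeasurable.mul
    hf.aestronglyMeasurable.comp_snd

theorem aestronglyMeasurable_mconv {H f : Euc n → ℝ} {σ : Measure (Euc n)} [SFinite σ]
    (hH : Continuous H) (hf : LocallyIntegrable f σ) :
    AEStronglyMeasurable (mconv H f σ) volume := by
  refine AEStronglyMeasurable.integral_prod_right'
    (f := fun z : Euc n × Euc n => H (z.1 - z.2) * f z.2) ?_
  exact (hH.comp (continuous_fst.sub continuous_snd)).aestronglyMeasurable.mul
    hf.aestronglyMeasurable.comp_snd

theorem hasSum_integral_mul_mconv {H : ℕ → Euc n → ℝ} {f ψ : Euc n → ℝ} {σ : Measure (Euc n)}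
    [SFinite σ] (hH : ∀ l, Continuous (H l)) {R : ℝ} (hR : ∀ l z, R < ‖z‖ → H l z = 0)
    (hf : LocallyIntegrable f σ) (hs : ∑' l, ∫⁻ z, ‖H l z‖ₑ ≠ ⊤) (hψ : Continuous ψ) {S : ℝ}
    (hS : ∀ z, S < ‖z‖ → ψ z = 0) :
    Integrable (fun y => ψ y * ∑' l, mconv (H l) f σ y) volume ∧
    HasSum (fun l => ∫ y, ψ y * mconv (H l) f σ y) (∫ y, ψ y * ∑' l, mconv (H l) f σ y) := by
  obtain ⟨C, hC0, hC⟩ := exists_norm_le_of_support hψ hS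
  have hi := fun l => integrable_mul_mconv hψ hS (hH l) (hR l) hf
  have hle : ∑' l, ∫⁻ y, ‖ψ y * mconv (H l) f σ y‖ₑ < ⊤ := by
    have h1 : ∀ l, ∫⁻ y, ‖ψ y * mconv (H l) f σ y‖ₑ ≤
        ENNReal.ofReal C * ∫⁻ y in closedBall (0 : Euc n) S, ∫⁻ x, ‖H l (y - x) * f x‖ₑ ∂σ := by
      intro l
      rw [← lintegral_const_mul' _ _ ENNReal.ofReal_ne_top,
        ← lintegral_indicator measurableSet_closedBall]
      refine lintegral_mono fun y => ?_
      by_cases hy : y ∈ closedBall (0 : Euc n) S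
      · rw [Set.indicator_of_mem hy, enorm_mul]
        gcongr
        · rw [← ofReal_norm]
          exact ENNReal.ofReal_le_ofReal (hC y)
        · exact enorm_mconv_le _ _ _ _
      · rw [hS y (by simpa using hy)]
        simp
    refine (ENNReal.tsum_le_tsum h1).trans_lt ?_
    rw [ENNReal.tsum_mul_left]
    exact ENNReal.mul_lt_top ENNReal.ofReal_lt_top ((lintegral_tsum_mconv_le hH hR hf S).trans_lt
      (ENNReal.mul_lt_top hs.lt_top
      (hf.integrableOn_isCompact (isCompact_closedBall (0 : Euc n) (S + R))).2))
  have hnorm : Summable fun l => ∫ y, ‖ψ y * mconv (H l) f σ y‖ := by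
    have h2 : ∀ l, ∫ y, ‖ψ y * mconv (H l) f σ y‖ =
        (∫⁻ y, ‖ψ y * mconv (H l) f σ y‖ₑ).toReal := fun l =>
      integral_norm_eq_lintegral_enorm (hi l).aestronglyMeasurable
    simp_rw [h2]
    exact ENNReal.summable_toReal hle.ne
  have h3 := hasSum_integral_of_summable_integral_norm hi hnorm
  simp_rw [tsum_mul_left] at h3
  refine ⟨?_, h3⟩
  have hm : AEStronglyMeasurable (fun y => ∑' l, ψ y * mconv (H l) f σ y) volume :=
    AEStronglyMeasurable.tsum fun l => (hi l).aestronglyMeasurable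
  refine ⟨by simpa only [tsum_mul_left] using hm, ?_⟩
  refine lt_of_le_of_lt (lintegral_mono fun y => ?_) ((lintegral_tsum fun l =>
    (hi l).aestronglyMeasurable.enorm).trans_lt hle)
  beta_reduce
  rw [← tsum_mul_left]
  exact enorm_tsum_le_tsum_enorm

theorem locallyIntegrable_tsum_mconv {H : ℕ → Euc n → ℝ} {f : Euc n → ℝ} {σ : Measure (Euc n)}
    [SFinite σ] (hH : ∀ l, Continuous (H l)) {R : ℝ} (hR : ∀ l z, R < ‖z‖ → H l z = 0)
    (hf : LocallyIntegrable f σ) (hs : ∑' l, ∫⁻ z, ‖H l z‖ₑ ≠ ⊤) :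
    LocallyIntegrable (fun y => ∑' l, mconv (H l) f σ y) volume := by
  refine locallyIntegrable_iff.2 fun K hK => ?_
  obtain ⟨S, hS⟩ := hK.isBounded.subset_closedBall (0 : Euc n)
  refine IntegrableOn.mono_set ?_ hS
  refine ⟨(AEStronglyMeasurable.tsum fun l =>
    aestronglyMeasurable_mconv (hH l) hf).restrict, ?_⟩
  refine lt_of_le_of_lt (lintegral_mono fun y => ?_) ((lintegral_tsum fun l =>
    (aemeasurable_lintegral_mconv (hH l) hf).restrict).trans_lt
      ((lintegral_tsum_mconv_le hH hR hf S).trans_lt (ENNReal.mul_lt_top hs.lt_top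
      (hf.integrableOn_isCompact (isCompact_closedBall (0 : Euc n) (S + R))).2)))
  exact enorm_tsum_le_tsum_enorm.trans (ENNReal.tsum_le_tsum fun l => enorm_mconv_le _ _ _ _)

theorem tendsto_integral_mul_mconv {Q : ℕ → Euc n → ℝ} {Q' f ψ : Euc n → ℝ} {σ : Measure (Euc n)}
    [SFinite σ] (hQ : ∀ N, Continuous (Q N)) {R C : ℝ} (hR : ∀ N z, R < ‖z‖ → Q N z = 0)
    (hC : ∀ N z, ‖Q N z‖ ≤ C) (hf : LocallyIntegrable f σ) (hψ : Continuous ψ) {S : ℝ}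
    (hS : ∀ z, S < ‖z‖ → ψ z = 0) (hlim : ∀ z, Tendsto (fun N => Q N z) atTop (𝓝 (Q' z))) :
    Tendsto (fun N => ∫ y, ψ y * mconv (Q N) f σ y) atTop (𝓝 (∫ y, ψ y * mconv Q' f σ y)) := by
  have hC0 : 0 ≤ C := (norm_nonneg _).trans (hC 0 0)
  have hbd : ∀ y, ∀ N x, ‖Q N (y - x) * f x‖ ≤ C * ‖(closedBall y R).indicator f x‖ :=
    fun y N x => by
    by_cases hx : x ∈ closedBall y R
    · rw [Set.indicator_of_mem hx, norm_mul]
      gcongr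
      exact hC _ _
    · rw [hR N (y - x) (by simpa [dist_eq_norm, norm_sub_rev] using hx), zero_mul, norm_zero]
      positivity
  have hint : ∀ (y : Euc n) (R : ℝ), Integrable ((closedBall y R).indicator f) σ := fun y R =>
    (integrable_indicator_iff measurableSet_closedBall).2
      (hf.integrableOn_isCompact (isCompact_closedBall y R))
  have hψi : Integrable ψ volume :=
    hψ.integrable_of_hasCompactSupport (hasCompactSupport_of_norm hS)
  refine tendsto_integral_of_dominated_convergence
    (fun y => ‖ψ y‖ * (C * ∫ x, ‖(closedBall (0 : Euc n) (S + R)).indicator f x‖ ∂σ))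
    (fun N => hψ.aestronglyMeasurable.mul (aestronglyMeasurable_mconv (hQ N) hf))
    (hψi.norm.mul_const _) (fun N => Eventually.of_forall fun y => ?_)
    (Eventually.of_forall fun y => Tendsto.const_mul _ ?_)
  · rcases lt_or_ge S ‖y‖ with h1 | h1
    · rw [hS _ h1, zero_mul, norm_zero]
      positivity
    rw [norm_mul]
    gcongr
    rw [← integral_const_mul]
    refine norm_integral_le_of_norm_le ((hint _ _).norm.const_mul C)
      (Eventually.of_forall fun x => (hbd y N x).trans ?_)
    gcongr
    refine norm_indicator_le_of_subset ?_ _ _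
    intro x hx
    rw [mem_closedBall, dist_eq_norm] at hx
    rw [mem_closedBall_zero_iff]
    linarith [norm_sub_norm_le x y]
  · exact tendsto_integral_of_dominated_convergence _
      (fun N => ((hQ N).comp (continuous_sub_left y)).aestronglyMeasurable.mul
        hf.aestronglyMeasurable)
      ((hint y R).norm.const_mul C) (fun N => Eventually.of_forall fun x => hbd y N x)
      (Eventually.of_forall fun x => (hlim _).mul_const _)

end SumConvolution

section DirDeriv

variable {n : ℕ} {F : Type*} [NormedAddCommGroup F] [NormedSpace ℝ F]

theorem ContDiff.dirDeriv {φ : Euc n → F} (h : ContDiff ℝ (⊤ : ℕ∞) φ) {m : ℕ}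
    (I : Fin m → Fin n) : ContDiff ℝ (⊤ : ℕ∞) (dirDeriv n m I φ) :=
  (ContinuousMultilinearMap.apply ℝ (fun _ : Fin m => Euc n) F _).contDiff.comp
    (h.iteratedFDeriv_right (m := (⊤ : ℕ∞)) (by exact_mod_cast le_top))

theorem IsTestFun.dirDeriv {φ : Euc n → F} (h : IsTestFun n φ) {m : ℕ} (I : Fin m → Fin n) :
    IsTestFun n (dirDeriv n m I φ) :=
  ⟨h.1.dirDeriv I, (h.2.iteratedFDeriv m).comp_left
    (g := fun M : ContinuousMultilinearMap ℝ (fun _ : Fin m => Euc n) F => M fun i => stdVec n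
      (I i))
    rfl⟩

theorem dirDeriv_zero (I : Fin 0 → Fin n) (φ : Euc n → F) : dirDeriv n 0 I φ = φ := by
  ext x; simp [dirDeriv]

theorem dirDeriv_succ {φ : Euc n → F} (h : ContDiff ℝ (⊤ : ℕ∞) φ) {m : ℕ}
    (I : Fin (m + 1) → Fin n) : dirDeriv n (m + 1) I φ =
      fun x => fderiv ℝ (dirDeriv n m (Fin.tail I) φ) x (stdVec n (I 0)) := by
  ext x
  exact DifferentiableAt.iteratedFDeriv_succ_apply_left'
    ((h.differentiable_iteratedFDeriv (WithTop.coe_lt_coe.2 (ENat.natCast_lt_top m))) x)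

theorem ContDiff.fderiv_stdVec {φ : Euc n → F} (h : ContDiff ℝ (⊤ : ℕ∞) φ) (i : Fin n) :
    ContDiff ℝ (⊤ : ℕ∞) fun x => fderiv ℝ φ x (stdVec n i) :=
  (h.fderiv_right (m := (⊤ : ℕ∞)) (by simp)).clm_apply contDiff_const

theorem fderiv_stdVec_comm {φ : Euc n → F} (h : ContDiff ℝ (⊤ : ℕ∞) φ) (i j : Fin n) (x : Euc n) :
    fderiv ℝ (fun x => fderiv ℝ φ x (stdVec n i)) x (stdVec n j) =
      fderiv ℝ (fun x => fderiv ℝ φ x (stdVec n j)) x (stdVec n i) := by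
  have hd : DifferentiableAt ℝ (fderiv ℝ φ) x :=
    (h.fderiv_right (m := (⊤ : ℕ∞)) (by simp)).differentiable (by simp) x
  rw [fderiv_clm_apply hd (differentiableAt_const _), fderiv_clm_apply hd
    (differentiableAt_const _)]
  simpa using (h.contDiffAt.isSymmSndFDerivAt
    (by simp only [minSmoothness_of_isRCLikeNormedField]
        exact WithTop.coe_le_coe.2 (le_top (a := (2 : ℕ∞))))).eq (stdVec n j) (stdVec n i)

theorem dirDeriv_fderiv_comm {φ : Euc n → F} (h : ContDiff ℝ (⊤ : ℕ∞) φ) (i : Fin n) {m : ℕ}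
    (I : Fin m → Fin n) : dirDeriv n m I (fun x => fderiv ℝ φ x (stdVec n i)) =
      fun x => fderiv ℝ (dirDeriv n m I φ) x (stdVec n i) := by
  induction m with
  | zero => simp [dirDeriv_zero]
  | succ m ih =>
    rw [dirDeriv_succ (h.fderiv_stdVec i), dirDeriv_succ h, ih]
    ext x
    exact fderiv_stdVec_comm (h.dirDeriv _) _ _ _

theorem dirDeriv_comp_sub_left {H : Euc n → F} (hH : ContDiff ℝ (⊤ : ℕ∞) H) {m : ℕ}
    (I : Fin m → Fin n) (y x : Euc n) :
    dirDeriv n m I (fun x => H (y - x)) x = (-1 : ℝ) ^ m • dirDeriv n m I H (y - x) := by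
  have h1 : (fun x => H (y - x)) = fun x => (fun z => H (y + z)) ((-1 : ℝ) • x) := by
    ext x; simp [sub_eq_add_neg]
  have h2 : ContDiff ℝ (⊤ : ℕ∞) fun z => H (y + z) := hH.comp (contDiff_const.add contDiff_id)
  rw [dirDeriv, h1, iteratedFDeriv_comp_const_smul _ (h2.of_le (by exact_mod_cast le_top))]
  simp [dirDeriv, iteratedFDeriv_comp_add_left, sub_eq_add_neg]

theorem dirDeriv_comp_sub_right (H : Euc n → F) {m : ℕ} (I : Fin m → Fin n) (x y : Euc n) :
    dirDeriv n m I (fun y => H (y - x)) y = dirDeriv n m I H (y - x) := by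
  simp [dirDeriv, iteratedFDeriv_comp_sub]

theorem dirDeriv_clm_comp {F' : Type*} [NormedAddCommGroup F'] [NormedSpace ℝ F'] {φ : Euc n → F}
    (h : ContDiff ℝ (⊤ : ℕ∞) φ) (L : F →L[ℝ] F') {m : ℕ} (I : Fin m → Fin n) (x : Euc n) :
    dirDeriv n m I (fun x => L (φ x)) x = L (dirDeriv n m I φ x) := by
  have := L.iteratedFDeriv_comp_left (i := m) (h.contDiffAt (x := x)) (by exact_mod_cast le_top)
  rw [dirDeriv, show (fun x => L (φ x)) = L ∘ φ from rfl, this]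
  rfl

theorem integral_fderiv_mul {g ψ : Euc n → ℝ} (hg : ContDiff ℝ (⊤ : ℕ∞) g) (hψ : IsTestFun n ψ)
    (i : Fin n) : ∫ x, fderiv ℝ ψ x (stdVec n i) * g x =
      -∫ x, ψ x * fderiv ℝ g x (stdVec n i) := by
  have h1 : HasCompactSupport fun x => fderiv ℝ ψ x (stdVec n i) :=
    (hψ.2.fderiv ℝ).comp_left (g := fun L : Euc n →L[ℝ] ℝ => L (stdVec n i)) rfl
  rw [integral_mul_fderiv_eq_neg_fderiv_mul_of_integrable (𝕜 := ℝ) (f := ψ) (g := g), neg_neg]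
  · exact ((hψ.1.fderiv_stdVec i).continuous.mul hg.continuous).integrable_of_hasCompactSupport
      h1.mul_right
  · exact (hψ.1.continuous.mul (hg.fderiv_stdVec i).continuous).integrable_of_hasCompactSupport
      hψ.2.mul_right
  · exact (hψ.1.continuous.mul hg.continuous).integrable_of_hasCompactSupport hψ.2.mul_right
  · exact fun x _ => hψ.1.differentiable (by simp) x
  · exact fun x _ => hg.differentiable (by simp) x

/-- Integration by parts against a test function. -/
theorem integral_dirDeriv_mul {g ψ : Euc n → ℝ} (hg : ContDiff ℝ (⊤ : ℕ∞) g)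
    (hψ : IsTestFun n ψ) {m : ℕ} (I : Fin m → Fin n) :
    ∫ x, dirDeriv n m I ψ x * g x = (-1 : ℝ) ^ m * ∫ x, ψ x * dirDeriv n m I g x := by
  induction m generalizing g with
  | zero => simp [dirDeriv_zero]
  | succ m ih =>
    rw [dirDeriv_succ hψ.1, integral_fderiv_mul hg (hψ.dirDeriv _), ih (hg.fderiv_stdVec _),
      dirDeriv_fderiv_comm hg, dirDeriv_succ hg, pow_succ]
    ring

/-- Integration by parts for the convolution of a test function with a measure. -/
theorem integral_dirDeriv_mul_mconv {H f ψ : Euc n → ℝ} {σ : Measure (Euc n)} [SFinite σ]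
    (hψ : IsTestFun n ψ) (hH : IsTestFun n H) (hf : LocallyIntegrable f σ) {m : ℕ}
    (I : Fin m → Fin n) : ∫ y, dirDeriv n m I ψ y * mconv H f σ y =
      (-1 : ℝ) ^ m * ∫ y, ψ y * mconv (dirDeriv n m I H) f σ y := by
  obtain ⟨S, -, hS⟩ := hψ.2.exists_norm_radius
  obtain ⟨S', -, hS'⟩ := (hψ.dirDeriv I).2.exists_norm_radius
  obtain ⟨R, -, hR⟩ := hH.2.exists_norm_radius
  obtain ⟨R', -, hR'⟩ := (hH.dirDeriv I).2.exists_norm_radius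
  rw [integral_mul_mconv (hψ.dirDeriv I).1.continuous hS' hH.1.continuous hR hf,
    integral_mul_mconv hψ.1.continuous hS (hH.dirDeriv I).1.continuous hR' hf,
    ← integral_const_mul]
  congr 1 with x
  rw [integral_dirDeriv_mul (g := fun y => H (y - x))
    (hH.1.comp (contDiff_id.sub contDiff_const)) hψ, mul_assoc]
  simp only [dirDeriv_comp_sub_right]

end DirDeriv

section ApproximateIdentity

open scoped SchwartzMap

variable {n : ℕ}

theorem integral_dil_mul (φ h : Euc n → ℝ) (l : ℕ) :
    ∫ z, dil l φ z * h z = ∫ z, φ z * h (((2 : ℝ) ^ l)⁻¹ • z) := by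
  rw [← integral_dil (fun z => φ z * h (((2 : ℝ) ^ l)⁻¹ • z)) l]
  congr 1 with z
  simp only [dil, smul_eq_mul]
  rw [smul_smul, inv_mul_cancel₀ (by positivity), one_smul]
  ring

theorem tendsto_integral_mul_mconv_dil {φ : 𝓢(Euc n, ℝ)} (hφ : ∫ z, φ z = 1) {χ ψ u : Euc n → ℝ}
    (hχ : Continuous χ) {R : ℝ} (hR : ∀ z, R < ‖z‖ → χ z = 0) (hχ0 : χ 0 = 1) (hψ : Continuous ψ)
    {S : ℝ} (hS : ∀ z, S < ‖z‖ → ψ z = 0) (hu : LocallyIntegrable u volume) :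
    Tendsto (fun N => ∫ y, ψ y * mconv (fun z => χ z * dil N φ z) u volume y) atTop
      (𝓝 (∫ y, ψ y * u y)) := by
  obtain ⟨C, hC0, hC⟩ := exists_norm_le_of_support hχ hR
  obtain ⟨D, hD0, hD⟩ := exists_norm_le_of_support hψ hS
  have hcd : ∀ N, Continuous fun z => χ z * dil N φ z := fun N =>
    hχ.mul (continuous_dil φ.continuous N)
  have hz : ∀ N z, R < ‖z‖ → χ z * dil N φ z = 0 := fun N z h => by rw [hR z h, zero_mul]
  simp_rw [fun N => integral_mul_mconv hψ hS (hcd N) (hz N) hu]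
  have hin : ∀ N x, ∫ y, ψ y * (χ (y - x) * dil N φ (y - x)) =
      ∫ z, φ z * (ψ (((2 : ℝ) ^ N)⁻¹ • z + x) * χ (((2 : ℝ) ^ N)⁻¹ • z)) := fun N x => by
    rw [← integral_dil_mul φ (fun z => ψ (z + x) * χ z) N,
      ← integral_sub_right_eq_self (fun z => dil N φ z * (ψ (z + x) * χ z)) x]
    congr 1 with y
    rw [sub_add_cancel]
    ring
  have hbd : ∀ N x z, ‖φ z * (ψ (((2 : ℝ) ^ N)⁻¹ • z + x) * χ (((2 : ℝ) ^ N)⁻¹ • z))‖ ≤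
      ‖φ z‖ * (D * C) := fun N x z => by
    rw [norm_mul, norm_mul]
    gcongr
    · exact hD _
    · exact hC _
  have hsm : ∀ z : Euc n, Tendsto (fun N : ℕ => ((2 : ℝ) ^ N)⁻¹ • z) atTop (𝓝 0) := fun z => by
    have := (tendsto_inv_atTop_zero.comp (tendsto_pow_atTop_atTop_of_one_lt
      (one_lt_two (α := ℝ)))).smul_const z
    simpa using this
  have hi : Integrable ((closedBall (0 : Euc n) (S + R)).indicator u) volume :=
    (integrable_indicator_iff measurableSet_closedBall).2
      (hu.integrableOn_isCompact (isCompact_closedBall _ _))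
  refine tendsto_integral_of_dominated_convergence
    (fun x => (∫ z, ‖φ z‖ * (D * C)) * ‖(closedBall (0 : Euc n) (S + R)).indicator u x‖)
    (fun N => ?_) (hi.norm.const_mul _) (fun N => Eventually.of_forall fun x => ?_)
    (Eventually.of_forall fun x => ?_)
  · refine AEStronglyMeasurable.mul ?_ hu.aestronglyMeasurable
    refine (AEStronglyMeasurable.integral_prod_right'
      (f := fun z : Euc n × Euc n => ψ z.2 * (χ (z.2 - z.1) * dil N φ (z.2 - z.1))) ?_)
    exact ((hψ.comp continuous_snd).mul ((hcd N).comp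
      (continuous_snd.sub continuous_fst))).aestronglyMeasurable
  · by_cases hx : x ∈ closedBall (0 : Euc n) (S + R)
    · rw [Set.indicator_of_mem hx, norm_mul, hin]
      gcongr
      exact norm_integral_le_of_norm_le (φ.integrable.norm.mul_const _)
        (Eventually.of_forall (hbd N x))
    · have : ∀ y, ψ y * (χ (y - x) * dil N φ (y - x)) = 0 := fun y => by
        rcases lt_or_ge S ‖y‖ with h1 | h1
        · rw [hS y h1, zero_mul]
        rw [hz, mul_zero]
        rw [mem_closedBall_zero_iff] at hx
        have := norm_sub_norm_le x y
        rw [norm_sub_rev] at this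
        linarith
      simp_rw [this, integral_zero, zero_mul, norm_zero]
      exact mul_nonneg (integral_nonneg fun z => by positivity) (norm_nonneg _)
  · refine Tendsto.mul_const _ ?_
    simp_rw [hin]
    have h1 : ψ x = ∫ z, φ z * (ψ (0 + x) * χ 0) := by
      rw [integral_mul_const, hφ, hχ0, zero_add]; ring
    rw [h1]
    refine tendsto_integral_of_dominated_convergence (fun z => ‖φ z‖ * (D * C)) (fun N => ?_)
      (φ.integrable.norm.mul_const _) (fun N => Eventually.of_forall (hbd N x))
      (Eventually.of_forall fun z => ?_)
    · exact (φ.continuous.mul ((hψ.comp (by fun_prop)).mul (hχ.comp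
        (by fun_prop)))).aestronglyMeasurable
    · refine Tendsto.const_mul _ (Tendsto.mul ?_ ?_)
      · exact (hψ.tendsto _).comp ((hsm z).add_const x)
      · exact (hχ.tendsto _).comp (hsm z)

end ApproximateIdentity

section KernelSplit

open scoped SchwartzMap

variable {n : ℕ}

/-- A smooth cutoff, equal to `1` for `‖z‖ ≤ 1 / 2` and to `0` for `1 ≤ ‖z‖`. -/
noncomputable def cutoff (n : ℕ) (z : Euc n) : ℝ := lowBump n ((2 : ℝ) • z)

theorem isTestFun_lowBump (n : ℕ) : IsTestFun n (lowBump n : Euc n → ℝ) :=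
  ⟨(lowBump n).contDiff, (lowBump n).hasCompactSupport⟩

theorem isTestFun_cutoff (n : ℕ) : IsTestFun n (cutoff n) :=
  ⟨(lowBump n).contDiff.comp (g := (lowBump n : Euc n → ℝ)) (contDiff_const_smul (2 : ℝ)),
    (lowBump n).hasCompactSupport.comp_smul (two_ne_zero)⟩

theorem cutoff_one {z : Euc n} (h : ‖z‖ ≤ 1 / 2) : cutoff n z = 1 :=
  lowBump_one (by rw [norm_smul, Real.norm_ofNat]; linarith)

theorem cutoff_zero {z : Euc n} (h : 1 ≤ ‖z‖) : cutoff n z = 0 :=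
  lowBump_zero (by rw [norm_smul, Real.norm_ofNat]; linarith)

/-- The part of `dyKer` near the origin. -/
noncomputable def nearKer (k l : ℕ) (Φ : Euc n → ℝ) (z : Euc n) : ℝ := cutoff n z * dyKer k l Φ z

/-- The part of `dyKer` away from the origin. -/
noncomputable def farKer (k l : ℕ) (Φ : Euc n → ℝ) (z : Euc n) : ℝ :=
  (1 - cutoff n z) * dyKer k l Φ z

theorem nearKer_eq (k l : ℕ) (Φ : Euc n → ℝ) :
    nearKer k l Φ = fun z => dyKer k l Φ z - farKer k l Φ z := by
  ext z; simp only [nearKer, farKer]; ring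

theorem isTestFun_nearKer {Φ : Euc n → ℝ} (hΦ : ContDiff ℝ (⊤ : ℕ∞) Φ) (k l : ℕ) :
    IsTestFun n (nearKer k l Φ) :=
  ⟨(isTestFun_cutoff n).1.mul (contDiff_dyKer hΦ k l), (isTestFun_cutoff n).2.mul_right⟩

theorem contDiff_farKer {Φ : Euc n → ℝ} (hΦ : ContDiff ℝ (⊤ : ℕ∞) Φ) (k l : ℕ) :
    ContDiff ℝ (⊤ : ℕ∞) (farKer k l Φ) :=
  (contDiff_const.sub (isTestFun_cutoff n).1).mul (contDiff_dyKer hΦ k l)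

theorem nearKer_zero {k l : ℕ} {Φ : Euc n → ℝ} {z : Euc n} (h : 1 < ‖z‖) :
    nearKer k l Φ z = 0 := by
  rw [nearKer, cutoff_zero h.le, zero_mul]

theorem IsTestFun.exists_iteratedFDeriv_bound {H : Euc n → ℝ} (hH : IsTestFun n H) (i : ℕ) :
    ∃ C : ℝ, 0 ≤ C ∧ ∀ z, ‖iteratedFDeriv ℝ i H z‖ ≤ C := by
  obtain ⟨C, hC⟩ := (hH.1.continuous_iteratedFDeriv (m := i)
    (by exact_mod_cast le_top)).bounded_above_of_compact_support (hH.2.iteratedFDeriv i)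
  exact ⟨C, (norm_nonneg _).trans (hC 0), hC⟩

theorem exists_iteratedFDeriv_one_sub_cutoff_bound (n i : ℕ) :
    ∃ C : ℝ, 0 ≤ C ∧ ∀ z : Euc n, ‖iteratedFDeriv ℝ i (fun z => 1 - cutoff n z) z‖ ≤ C := by
  obtain ⟨C, hC0, hC⟩ := (isTestFun_cutoff n).exists_iteratedFDeriv_bound i
  refine ⟨1 + C, by positivity, fun z => ?_⟩
  have h2 : ContDiff ℝ i (cutoff n) := (isTestFun_cutoff n).1.of_le (by exact_mod_cast le_top)
  have h1 : iteratedFDeriv ℝ i (fun z => 1 - cutoff n z) z =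
      iteratedFDeriv ℝ i (fun _ : Euc n => (1 : ℝ)) z - iteratedFDeriv ℝ i (cutoff n) z :=
    iteratedFDeriv_sub_apply (f := fun _ : Euc n => (1 : ℝ)) contDiff_const.contDiffAt h2.contDiffAt
  rw [h1]
  refine (norm_sub_le _ _).trans (add_le_add ?_ (hC z))
  rcases Nat.eq_zero_or_pos i with rfl | hi
  · simp
  · rw [iteratedFDeriv_const_of_ne hi.ne']; simp

theorem exists_farKer_bound (Φ : 𝓢(Euc n, ℝ)) (k i : ℕ) :
    ∃ C : ℝ, 0 ≤ C ∧ ∀ l z, ‖iteratedFDeriv ℝ i (farKer k l Φ) z‖ ≤ C * (1 / 2) ^ l := by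
  obtain ⟨C, hC0, hC⟩ := Φ.exists_decay_bound (i + n + 1) i
  choose B hB0 hB using exists_iteratedFDeriv_one_sub_cutoff_bound n
  have hd : ∀ i' ≤ i, ∀ l (z : Euc n), 1 / 2 ≤ ‖z‖ → ‖iteratedFDeriv ℝ i' (dyKer k l Φ) z‖ ≤
      C * 2 ^ (i + n + 1) * (1 / 2) ^ l := fun i' hi' l z hz => by
    rw [iteratedFDeriv_dyKer (Φ.smooth ⊤), dil, smul_smul, norm_smul,
      Real.norm_of_nonneg (by positivity)]
    have h2 : (2 : ℝ) ^ l * (1 / 2) ≤ 1 + ‖(2 : ℝ) ^ l • z‖ := by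
      rw [norm_smul, Real.norm_of_nonneg (by positivity)]
      nlinarith [pow_pos (two_pos : (0 : ℝ) < 2) l]
    calc ((2 : ℝ) ^ (l * k))⁻¹ * 2 ^ (l * i') * 2 ^ (l * n) *
          ‖iteratedFDeriv ℝ i' Φ ((2 : ℝ) ^ l • z)‖
        ≤ 1 * 2 ^ (l * i) * 2 ^ (l * n) * (C * (((2 : ℝ) ^ l * (1 / 2)) ^ (i + n + 1))⁻¹) := by
          gcongr
          · exact inv_le_one_of_one_le₀ (one_le_pow₀ one_le_two)
          · exact one_le_two
          · refine (hC i' hi' _).trans ?_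
            gcongr
      _ = C * 2 ^ (i + n + 1) * (1 / 2) ^ l := by
          rw [mul_pow, one_div, inv_pow, inv_pow, ← pow_mul, mul_inv, inv_inv, mul_add l, mul_add l,
            pow_add, pow_add _ (l * i), mul_one]
          field_simp
  refine ⟨∑ s ∈ Finset.range (i + 1), (i.choose s : ℝ) * B s * (C * 2 ^ (i + n + 1)),
    Finset.sum_nonneg fun s _ => by have := hB0 s; positivity, fun l z => ?_⟩
  rcases lt_or_ge ‖z‖ (1 / 2) with hz | hz
  · have h0 : farKer k l Φ =ᶠ[𝓝 z] fun _ => (0 : ℝ) := by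
      filter_upwards [(isOpen_lt continuous_norm continuous_const).mem_nhds hz] with w hw
      rw [farKer, cutoff_one (le_of_lt hw), sub_self, zero_mul]
    rw [h0.iteratedFDeriv ℝ i |>.eq_of_nhds]
    have : iteratedFDeriv ℝ i (fun _ : Euc n => (0 : ℝ)) z = 0 := by
      rw [iteratedFDeriv_fun_zero]; rfl
    rw [this, norm_zero]
    have := hB0
    refine mul_nonneg (Finset.sum_nonneg fun s _ => ?_) (by positivity)
    have := hB0 s
    positivity
  · refine (norm_iteratedFDeriv_mul_le (contDiff_const.sub (isTestFun_cutoff n).1)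
      (contDiff_dyKer (Φ.smooth ⊤) k l) z (n := i) (by exact_mod_cast le_top)).trans ?_
    rw [Finset.sum_mul]
    refine Finset.sum_le_sum fun s _ => ?_
    rw [mul_assoc _ (C * 2 ^ (i + n + 1))]
    exact mul_le_mul (mul_le_mul_of_nonneg_left (hB s z) (by positivity))
      (hd _ (Nat.sub_le _ _) l z hz) (norm_nonneg _) (mul_nonneg (by positivity) (hB0 s))

/-- The sum of the far parts. -/
noncomputable def farSum (k : ℕ) (Φ : Euc n → ℝ) (z : Euc n) : ℝ := ∑' l, farKer k l Φ z

theorem contDiff_farSum (Φ : 𝓢(Euc n, ℝ)) (k : ℕ) : ContDiff ℝ (⊤ : ℕ∞) (farSum k Φ) := by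
  choose C hC0 hC using exists_farKer_bound Φ k
  exact contDiff_tsum (v := fun i l => C i * (1 / 2) ^ l)
    (fun l => contDiff_farKer (Φ.smooth ⊤) k l)
    (fun i _ => (summable_geometric_two).mul_left (C i)) fun i l z _ => hC i l z

theorem exists_dirDeriv_farKer_bound (Φ : 𝓢(Euc n, ℝ)) (k : ℕ) {m : ℕ} (I : Fin m → Fin n) :
    ∃ C : ℝ, 0 ≤ C ∧ ∀ l z, ‖dirDeriv n m I (farKer k l Φ) z‖ ≤ C * (1 / 2) ^ l := by
  obtain ⟨C, hC0, hC⟩ := exists_farKer_bound Φ k m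
  refine ⟨C, hC0, fun l z => ?_⟩
  refine (ContinuousMultilinearMap.le_opNorm _ _).trans ?_
  simpa [stdVec] using hC l z

theorem dirDeriv_farSum (Φ : 𝓢(Euc n, ℝ)) (k : ℕ) {m : ℕ} (I : Fin m → Fin n) (z : Euc n) :
    HasSum (fun l => dirDeriv n m I (farKer k l Φ) z) (dirDeriv n m I (farSum k Φ) z) := by
  choose C hC0 hC using exists_farKer_bound Φ k
  have hs := fun i => (summable_geometric_two).mul_left (C i)
  have h1 : Summable fun l => iteratedFDeriv ℝ m (farKer k l Φ) z :=
    Summable.of_norm_bounded (hs m) fun l => hC m l z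
  have h2 : iteratedFDeriv ℝ m (farSum k Φ) z = ∑' l, iteratedFDeriv ℝ m (farKer k l Φ) z :=
    iteratedFDeriv_tsum_apply (N := (⊤ : ℕ∞)) (v := fun i l => C i * (1 / 2) ^ l)
      (fun l => contDiff_farKer (Φ.smooth ⊤) k l) (fun i _ => hs i) (fun i l z _ => hC i l z)
      (by exact_mod_cast le_top) z
  simp only [dirDeriv, h2]
  exact h1.hasSum.mapL
    (ContinuousMultilinearMap.apply ℝ (fun _ : Fin m => Euc n) ℝ (fun i => stdVec n (I i)))

theorem dirDeriv_dyKer {Φ : Euc n → ℝ} (hΦ : ContDiff ℝ (⊤ : ℕ∞) Φ) {m j k : ℕ} (h : m + j = k)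
    (I : Fin m → Fin n) (l : ℕ) :
    dirDeriv n m I (dyKer k l Φ) = dyKer j l (dirDeriv n m I Φ) := by
  ext z
  rw [dirDeriv, iteratedFDeriv_dyKer hΦ]
  have : (((2 : ℝ) ^ (l * k))⁻¹ * 2 ^ (l * m)) = (2 ^ (l * j))⁻¹ := by
    rw [← h, mul_add, pow_add]; field_simp
  simp only [this, dyKer, dil, dirDeriv, _root_.smul_apply, smul_eq_mul]

theorem dirDeriv_nearKer {Φ : Euc n → ℝ} (hΦ : ContDiff ℝ (⊤ : ℕ∞) Φ) {m j k : ℕ} (h : m + j = k)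
    (I : Fin m → Fin n) (l : ℕ) (z : Euc n) : dirDeriv n m I (nearKer k l Φ) z =
      dyKer j l (dirDeriv n m I Φ) z - dirDeriv n m I (farKer k l Φ) z := by
  have hm : ((m : ℕ) : WithTop ℕ∞) ≤ ((⊤ : ℕ∞) : WithTop ℕ∞) := by exact_mod_cast le_top
  have := iteratedFDeriv_sub_apply (i := m) (x := z)
    ((contDiff_dyKer hΦ k l).of_le hm).contDiffAt ((contDiff_farKer hΦ k l).of_le hm).contDiffAt
  rw [← dirDeriv_dyKer hΦ h, nearKer_eq, dirDeriv]
  change iteratedFDeriv ℝ m (dyKer k l Φ - farKer k l Φ) z _ = _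
  rw [this]
  rfl

theorem dirDeriv_zero_of_norm {H : Euc n → ℝ} {R : ℝ} (hR : ∀ z, R < ‖z‖ → H z = 0) {m : ℕ}
    (I : Fin m → Fin n) {z : Euc n} (hz : R < ‖z‖) : dirDeriv n m I H z = 0 := by
  have h0 : H =ᶠ[𝓝 z] fun _ => (0 : ℝ) := by
    filter_upwards [(isOpen_lt continuous_const continuous_norm).mem_nhds hz] with w hw
    exact hR w hw
  rw [dirDeriv, h0.iteratedFDeriv ℝ m |>.eq_of_nhds, iteratedFDeriv_fun_zero]
  rfl

theorem lintegral_dyKer (j l : ℕ) (Φ : 𝓢(Euc n, ℝ)) :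
    ∫⁻ z, ‖dyKer j l Φ z‖ₑ = ENNReal.ofReal (((2 : ℝ) ^ (l * j))⁻¹) * ∫⁻ z, ‖Φ z‖ₑ := by
  have h1 : Integrable (dyKer j l Φ) volume := (integrable_dil Φ l).const_mul _
  rw [← ofReal_integral_norm_eq_lintegral_enorm h1,
    ← ofReal_integral_norm_eq_lintegral_enorm Φ.integrable, ← ENNReal.ofReal_mul (by positivity),
    ← integral_dil (fun z => ‖Φ z‖) l, ← integral_const_mul]
  congr 2
  ext z
  rw [dyKer, norm_mul, Real.norm_of_nonneg (by positivity), dil, norm_smul,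
    Real.norm_of_nonneg (by positivity)]
  rfl

theorem tsum_ofReal_inv_two_pow_ne_top {j : ℕ} (hj : 1 ≤ j) :
    ∑' l : ℕ, ENNReal.ofReal (((2 : ℝ) ^ (l * j))⁻¹) ≠ ⊤ := by
  refine (ENNReal.tsum_le_tsum (g := fun l => ENNReal.ofReal ((1 / 2) ^ l)) fun l => ?_).trans_lt
    summable_geometric_two.tsum_ofReal_lt_top |>.ne
  refine ENNReal.ofReal_le_ofReal ?_
  rw [one_div, inv_pow]
  gcongr
  · exact one_le_two
  · exact Nat.le_mul_of_pos_right l hj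

theorem tsum_lintegral_dyKer_ne_top {j : ℕ} (hj : 1 ≤ j) (Φ : 𝓢(Euc n, ℝ)) :
    ∑' l, ∫⁻ z, ‖dyKer j l Φ z‖ₑ ≠ ⊤ := by
  simp_rw [lintegral_dyKer, ENNReal.tsum_mul_right]
  exact ENNReal.mul_ne_top (tsum_ofReal_inv_two_pow_ne_top hj) Φ.integrable.2.ne

theorem tsum_lintegral_dirDeriv_nearKer_ne_top (Φ : 𝓢(Euc n, ℝ)) {m j k : ℕ} (h : m + j = k)
    (I : Fin m → Fin n) (Ψ : 𝓢(Euc n, ℝ)) (hΨ : ∀ z, dirDeriv n m I Φ z = Ψ z) (hj : 1 ≤ j) :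
    ∑' l, ∫⁻ z, ‖dirDeriv n m I (nearKer k l Φ) z‖ₑ ≠ ⊤ := by
  obtain ⟨C, hC0, hC⟩ := exists_dirDeriv_farKer_bound Φ k I
  have hΨ' : dirDeriv n m I Φ = Ψ := funext hΨ
  have hle : ∀ l, ∫⁻ z, ‖dirDeriv n m I (nearKer k l Φ) z‖ₑ ≤
      (∫⁻ z, ‖dyKer j l Ψ z‖ₑ) +
        ENNReal.ofReal (C * (1 / 2) ^ l) * volume (closedBall (0 : Euc n) 1) := fun l => by
    rw [← setLIntegral_eq_of_support_subset (s := closedBall (0 : Euc n) 1)]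
    · refine (setLIntegral_mono' measurableSet_closedBall (g := fun z =>
        ‖dyKer j l Ψ z‖ₑ + ENNReal.ofReal (C * (1 / 2) ^ l)) fun z _ => ?_).trans ?_
      · rw [dirDeriv_nearKer (Φ.smooth ⊤) h, hΨ']
        refine (enorm_sub_le).trans (add_le_add le_rfl ?_)
        rw [← ofReal_norm]
        exact ENNReal.ofReal_le_ofReal (hC l z)
      · rw [lintegral_add_right _ measurable_const, setLIntegral_const]
        exact add_le_add (setLIntegral_le_lintegral _ _) le_rfl
    · intro z hz
      by_contra hz'
      refine hz ?_
      beta_reduce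
      rw [dirDeriv_zero_of_norm (R := 1) (H := nearKer k l Φ) (fun z hz => nearKer_zero hz) I
        (by simpa using hz'), enorm_zero]
  refine (ENNReal.tsum_le_tsum hle).trans_lt ?_ |>.ne
  rw [ENNReal.tsum_add, ENNReal.tsum_mul_right]
  exact ENNReal.add_lt_top.2 ⟨(tsum_lintegral_dyKer_ne_top hj Ψ).lt_top, ENNReal.mul_lt_top
    (summable_geometric_two.mul_left C).tsum_ofReal_lt_top
      (isCompact_closedBall _ _).measure_lt_top⟩

end KernelSplit

section LocalizedKernel

open scoped SchwartzMap

variable {n k : ℕ} {V W : Type*}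
  [NormedAddCommGroup V] [InnerProductSpace ℝ V] [FiniteDimensional ℝ V]
  [NormedAddCommGroup W] [InnerProductSpace ℝ W] [FiniteDimensional ℝ W]
  {ι ι' : Type*} [Fintype ι] [Fintype ι']

theorem HasDistribA.scalar {A : CoeffOp n k V W} {u : Euc n → V} {σ : Measure (Euc n)}
    {f : Euc n → W} (h : HasDistribA n k A u σ f) (w : W) {ρ : Euc n → ℝ} (hρ : IsTestFun n ρ) :
    (-1 : ℝ) ^ k * ∑ I : Fin k → Fin n,
      ∫ x, dirDeriv n k I ρ x * ⟪LinearMap.adjoint (A I) w, u x⟫ =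
      ∫ x, ρ x * ⟪w, f x⟫ ∂σ := by
  have h1 : IsTestFun n fun x => ρ x • w := ⟨hρ.1.smul contDiff_const, hρ.2.smul_right⟩
  have h2 := h _ h1
  have h3 : ∀ (I : Fin k → Fin n) x, dirDeriv n k I (fun x => ρ x • w) x = dirDeriv n k I ρ x • w :=
    fun I x => dirDeriv_clm_comp hρ.1 ((ContinuousLinearMap.id ℝ ℝ).smulRight w) I x
  simp only [h3, map_smul, real_inner_smul_right] at h2
  simpa only [real_inner_comm] using h2

theorem mconv_const_mul (a : ℝ) (H f : Euc n → ℝ) (σ : Measure (Euc n)) (y : Euc n) :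
    mconv (fun z => a * H z) f σ y = a * mconv H f σ y := by
  simp only [mconv, mul_assoc, integral_const_mul]

theorem mconv_sum {α : Type*} (s : Finset α) {H : α → Euc n → ℝ} {f : Euc n → ℝ}
    {σ : Measure (Euc n)} (hH : ∀ i ∈ s, Continuous (H i)) {R : ℝ}
    (hR : ∀ i ∈ s, ∀ z, R < ‖z‖ → H i z = 0) (hf : LocallyIntegrable f σ) (y : Euc n) :
    mconv (fun z => ∑ i ∈ s, H i z) f σ y = ∑ i ∈ s, mconv (H i) f σ y := by
  simp only [mconv, Finset.sum_mul]
  exact integral_finsetSum _ fun i hi => integrable_comp_sub_mul (hH i hi) (hR i hi) hf y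

theorem mconv_add {H H' f : Euc n → ℝ} {σ : Measure (Euc n)} (hH : Continuous H)
    (hH' : Continuous H') {R : ℝ} (hR : ∀ z, R < ‖z‖ → H z = 0) (hR' : ∀ z, R < ‖z‖ → H' z = 0)
    (hf : LocallyIntegrable f σ) (y : Euc n) :
    mconv (fun z => H z + H' z) f σ y = mconv H f σ y + mconv H' f σ y := by
  simp only [mconv, add_mul]
  exact integral_add (integrable_comp_sub_mul hH hR hf y) (integrable_comp_sub_mul hH' hR' hf y)

theorem MeasureTheory.LocallyIntegrable.inner_const {E : Type*} [NormedAddCommGroup E]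
    [InnerProductSpace ℝ E] {f : Euc n → E} {σ : Measure (Euc n)} (hf : LocallyIntegrable f σ)
    (w : E) : LocallyIntegrable (fun x => ⟪w, f x⟫) σ := fun x =>
  (hf x).elim fun s ⟨hs, hi⟩ => ⟨s, hs, (innerSL ℝ w).integrable_comp hi⟩

theorem HasDistribA.mconv_eq {A : CoeffOp n k V W} {u : Euc n → V} {σ : Measure (Euc n)}
    {f : Euc n → W} (h : HasDistribA n k A u σ f) (hu : LocallyIntegrable u volume)
    (bV : OrthonormalBasis ι ℝ V) (w : W) {G : Euc n → ℝ} (hG : IsTestFun n G) (y : Euc n) :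
    mconv G (fun x => ⟪w, f x⟫) σ y = ∑ c, mconv (fun z => ∑ I : Fin k → Fin n,
      ⟪w, A I (bV c)⟫ * dirDeriv n k I G z) (fun x => ⟪bV c, u x⟫) volume y := by
  have hρ : IsTestFun n fun x => G (y - x) :=
    ⟨hG.1.comp (contDiff_const.sub contDiff_id), hG.2.comp_homeomorph (Homeomorph.subLeft y)⟩
  have h1 := h.scalar w hρ
  rw [mconv, ← h1]
  have hR : ∀ I : Fin k → Fin n, ∃ R : ℝ, 0 ≤ R ∧ ∀ z, R < ‖z‖ → dirDeriv n k I G z = 0 :=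
    fun I => (hG.dirDeriv I).2.exists_norm_radius
  obtain ⟨R, -, hR⟩ := hG.2.exists_norm_radius
  have hint : ∀ (I : Fin k → Fin n) c, Integrable
      (fun x => ⟪w, A I (bV c)⟫ * dirDeriv n k I G (y - x) * ⟪bV c, u x⟫) volume := fun I c => by
    simp_rw [mul_assoc]
    exact (integrable_comp_sub_mul (hG.dirDeriv I).1.continuous
      (fun z hz => dirDeriv_zero_of_norm hR I hz) (hu.inner_const (bV c)) y).const_mul _
  simp only [mconv, Finset.sum_mul]
  rw [Finset.mul_sum]
  simp_rw [integral_finsetSum _ fun I _ => hint I _]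
  rw [Finset.sum_comm]
  refine Finset.sum_congr rfl fun I _ => ?_
  rw [← integral_finsetSum _ fun c _ => hint I c, ← integral_const_mul]
  congr 1 with x
  rw [dirDeriv_comp_sub_left hG.1, smul_eq_mul, ← mul_assoc, ← mul_assoc, ← pow_add, ← two_mul,
    pow_mul, neg_one_sq, one_pow, one_mul, ← bV.sum_inner_mul_inner, Finset.mul_sum]
  refine Finset.sum_congr rfl fun c _ => ?_
  rw [LinearMap.adjoint_inner_left]
  ring

theorem dil_dil_one (φ : Euc n → ℝ) (l : ℕ) (z : Euc n) : dil l (dil 1 φ) z = dil (l + 1) φ z := by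
  simp only [dil, smul_smul, add_mul, pow_add, pow_one, one_mul]
  rw [mul_comm 2]

/-- Summing dyadic copies of the kernel telescopes. -/
theorem IsElliptic.exists_localized_kernel [DecidableEq ι] {A : CoeffOp n k V W}
    (hA : IsElliptic n k A)
    (bV : OrthonormalBasis ι ℝ V) (bW : OrthonormalBasis ι' ℝ W) :
    ∃ (κ : ι → ι' → 𝓢(Euc n, ℂ)) (φ : 𝓢(Euc n, ℝ)) (QN : ℕ → ι → ι → Euc n → ℝ)
      (Q : ι → ι → Euc n → ℝ),
      ∫ z, φ z = 1 ∧ (∀ a b, IsAnnular (κ a b)) ∧ (∀ a c, IsTestFun n (Q a c)) ∧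
      (∀ N a c, Continuous (QN N a c)) ∧ (∀ N a c z, 2 < ‖z‖ → QN N a c z = 0) ∧
      (∀ a c, ∃ C, ∀ N z, ‖QN N a c z‖ ≤ C) ∧
      (∀ a c z, Tendsto (fun N => QN N a c z) atTop (𝓝 (Q a c z))) ∧
      ∀ N a c z, ∑ l ∈ Finset.range N, ∑ b, ∑ I : Fin k → Fin n,
        ⟪bW b, A I (bV c)⟫ * dirDeriv n k I (nearKer k l (reS (κ a b))) z =
        (if a = c then 1 else 0) * (lowBump n z * dil N φ z) + QN N a c z := by
  obtain ⟨κ, φ, hφ, hκ, hid⟩ := hA.exists_kernel bV bW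
  set t : ℕ → ι → ι → Euc n → ℝ := fun l a c z => ∑ b, ∑ I : Fin k → Fin n,
    ⟪bW b, A I (bV c)⟫ * dirDeriv n k I (farKer k l (reS (κ a b))) z with ht
  set T : ι → ι → Euc n → ℝ := fun a c z => ∑ b, ∑ I : Fin k → Fin n,
    ⟪bW b, A I (bV c)⟫ * dirDeriv n k I (farSum k (reS (κ a b))) z with hT
  set δ : ι → ι → ℝ := fun a c => if a = c then 1 else 0 with hδ
  have hδ1 : ∀ a c, |δ a c| ≤ 1 := fun a c => by
    simp only [hδ]; split_ifs <;> simp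
  have hts : ∀ l a c, ContDiff ℝ (⊤ : ℕ∞) (t l a c) := fun l a c =>
    ContDiff.sum fun b _ => ContDiff.sum fun I _ =>
      contDiff_const.mul ((contDiff_farKer (SchwartzMap.smooth _ ⊤) k l).dirDeriv I)
  have hTs : ∀ a c, ContDiff ℝ (⊤ : ℕ∞) (T a c) := fun a c =>
    ContDiff.sum fun b _ => ContDiff.sum fun I _ =>
      contDiff_const.mul ((contDiff_farSum _ k).dirDeriv I)
  have hsum : ∀ a c z, HasSum (fun l => t l a c z) (T a c z) := fun a c z =>
    hasSum_sum fun b _ => hasSum_sum fun I _ => (dirDeriv_farSum _ k I z).mul_left _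
  have htb : ∀ a c, ∃ C, 0 ≤ C ∧ ∀ l z, ‖t l a c z‖ ≤ C * (1 / 2) ^ l := fun a c => by
    choose D hD0 hD using fun b => fun I : Fin k → Fin n =>
      exists_dirDeriv_farKer_bound (reS (κ a b)) k I
    refine ⟨∑ b, ∑ I, ‖⟪bW b, A I (bV c)⟫‖ * D b I, Finset.sum_nonneg fun b _ =>
      Finset.sum_nonneg fun I _ => mul_nonneg (norm_nonneg _) (hD0 b I), fun l z => ?_⟩
    rw [Finset.sum_mul]
    refine norm_sum_le_of_le _ fun b _ => ?_
    rw [Finset.sum_mul]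
    refine norm_sum_le_of_le _ fun I _ => ?_
    rw [norm_mul, mul_assoc]
    exact mul_le_mul_of_nonneg_left (hD b I l z) (norm_nonneg _)
  refine ⟨κ, φ, fun N a c z => lowBump n z * (-(δ a c * φ z) - ∑ l ∈ Finset.range N, t l a c z),
    fun a c z => lowBump n z * (-(δ a c * φ z) - T a c z), hφ, hκ, fun a c =>
    ⟨(lowBump n).contDiff.mul ((contDiff_const.mul (φ.smooth ⊤)).neg.sub (hTs a c)),
      (lowBump n).hasCompactSupport.mul_right⟩, fun N a c => ?_, fun N a c z hz => ?_,
    fun a c => ?_, fun a c z => ?_, fun N a c z => ?_⟩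
  · exact (lowBump n).continuous.mul ((continuous_const.mul φ.continuous).neg.sub
      (continuous_finsetSum _ fun l _ => (hts l a c).continuous))
  · beta_reduce
    rw [lowBump_zero hz.le, zero_mul]
  · obtain ⟨C, hC0, hC⟩ := htb a c
    obtain ⟨D, hD0, hD⟩ := φ.exists_decay_bound 0 0
    refine ⟨1 * (1 * D + C * 2), fun N z => ?_⟩
    rw [norm_mul]
    refine mul_le_mul ?_ ?_ (norm_nonneg _) zero_le_one
    · rw [Real.norm_of_nonneg (lowBump n).nonneg]; exact (lowBump n).le_one
    · refine (norm_sub_le _ _).trans (add_le_add ?_ ?_)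
      · rw [norm_neg, norm_mul]
        refine mul_le_mul (hδ1 a c) ?_ (norm_nonneg _) zero_le_one
        simpa using hD 0 le_rfl z
      · refine (norm_sum_le_of_le _ fun l _ => hC l z).trans ?_
        rw [← Finset.mul_sum]
        exact mul_le_mul_of_nonneg_left ((summable_geometric_two.sum_le_tsum _
          fun l _ => by positivity).trans tsum_geometric_two.le) hC0
  · exact (tendsto_const_nhds.sub (hsum a c z).tendsto_sum_nat).const_mul _
  · have key : ∀ l z, ∑ b, ∑ I : Fin k → Fin n,
        ⟪bW b, A I (bV c)⟫ * dirDeriv n k I (nearKer k l (reS (κ a b))) z =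
        δ a c * (dil (l + 1) φ z - dil l φ z) - t l a c z := fun l z => by
      have h1 : ∀ b (I : Fin k → Fin n), dirDeriv n k I (nearKer k l (reS (κ a b))) z =
          dil l (dirDeriv n k I (reS (κ a b))) z - dirDeriv n k I (farKer k l (reS (κ a b))) z :=
        fun b I => by
          rw [dirDeriv_nearKer (SchwartzMap.smooth _ ⊤) (add_zero k) I l z]
          simp [dyKer]
      simp only [h1, mul_sub, Finset.sum_sub_distrib, ht]
      congr 1
      have h2 := congrArg ((2 : ℝ) ^ (l * n) * ·) (hid a c ((2 : ℝ) ^ l • z))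
      beta_reduce at h2
      rw [Finset.sum_comm, Finset.mul_sum] at h2
      simp only [dil, smul_eq_mul]
      calc _ = _ := ?_
        _ = _ := h2
        _ = _ := ?_
      · refine Finset.sum_congr rfl fun b _ => ?_
        rw [Finset.mul_sum]
        exact Finset.sum_congr rfl fun I _ => by ring
      · have h3 := dil_dil_one φ l z
        simp only [dil, smul_eq_mul] at h3
        simp only [hδ, ← h3]
        split_ifs
        · simp only [dil, smul_eq_mul]; ring
        · ring
    have hE : ∑ l ∈ Finset.range N, ∑ b, ∑ I : Fin k → Fin n,
        ⟪bW b, A I (bV c)⟫ * dirDeriv n k I (nearKer k l (reS (κ a b))) z =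
        δ a c * (dil N φ z - φ z) - ∑ l ∈ Finset.range N, t l a c z := by
      simp only [key, Finset.sum_sub_distrib, ← Finset.mul_sum]
      have h4 := Finset.sum_range_sub (fun l => dil l φ z) N
      rw [Finset.sum_sub_distrib] at h4
      rw [h4]
      simp [dil]
    rcases le_or_gt ‖z‖ 1 with hz | hz
    · rw [hE]
      beta_reduce
      rw [lowBump_one hz]; ring
    · have h0 : ∑ l ∈ Finset.range N, ∑ b, ∑ I : Fin k → Fin n,
          ⟪bW b, A I (bV c)⟫ * dirDeriv n k I (nearKer k l (reS (κ a b))) z = 0 :=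
        Finset.sum_eq_zero fun l _ => Finset.sum_eq_zero fun b _ => Finset.sum_eq_zero fun I _ => by
          rw [dirDeriv_zero_of_norm (R := 1) (H := nearKer k l (reS (κ a b)))
            (fun z hz => nearKer_zero hz) I hz, mul_zero]
      have h5 := hE.symm.trans h0
      rw [h0]
      have : δ a c * (lowBump n z * dil N φ z) +
          lowBump n z * (-(δ a c * φ z) - ∑ l ∈ Finset.range N, t l a c z) =
          lowBump n z * (δ a c * (dil N φ z - φ z) - ∑ l ∈ Finset.range N, t l a c z) := by ring
      rw [this, h5, mul_zero]

end LocalizedKernel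

section WeakDerivative

open scoped SchwartzMap LineDeriv

variable {n k : ℕ} {V W : Type*}
  [NormedAddCommGroup V] [InnerProductSpace ℝ V] [FiniteDimensional ℝ V]
  [NormedAddCommGroup W] [InnerProductSpace ℝ W] [FiniteDimensional ℝ W]
  {ι ι' : Type*} [Fintype ι] [Fintype ι']

theorem dirDeriv_reS (κ : 𝓢(Euc n, ℂ)) {m : ℕ} (I : Fin m → Fin n) :
    dirDeriv n m I (reS κ) = reS (∂^{fun i => stdVec n (I i)} κ) :=
  funext fun z => iteratedFDeriv_reS κ _ z

theorem tsum_lintegral_dirDeriv_nearKer_reS_ne_top (κ : 𝓢(Euc n, ℂ)) {m j : ℕ} (h : m + j = k)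
    (hj : 1 ≤ j) (I : Fin m → Fin n) :
    ∑' l, ∫⁻ z, ‖dirDeriv n m I (nearKer k l (reS κ)) z‖ₑ ≠ ⊤ :=
  tsum_lintegral_dirDeriv_nearKer_ne_top _ h I _ (congrFun (dirDeriv_reS κ I)) hj

/-- The components of the weak derivative of order `m` of `u` along `I`. -/
noncomputable def weakComp (k : ℕ) {m : ℕ} (I : Fin m → Fin n) (κ : ι' → 𝓢(Euc n, ℂ))
    (Q : ι → Euc n → ℝ) (u : ι → Euc n → ℝ) (f : ι' → Euc n → ℝ) (σ : Measure (Euc n))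
    (y : Euc n) : ℝ :=
  ∑ b, ∑' l, mconv (dirDeriv n m I (nearKer k l (reS (κ b)))) (f b) σ y -
    ∑ c, mconv (dirDeriv n m I (Q c)) (u c) volume y

theorem locallyIntegrable_weakComp {m j : ℕ} (h : m + j = k) (hj : 1 ≤ j) (I : Fin m → Fin n)
    (κ : ι' → 𝓢(Euc n, ℂ)) {Q : ι → Euc n → ℝ} (hQ : ∀ c, IsTestFun n (Q c))
    {u : ι → Euc n → ℝ} (hu : ∀ c, LocallyIntegrable (u c) volume) {σ : Measure (Euc n)}
    [SFinite σ] {f : ι' → Euc n → ℝ} (hf : ∀ b, LocallyIntegrable (f b) σ) :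
    LocallyIntegrable (weakComp k I κ Q u f σ) volume := by
  have h1 : LocallyIntegrable (fun y => ∑ b, ∑' l,
      mconv (dirDeriv n m I (nearKer k l (reS (κ b)))) (f b) σ y) volume :=
    locallyIntegrable_finsetSum _ fun b _ => locallyIntegrable_tsum_mconv
      (fun l => ((isTestFun_nearKer (SchwartzMap.smooth _ ⊤) k l).dirDeriv I).1.continuous)
      (fun l z hz => dirDeriv_zero_of_norm (R := 1) (fun z hz => nearKer_zero hz) I hz) (hf b)
      (tsum_lintegral_dirDeriv_nearKer_reS_ne_top (κ b) h hj I)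
  have h2 : Continuous fun y => ∑ c, mconv (dirDeriv n m I (Q c)) (u c) volume y :=
    continuous_finsetSum _ fun c _ => (ContDiff.mconv ((hQ c).dirDeriv I) (hu c)).continuous
  exact h1.sub h2.locallyIntegrable

theorem IsElliptic.exists_weakComp {A : CoeffOp n k V W} (hA : IsElliptic n k A)
    (bV : OrthonormalBasis ι ℝ V) (bW : OrthonormalBasis ι' ℝ W) :
    ∃ (κ : ι → ι' → 𝓢(Euc n, ℂ)) (Q : ι → ι → Euc n → ℝ),
      (∀ a b, IsAnnular (κ a b)) ∧ (∀ a c, IsTestFun n (Q a c)) ∧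
      ∀ {u : Euc n → V} {σ : Measure (Euc n)} {f : Euc n → W} [SFinite σ]
        (_ : LocallyIntegrable u volume) (_ : LocallyIntegrable f σ) (_ : HasDistribA n k A u σ f)
        {m j : ℕ} (_ : m + j = k) (_ : 1 ≤ j) (I : Fin m → Fin n) {ψ : Euc n → ℝ}
        (_ : IsTestFun n ψ) (a : ι),
        ∫ x, dirDeriv n m I ψ x * ⟪bV a, u x⟫ = (-1 : ℝ) ^ m * ∫ x, ψ x *
          weakComp k I (κ a) (Q a) (fun c x => ⟪bV c, u x⟫) (fun b x => ⟪bW b, f x⟫) σ x := by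
  classical
  obtain ⟨κ, φ, QN, Q, hφ, hκ, hQ, hQc, hQR, hQb, hQl, hid⟩ := hA.exists_localized_kernel bV bW
  refine ⟨κ, Q, hκ, hQ, fun {u σ f} _ hu hf h {m j} hmj hj I {ψ} hψ a => ?_⟩
  have hG : ∀ l b, IsTestFun n (nearKer k l (reS (κ a b))) :=
    fun l b => isTestFun_nearKer (SchwartzMap.smooth _ ⊤) k l
  have hG1 : ∀ l b z, 1 < ‖z‖ → nearKer k l (reS (κ a b)) z = 0 := fun l b z hz => nearKer_zero hz
  have hfb := fun b => hf.inner_const (bW b)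
  have huc := fun c => hu.inner_const (bV c)
  have hdil : ∀ N, Continuous fun z => lowBump n z * dil N φ z := fun N =>
    (lowBump n).continuous.mul (continuous_dil φ.continuous N)
  have hdil0 : ∀ N z, 2 < ‖z‖ → lowBump n z * dil N φ z = 0 := fun N z hz => by
    rw [lowBump_zero hz.le, zero_mul]
  have hpt : ∀ N y, ∑ l ∈ Finset.range N, ∑ b,
      mconv (nearKer k l (reS (κ a b))) (fun x => ⟪bW b, f x⟫) σ y =
      mconv (fun z => lowBump n z * dil N φ z) (fun x => ⟪bV a, u x⟫) volume y +
        ∑ c, mconv (QN N a c) (fun x => ⟪bV c, u x⟫) volume y := fun N y => by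
    have hc : ∀ l b c, Continuous fun z => ∑ I : Fin k → Fin n,
        ⟪bW b, A I (bV c)⟫ * dirDeriv n k I (nearKer k l (reS (κ a b))) z := fun l b c =>
      continuous_finsetSum _ fun I _ => continuous_const.mul ((hG l b).dirDeriv I).1.continuous
    have hc0 : ∀ l b c z, 1 < ‖z‖ → ∑ I : Fin k → Fin n,
        ⟪bW b, A I (bV c)⟫ * dirDeriv n k I (nearKer k l (reS (κ a b))) z = 0 :=
      fun l b c z hz => Finset.sum_eq_zero fun I _ => by
        rw [dirDeriv_zero_of_norm (hG1 l b) I hz, mul_zero]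
    have h1 : ∀ l b, mconv (nearKer k l (reS (κ a b))) (fun x => ⟪bW b, f x⟫) σ y = _ :=
      fun l b => h.mconv_eq hu bV (bW b) (hG l b) y
    simp only [h1]
    have h2 : ∀ c, ∑ l ∈ Finset.range N, ∑ b, mconv (fun z => ∑ I : Fin k → Fin n,
        ⟪bW b, A I (bV c)⟫ * dirDeriv n k I (nearKer k l (reS (κ a b))) z)
        (fun x => ⟪bV c, u x⟫) volume y =
        (if a = c then 1 else 0) * mconv (fun z => lowBump n z * dil N φ z)
          (fun x => ⟪bV c, u x⟫) volume y + mconv (QN N a c) (fun x => ⟪bV c, u x⟫) volume y :=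
      fun c => by
      rw [← mconv_const_mul, ← mconv_add (R := 2)
        (H := fun z => (if a = c then 1 else 0) * (lowBump n z * dil N φ z))
        (continuous_const.mul (hdil N)) (hQc N a c)
        (fun z hz => by rw [hdil0 N z hz, mul_zero]) (hQR N a c) (huc c)]
      simp_rw [← hid]
      rw [mconv_sum (R := 1) _ (fun l _ => continuous_finsetSum _ fun b _ => hc l b c)
        (fun l _ z hz => Finset.sum_eq_zero fun b _ => hc0 l b c z hz) (huc c)]
      refine Finset.sum_congr rfl fun l _ => ?_
      rw [mconv_sum (R := 1) _ (fun b _ => hc l b c) (fun b _ => hc0 l b c) (huc c)]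
    have h3 : ∀ l, ∑ b, ∑ c, mconv (fun z => ∑ I : Fin k → Fin n,
        ⟪bW b, A I (bV c)⟫ * dirDeriv n k I (nearKer k l (reS (κ a b))) z)
        (fun x => ⟪bV c, u x⟫) volume y = _ := fun l => Finset.sum_comm
    simp only [h3]
    rw [Finset.sum_comm]
    simp only [h2, Finset.sum_add_distrib]
    simp
  obtain ⟨S, -, hS⟩ := hψ.2.exists_norm_radius
  have hψ' := hψ.dirDeriv I
  obtain ⟨S', -, hS'⟩ := hψ'.2.exists_norm_radius
  have hQ2 : ∀ c, ∃ R : ℝ, 0 ≤ R ∧ ∀ z, R < ‖z‖ → Q a c z = 0 := fun c =>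
    (hQ a c).2.exists_norm_radius
  have hint : ∀ N, ∑ b, ∑ l ∈ Finset.range N, (-1 : ℝ) ^ m *
      ∫ y, ψ y * mconv (dirDeriv n m I (nearKer k l (reS (κ a b)))) (fun x => ⟪bW b, f x⟫) σ y =
      (∫ y, dirDeriv n m I ψ y *
        mconv (fun z => lowBump n z * dil N φ z) (fun x => ⟪bV a, u x⟫) volume y) +
      ∑ c, ∫ y, dirDeriv n m I ψ y * mconv (QN N a c) (fun x => ⟪bV c, u x⟫) volume y := fun N => by
    simp_rw [← integral_dirDeriv_mul_mconv hψ (hG _ _) (hfb _) I]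
    rw [Finset.sum_comm]
    have hi1 : ∀ l b, Integrable (fun y => dirDeriv n m I ψ y *
        mconv (nearKer k l (reS (κ a b))) (fun x => ⟪bW b, f x⟫) σ y) volume := fun l b =>
      integrable_mul_mconv hψ'.1.continuous hS' (hG l b).1.continuous (hG1 l b) (hfb b)
    have hi2 := integrable_mul_mconv hψ'.1.continuous hS' (hdil N) (hdil0 N) (huc a)
    have hi3 := fun c => integrable_mul_mconv hψ'.1.continuous hS' (hQc N a c) (hQR N a c) (huc c)
    rw [← integral_finsetSum _ fun c _ => hi3 c, ← integral_add hi2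
      (integrable_finsetSum _ fun c _ => hi3 c)]
    simp_rw [← integral_finsetSum _ fun b _ => hi1 _ b]
    rw [← integral_finsetSum _ fun l _ => integrable_finsetSum _ fun b _ => hi1 l b]
    congr 1 with y
    simp_rw [← Finset.mul_sum, ← mul_add, hpt]
  have hw := fun b => hasSum_integral_mul_mconv
    (fun l => ((hG l b).dirDeriv I).1.continuous)
    (fun l z hz => dirDeriv_zero_of_norm (hG1 l b) I hz) (hfb b)
    (tsum_lintegral_dirDeriv_nearKer_reS_ne_top (κ a b) hmj hj I) hψ.1.continuous hS
  have hlimL := tendsto_finsetSum Finset.univ fun b _ =>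
    ((hw b).2.tendsto_sum_nat.const_mul ((-1 : ℝ) ^ m))
  have hlimR := (tendsto_integral_mul_mconv_dil hφ (lowBump n).continuous
    (fun z hz => lowBump_zero (le_of_lt hz)) (lowBump_one (by simp)) hψ'.1.continuous hS'
    (huc a)).add (tendsto_finsetSum Finset.univ fun c _ => by
      obtain ⟨C, hC⟩ := hQb a c
      exact tendsto_integral_mul_mconv (fun N => hQc N a c) (fun N => hQR N a c) hC (huc c)
        hψ'.1.continuous hS' (hQl a c))
  simp_rw [Finset.mul_sum] at hlimL
  have hlim := tendsto_nhds_unique (hlimL.congr hint) hlimR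
  have hi4 : ∀ c, Integrable (fun y => ψ y * mconv (dirDeriv n m I (Q a c))
      (fun x => ⟪bV c, u x⟫) volume y) volume := fun c => by
    obtain ⟨R, -, hR⟩ := ((hQ a c).dirDeriv I).2.exists_norm_radius
    exact integrable_mul_mconv hψ.1.continuous hS ((hQ a c).dirDeriv I).1.continuous hR (huc c)
  simp only [weakComp, mul_sub, Finset.mul_sum]
  rw [integral_sub (integrable_finsetSum _ fun b _ => (hw b).1)
    (integrable_finsetSum _ fun c _ => hi4 c), integral_finsetSum _ fun b _ => (hw b).1,
    integral_finsetSum _ fun c _ => hi4 c, mul_sub, Finset.mul_sum, hlim, Finset.mul_sum]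
  simp_rw [integral_dirDeriv_mul_mconv hψ (hQ a _) (huc _) I]
  ring

end WeakDerivative

section WeakComponentTaylor

open scoped SchwartzMap LineDeriv

variable {n k : ℕ} {ι ι' : Type*} [Fintype ι] [Fintype ι']

theorem MemT.neg {F : Type*} [NormedAddCommGroup F] [NormedSpace ℝ F] {j : ℕ} {p : ℝ} (hp : 0 < p)
    {f : Euc n → F} {x : Euc n} (hf : MemT n j p f x) : MemT n j p (fun y => -f y) x := by
  simpa using hf.clm hp (-ContinuousLinearMap.id ℝ F)

theorem integral_mul_eq_sub_withDensity {α : Type*} [MeasurableSpace α] {σ : Measure α}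
    {h g : α → ℝ} (hg : Integrable g σ) (hh : AEStronglyMeasurable h σ) {C : ℝ}
    (hC : ∀ x, ‖h x‖ ≤ C) : ∫ x, h x * g x ∂σ =
      ∫ x, h x ∂σ.withDensity (fun x => ENNReal.ofReal (g x)) -
        ∫ x, h x ∂σ.withDensity (fun x => ENNReal.ofReal (-g x)) := by
  rw [integral_withDensity_eq_integral_toReal_smul₀ hg.1.aemeasurable.ennreal_ofReal (by simp),
    integral_withDensity_eq_integral_toReal_smul₀ (f := fun x => ENNReal.ofReal (-g x))
      hg.1.aemeasurable.neg.ennreal_ofReal (by simp)]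
  simp only [ENNReal.toReal_ofReal', smul_eq_mul]
  rw [← integral_sub (hg.pos_part.mul_bdd hh (Eventually.of_forall hC))
    (hg.neg_part.mul_bdd hh (Eventually.of_forall hC))]
  congr 1 with x
  rcases le_total 0 (g x) with h0 | h0
  · rw [max_eq_left h0, max_eq_right (by linarith)]; ring
  · rw [max_eq_right h0, max_eq_left (by linarith)]; ring

theorem ae_summable_dyKer {j : ℕ} (hj : 1 ≤ j) (Φ : 𝓢(Euc n, ℝ)) (σ : Measure (Euc n))
    [IsFiniteMeasure σ] : ∀ᵐ y ∂(volume : Measure (Euc n)),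
      Summable fun l => ∫ x, dyKer j l Φ (y - x) ∂σ := by
  have hc : ∀ l, Continuous (dyKer j l Φ) := fun l => (contDiff_dyKer (Φ.smooth ⊤) j l).continuous
  have hm : ∀ l, AEMeasurable (fun z : Euc n × Euc n => ‖dyKer j l Φ (z.1 - z.2)‖ₑ)
      (volume.prod σ) := fun l =>
    ((hc l).comp (continuous_fst.sub continuous_snd)).aestronglyMeasurable.enorm
  have h1 : ∀ l, ∫⁻ y, ∫⁻ x, ‖dyKer j l Φ (y - x)‖ₑ ∂σ = (∫⁻ z, ‖dyKer j l Φ z‖ₑ) * σ Set.univ :=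
    fun l => by
    rw [lintegral_lintegral_swap (hm l)]
    simp_rw [lintegral_sub_right_eq_self (fun z => ‖dyKer j l Φ z‖ₑ)]
    rw [lintegral_const]
  have h2 : ∫⁻ y, ∑' l, ∫⁻ x, ‖dyKer j l Φ (y - x)‖ₑ ∂σ ≠ ⊤ := by
    rw [lintegral_tsum fun l => (hm l).lintegral_prod_right']
    simp_rw [h1, ENNReal.tsum_mul_right]
    exact ENNReal.mul_ne_top (tsum_lintegral_dyKer_ne_top hj Φ) (measure_ne_top _ _)
  filter_upwards [ae_lt_top' (AEMeasurable.tsum fun l => (hm l).lintegral_prod_right') h2] with y hy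
  refine Summable.of_enorm (ne_top_of_le_ne_top hy.ne
    (ENNReal.tsum_le_tsum fun l => enorm_integral_le_lintegral_enorm _))

theorem aestronglyMeasurable_dyPot (j : ℕ) (Φ : 𝓢(Euc n, ℝ)) (σ : Measure (Euc n))
    [IsFiniteMeasure σ] : AEStronglyMeasurable (dyPot j Φ σ) volume := by
  refine AEStronglyMeasurable.tsum fun l => ?_
  have := aestronglyMeasurable_mconv (f := fun _ => 1) (contDiff_dyKer (Φ.smooth ⊤) j l).continuous
    (locallyIntegrable_const (μ := σ) (1 : ℝ))
  have h : mconv (dyKer j l Φ) (fun _ => 1) σ = fun y => ∫ x, dyKer j l Φ (y - x) ∂σ := by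
    ext y
    simp [mconv]
  rwa [h] at this

theorem hasSum_mconv_dirDeriv_farKer (Φ : 𝓢(Euc n, ℝ)) (k : ℕ) {m : ℕ} (I : Fin m → Fin n)
    {σ : Measure (Euc n)} {g : Euc n → ℝ} (hg : Integrable g σ) (y : Euc n) :
    HasSum (fun l => mconv (dirDeriv n m I (farKer k l Φ)) g σ y)
      (mconv (dirDeriv n m I (farSum k Φ)) g σ y) := by
  obtain ⟨C, hC0, hC⟩ := exists_dirDeriv_farKer_bound Φ k I
  have hc : ∀ l, Continuous fun x => dirDeriv n m I (farKer k l Φ) (y - x) := fun l =>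
    ((contDiff_farKer (Φ.smooth ⊤) k l).dirDeriv I).continuous.comp (continuous_sub_left y)
  have hi : ∀ l, Integrable (fun x => dirDeriv n m I (farKer k l Φ) (y - x) * g x) σ := fun l =>
    hg.bdd_mul (hc l).aestronglyMeasurable (Eventually.of_forall fun x => hC l (y - x))
  have h1 := hasSum_integral_of_summable_integral_norm hi
    (Summable.of_nonneg_of_le (fun l => integral_nonneg fun x => norm_nonneg _) (fun l => ?_)
      (summable_geometric_two.mul_left (C * ∫ x, ‖g x‖ ∂σ)))
  · have h2 : mconv (dirDeriv n m I (farSum k Φ)) g σ y =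
        ∫ x, ∑' l, dirDeriv n m I (farKer k l Φ) (y - x) * g x ∂σ := by
      simp only [mconv]
      congr 1 with x
      exact (((dirDeriv_farSum Φ k I (y - x)).mul_right (g x)).tsum_eq).symm
    rw [h2]
    exact h1
  · rw [mul_right_comm, ← integral_const_mul]
    refine integral_mono (hi l).norm (hg.norm.const_mul _) fun x => ?_
    rw [norm_mul]
    exact mul_le_mul_of_nonneg_right (hC l _) (norm_nonneg _)

theorem IsAnnular.ae_memT_tsum_mconv {κ : 𝓢(Euc n, ℂ)} (h : IsAnnular κ) {m j : ℕ} {p : ℝ}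
    (hmj : m + j = k) (hj : 1 ≤ j) (hjn : j < n) (hp : 1 ≤ p) (hpn : p * ((n : ℝ) - j) < n)
    (I : Fin m → Fin n) {σ : Measure (Euc n)} {g : Euc n → ℝ} (hg : LocallyIntegrable g σ) :
    ∀ᵐ x ∂(volume : Measure (Euc n)),
      MemT n j p (fun y => ∑' l, mconv (dirDeriv n m I (nearKer k l (reS κ))) g σ y) x := by
  have hp0 : 0 < p := by linarith
  suffices hR : ∀ R : ℕ, ∀ᵐ x ∂(volume : Measure (Euc n)), x ∈ ball (0 : Euc n) R →
      MemT n j p (fun y => ∑' l, mconv (dirDeriv n m I (nearKer k l (reS κ))) g σ y) x by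
    filter_upwards [ae_all_iff.2 hR] with x hx
    obtain ⟨R, hR⟩ := exists_nat_gt ‖x‖
    exact hx R (by simpa using hR)
  intro R
  set κ' := ∂^{fun i => stdVec n (I i)} κ with hκ'
  have hd : dirDeriv n m I (reS κ) = reS κ' := dirDeriv_reS κ I
  set gR : Euc n → ℝ := (closedBall (0 : Euc n) (R + 1)).indicator g with hgR
  have hgi : Integrable gR σ := (integrable_indicator_iff measurableSet_closedBall).2
    (hg.integrableOn_isCompact (isCompact_closedBall _ _))
  set σp := σ.withDensity (fun x => ENNReal.ofReal (gR x)) with hσp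
  set σm := σ.withDensity (fun x => ENNReal.ofReal (-gR x)) with hσm
  have : IsFiniteMeasure σp := isFiniteMeasure_withDensity_ofReal hgi.2
  have : IsFiniteMeasure σm := isFiniteMeasure_withDensity_ofReal hgi.neg.2
  set r : ℝ := (2 * R + 1)⁻¹ with hr
  have hr0 : 0 < r := by positivity
  set H : Euc n → ℝ := fun z => lowBump n (r • z) * dirDeriv n m I (farSum k (reS κ)) z with hH
  have hHt : IsTestFun n H := ⟨((lowBump n).contDiff.comp (g := (lowBump n : Euc n → ℝ))
    (contDiff_const_smul r)).mul ((contDiff_farSum _ k).dirDeriv I),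
    ((lowBump n).hasCompactSupport.comp_smul hr0.ne').mul_right⟩
  have hconv : ContDiff ℝ (⊤ : ℕ∞) (mconv H gR σ) := ContDiff.mconv hHt hgi.locallyIntegrable
  have hHy : ∀ y ∈ ball (0 : Euc n) R, mconv (dirDeriv n m I (farSum k (reS κ))) gR σ y =
      mconv H gR σ y := fun y hy => by
    simp only [mconv]
    congr 1 with x
    by_cases hx : x ∈ closedBall (0 : Euc n) (R + 1)
    · rw [hH]
      beta_reduce
      rw [lowBump_one, one_mul]
      rw [norm_smul, Real.norm_of_nonneg hr0.le, hr, inv_mul_le_iff₀ (by positivity), mul_one]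
      have h1 := norm_sub_le y x
      rw [mem_ball_zero_iff] at hy
      rw [mem_closedBall_zero_iff] at hx
      linarith
    · rw [hgR, Set.indicator_of_notMem hx, mul_zero, mul_zero]
  have hnear : ∀ y ∈ ball (0 : Euc n) R, ∀ l,
      mconv (dirDeriv n m I (nearKer k l (reS κ))) g σ y =
        (∫ x, dyKer j l (reS κ') (y - x) ∂σp) - (∫ x, dyKer j l (reS κ') (y - x) ∂σm) -
          mconv (dirDeriv n m I (farKer k l (reS κ))) gR σ y := fun y hy l => by
    obtain ⟨C, hC0, hC⟩ := exists_dirDeriv_farKer_bound (reS κ) k I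
    obtain ⟨D, hD0, hD⟩ := exists_dyKer_bound (reS κ') j
    have hdc : Continuous fun x => dyKer j l (reS κ') (y - x) :=
      (contDiff_dyKer ((reS κ').smooth ⊤) j l).continuous.comp (continuous_sub_left y)
    have hfc : Continuous fun x => dirDeriv n m I (farKer k l (reS κ)) (y - x) :=
      ((contDiff_farKer ((reS κ).smooth ⊤) k l).dirDeriv I).continuous.comp (continuous_sub_left y)
    have hdb : ∃ D, ∀ z, ‖dyKer j l (reS κ') z‖ ≤ D :=
      ⟨_, fun z => ((norm_iteratedFDeriv_zero (𝕜 := ℝ)).symm.le.trans (hD 0 (by omega) l z)).trans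
        (mul_le_mul_of_nonneg_left (decayWt_le_two_pow l z) (by positivity))⟩
    obtain ⟨D, hD⟩ := hdb
    rw [hσp, hσm, ← integral_mul_eq_sub_withDensity (h := fun x => dyKer j l (reS κ') (y - x)) hgi
      hdc.aestronglyMeasurable (fun x => hD _), mconv, mconv,
      ← integral_sub (hgi.bdd_mul hdc.aestronglyMeasurable (Eventually.of_forall fun x => hD _))
      (hgi.bdd_mul hfc.aestronglyMeasurable (Eventually.of_forall fun x => hC l _))]
    congr 1 with x
    beta_reduce
    rw [← sub_mul, ← hd, ← dirDeriv_nearKer ((reS κ).smooth ⊤) hmj]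
    by_cases hx : x ∈ closedBall (0 : Euc n) (R + 1)
    · rw [hgR, Set.indicator_of_mem hx]
    · rw [hgR, Set.indicator_of_notMem hx, mul_zero, dirDeriv_zero_of_norm (R := 1)
        (H := nearKer k l (reS κ)) (fun z hz => nearKer_zero hz) I, zero_mul]
      rw [mem_ball_zero_iff] at hy
      rw [mem_closedBall_zero_iff] at hx
      have h1 := norm_sub_norm_le x y
      rw [norm_sub_rev] at h1
      linarith
  have hae : ∀ᵐ y ∂(volume : Measure (Euc n)), y ∈ ball (0 : Euc n) R →
      dyPot j (reS κ') σp y + (-dyPot j (reS κ') σm y + -mconv H gR σ y) =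
      ∑' l, mconv (dirDeriv n m I (nearKer k l (reS κ))) g σ y := by
    filter_upwards [ae_summable_dyKer hj (reS κ') σp, ae_summable_dyKer hj
      (reS κ') σm] with y h1 h2 hy
    have h3 := (h1.hasSum.sub h2.hasSum).sub (hasSum_mconv_dirDeriv_farKer (reS κ) k I hgi y)
    simp_rw [hnear y hy]
    rw [h3.tsum_eq, hHy y hy, dyPot, dyPot]
    ring
  have hκ'a : IsAnnular κ' := h.iteratedLineDerivOp _
  filter_upwards [hκ'a.ae_memT_dyPot hj hjn hp hpn σp, hκ'a.ae_memT_dyPot hj hjn hp hpn σm]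
    with x hx1 hx2 hx
  have hm1 := aestronglyMeasurable_dyPot j (reS κ') σp
  have hm2 := aestronglyMeasurable_dyPot j (reS κ') σm
  have hm3 := hconv.continuous.aestronglyMeasurable (μ := volume)
  obtain ⟨ε, hε, hsub⟩ := Metric.isOpen_ball.mem_nhds hx |> Metric.mem_nhds_iff.1
  refine (hx1.add hp ((hx2.neg hp0).add hp ((hconv.memT hp0 x).neg hp0) hm2.neg hm3.neg) hm1
    (hm2.neg.add hm3.neg)).congr hε ?_
  filter_upwards [ae_restrict_of_ae hae, ae_restrict_mem measurableSet_ball] with y hy hyb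
  exact hy (hsub hyb)

theorem ae_memT_weakComp {m j : ℕ} {p : ℝ} (hmj : m + j = k) (hj : 1 ≤ j) (hjn : j < n)
    (hp : 1 ≤ p) (hpn : p * ((n : ℝ) - j) < n) (I : Fin m → Fin n) {κ : ι' → 𝓢(Euc n, ℂ)}
    (hκ : ∀ b, IsAnnular (κ b)) {Q : ι → Euc n → ℝ} (hQ : ∀ c, IsTestFun n (Q c))
    {u : ι → Euc n → ℝ} (hu : ∀ c, LocallyIntegrable (u c) volume) {σ : Measure (Euc n)}
    [SFinite σ] {f : ι' → Euc n → ℝ} (hf : ∀ b, LocallyIntegrable (f b) σ) :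
    ∀ᵐ x ∂(volume : Measure (Euc n)), MemT n j p (weakComp k I κ Q u f σ) x := by
  have hs : ContDiff ℝ (⊤ : ℕ∞) fun y => ∑ c, mconv (dirDeriv n m I (Q c)) (u c) volume y :=
    ContDiff.sum fun c _ => ContDiff.mconv ((hQ c).dirDeriv I) (hu c)
  have hm : ∀ b, AEStronglyMeasurable
      (fun y => ∑' l, mconv (dirDeriv n m I (nearKer k l (reS (κ b)))) (f b) σ y) volume := fun b =>
    AEStronglyMeasurable.tsum fun l => aestronglyMeasurable_mconv
      ((isTestFun_nearKer (SchwartzMap.smooth _ ⊤) k l).dirDeriv I).1.continuous (hf b)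
  filter_upwards [ae_all_iff.2 fun b => (hκ b).ae_memT_tsum_mconv hmj hj hjn hp hpn I (hf b)]
    with x hx
  have h1 := (MemT.sum Finset.univ hp (fun b _ => hx b) fun b _ => hm b).add hp
    ((hs.memT (by linarith) x).neg (by linarith))
    (Finset.aestronglyMeasurable_fun_sum _ fun b _ => hm b)
    hs.continuous.neg.aestronglyMeasurable
  convert h1 using 1
  ext y
  rw [weakComp, sub_eq_add_neg]

end WeakComponentTaylor

section Sufficiency

variable {n k : ℕ} {V W : Type*}
  [NormedAddCommGroup V] [InnerProductSpace ℝ V] [FiniteDimensional ℝ V]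
  [NormedAddCommGroup W] [InnerProductSpace ℝ W] [FiniteDimensional ℝ W]

theorem IsTestFun.integrable_mul {ψ : Euc n → ℝ} (hψ : IsTestFun n ψ) {g : Euc n → ℝ}
    (hg : LocallyIntegrable g volume) : Integrable (fun x => ψ x * g x) volume := by
  simpa using hg.integrable_smul_left_of_hasCompactSupport hψ.1.continuous hψ.2

theorem LocallyIntegrable.smul_vec {F : Type*} [NormedAddCommGroup F] [NormedSpace ℝ F]
    {μ : Measure (Euc n)} {g : Euc n → ℝ} (hg : LocallyIntegrable g μ) (w : F) :
    LocallyIntegrable (fun x => g x • w) μ := fun x => by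
  obtain ⟨s, hs, h⟩ := hg x
  exact ⟨s, hs, h.smul_const w⟩

theorem MemBVAloc.exists_weakDeriv {A : CoeffOp n k V W} (hA : IsElliptic n k A) {j : ℕ} {p : ℝ}
    (hj : 1 ≤ j) (hjk : j ≤ k) (hjn : j < n) (hp : 1 ≤ p) (hpn : p * ((n : ℝ) - j) < n)
    {u : Euc n → V} (hu : MemBVAloc n k A u) :
    ∃ v : (Fin (k - j) → Fin n) → Euc n → V, IsWeakDerivFamily n (k - j) u v ∧
      ∀ᵐ x ∂(volume : Measure (Euc n)), ∀ I, MemT n j p (v I) x := by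
  obtain ⟨hul, σ, f, hσ, hf, -, h⟩ := hu
  have hmj : k - j + j = k := Nat.sub_add_cancel hjk
  set bV := stdOrthonormalBasis ℝ V
  set bW := stdOrthonormalBasis ℝ W
  obtain ⟨κ, Q, hκ, hQ, hw⟩ := hA.exists_weakComp bV bW
  have huc := fun c => hul.inner_const (bV c)
  have hfb := fun b => hf.inner_const (bW b)
  set g : (Fin (k - j) → Fin n) → Fin (Module.finrank ℝ V) → Euc n → ℝ := fun I a =>
    weakComp k I (κ a) (Q a) (fun c x => ⟪bV c, u x⟫) (fun b x => ⟪bW b, f x⟫) σ with hg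
  have hgl : ∀ I a, LocallyIntegrable (g I a) volume := fun I a =>
    locallyIntegrable_weakComp hmj hj I (κ a) (hQ a) huc hfb
  refine ⟨fun I x => ∑ a, g I a x • bV a, ⟨fun I => locallyIntegrable_finsetSum _ fun a _ =>
    LocallyIntegrable.smul_vec (hgl I a) _, fun I ψ hψ => ?_⟩, ?_⟩
  · have h1 : ∀ x, dirDeriv n (k - j) I ψ x • u x =
        ∑ a, (dirDeriv n (k - j) I ψ x * ⟪bV a, u x⟫) • bV a := fun x => by
      conv_lhs => rw [← bV.sum_repr' (u x), Finset.smul_sum]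
      simp only [mul_smul]
    simp_rw [h1, Finset.smul_sum, ← mul_smul]
    rw [integral_finsetSum _ fun a _ => ((hψ.dirDeriv I).integrable_mul (huc a)).smul_const _,
      integral_finsetSum _ fun a _ => (hψ.integrable_mul (hgl I a)).smul_const _, Finset.smul_sum]
    refine Finset.sum_congr rfl fun a _ => ?_
    rw [integral_smul_const, integral_smul_const, hw hul hf h hmj hj I hψ a, mul_smul]
  · filter_upwards [ae_all_iff.2 fun I => ae_all_iff.2 fun a =>
      ae_memT_weakComp hmj hj hjn hp hpn I (hκ a) (hQ a) huc hfb] with x hx I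
    refine MemT.sum Finset.univ hp (fun a _ => ?_) fun a _ =>
      (LocallyIntegrable.smul_vec (hgl I a) _).aestronglyMeasurable
    exact (hx I a).clm (by linarith) ((ContinuousLinearMap.id ℝ ℝ).smulRight (bV a))

end Sufficiency

section FunctionSeries

variable {n : ℕ} {G : ℕ → Euc n → ℝ}

theorem ae_summable_of_tsum_lintegral_ball (hG : ∀ i, Continuous (G i))
    (hs : ∀ R : ℝ, ∑' i, ∫⁻ x in ball 0 R, ‖G i x‖ₑ ≠ ⊤) :
    ∀ᵐ x ∂(volume : Measure (Euc n)), Summable fun i => G i x := by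
  suffices h : ∀ R : ℕ, ∀ᵐ x ∂(volume : Measure (Euc n)), x ∈ ball (0 : Euc n) R →
      Summable fun i => G i x by
    filter_upwards [ae_all_iff.2 h] with x hx
    obtain ⟨R, hR⟩ := exists_nat_gt ‖x‖
    exact hx R (by simpa using hR)
  intro R
  rw [← ae_restrict_iff' measurableSet_ball]
  have hm : ∀ i, Measurable fun x => ‖G i x‖ₑ := fun i => (hG i).measurable.enorm
  have h1 := hs R
  rw [← lintegral_tsum fun i => (hm i).aemeasurable] at h1
  filter_upwards [ae_lt_top (Measurable.tsum hm) h1] with x hx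
  exact Summable.of_enorm hx.ne

theorem locallyIntegrable_tsum_of_tsum_lintegral_ball (hG : ∀ i, Continuous (G i))
    (hs : ∀ R : ℝ, ∑' i, ∫⁻ x in ball 0 R, ‖G i x‖ₑ ≠ ⊤) :
    LocallyIntegrable (fun x => ∑' i, G i x) volume := fun x => by
  refine ⟨ball 0 (‖x‖ + 1), Metric.isOpen_ball.mem_nhds (by simp),
    AEStronglyMeasurable.tsum fun i => (hG i).aestronglyMeasurable, ?_⟩
  refine lt_of_le_of_lt (lintegral_mono fun y => enorm_tsum_le_tsum_enorm) ?_
  rw [lintegral_tsum fun i => (hG i).measurable.enorm.aemeasurable]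
  exact (hs _).lt_top

theorem integral_tsum_mul_of_tsum_lintegral_ball (hG : ∀ i, Continuous (G i))
    (hs : ∀ R : ℝ, ∑' i, ∫⁻ x in ball 0 R, ‖G i x‖ₑ ≠ ⊤) {h : Euc n → ℝ} (hc : Continuous h)
    (hh : HasCompactSupport h) :
    ∫ x, (∑' i, G i x) * h x = ∑' i, ∫ x, G i x * h x := by
  obtain ⟨R, -, hR⟩ := hh.exists_norm_radius
  obtain ⟨C, -, hC⟩ := exists_norm_le_of_support hc hR
  simp_rw [← tsum_mul_right]
  refine integral_tsum (fun i => ((hG i).mul hc).aestronglyMeasurable) ?_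
  have hle : ∀ i, ∫⁻ x, ‖G i x * h x‖ₑ ≤ (∫⁻ x in ball 0 (R + 1), ‖G i x‖ₑ) * ENNReal.ofReal C :=
    fun i => by
    rw [← lintegral_mul_const _ (hG i).measurable.enorm, ← lintegral_indicator measurableSet_ball]
    refine lintegral_mono fun x => ?_
    by_cases hx : x ∈ ball (0 : Euc n) (R + 1)
    · rw [Set.indicator_of_mem hx, enorm_mul]
      gcongr
      rw [← ofReal_norm]
      exact ENNReal.ofReal_le_ofReal (hC x)
    · rw [Set.indicator_of_notMem hx, hR x, mul_zero, enorm_zero]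
      rw [mem_ball_zero_iff] at hx
      linarith
  refine ne_top_of_le_ne_top ?_ (ENNReal.tsum_le_tsum hle)
  rw [ENNReal.tsum_mul_right]
  exact ENNReal.mul_ne_top (hs _) ENNReal.ofReal_ne_top

end FunctionSeries

section PlaneWave

variable {n k : ℕ} {V W : Type*}
  [NormedAddCommGroup V] [InnerProductSpace ℝ V] [FiniteDimensional ℝ V]
  [NormedAddCommGroup W] [InnerProductSpace ℝ W] [FiniteDimensional ℝ W]

theorem dirDeriv_comp_inner {g : ℝ → ℝ} (hg : ContDiff ℝ (⊤ : ℕ∞) g) (ξ : Euc n) {m : ℕ}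
    (I : Fin m → Fin n) (x : Euc n) :
    dirDeriv n m I (fun x => g ⟪ξ, x⟫) x = (∏ i, ξ (I i)) * iteratedDeriv m g ⟪ξ, x⟫ := by
  have h := (innerSL ℝ ξ).iteratedFDeriv_comp_right hg x (i := m) (by exact_mod_cast le_top)
  have e : (fun x => g ⟪ξ, x⟫) = g ∘ innerSL ℝ ξ := rfl
  rw [dirDeriv, e, h, ContinuousMultilinearMap.compContinuousLinearMap_apply,
    iteratedFDeriv_apply_eq_iteratedDeriv_mul_prod, smul_eq_mul]
  simp [stdVec, EuclideanSpace.inner_single_right]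

theorem contDiff_comp_inner {g : ℝ → ℝ} (hg : ContDiff ℝ (⊤ : ℕ∞) g) (ξ : Euc n) :
    ContDiff ℝ (⊤ : ℕ∞) fun x : Euc n => g ⟪ξ, x⟫ := hg.comp (innerSL ℝ ξ).contDiff

theorem integral_planeWave_mul {A : CoeffOp n k V W} {ξ : Euc n} {v : V}
    (hv : symbolMap n k A ξ v = 0) {g : ℝ → ℝ} (hg : ContDiff ℝ (⊤ : ℕ∞) g) {φ : Euc n → W}
    (hφ : IsTestFun n φ) :
    ∫ x, g ⟪ξ, x⟫ * ∑ I : Fin k → Fin n, ⟪A I v, dirDeriv n k I φ x⟫ = 0 := by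
  have hgc := contDiff_comp_inner hg ξ
  have hψ : ∀ I, IsTestFun n fun x => ⟪A I v, φ x⟫ := fun I =>
    ⟨(innerSL ℝ (A I v)).contDiff.comp hφ.1, hφ.2.comp_left (g := fun w => ⟪A I v, w⟫) (by simp)⟩
  have h1 : ∀ (I : Fin k → Fin n) x, ⟪A I v, dirDeriv n k I φ x⟫ =
      dirDeriv n k I (fun x => ⟪A I v, φ x⟫) x := fun I x =>
    (dirDeriv_clm_comp hφ.1 (innerSL ℝ (A I v)) I x).symm
  simp_rw [h1, Finset.mul_sum, mul_comm (g _)]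
  rw [integral_finsetSum _ fun I _ =>
    ((hψ I).dirDeriv I).integrable_mul hgc.continuous.locallyIntegrable]
  simp_rw [integral_dirDeriv_mul hgc (hψ _), dirDeriv_comp_inner hg]
  have hc : ∀ I : Fin k → Fin n,
      Continuous fun x => (∏ i, ξ (I i)) * iteratedDeriv k g ⟪ξ, x⟫ := fun I =>
    continuous_const.mul ((hg.continuous_iteratedDeriv k (by exact_mod_cast le_top)).comp
      (innerSL ℝ ξ).continuous)
  rw [← Finset.mul_sum, ← integral_finsetSum _ fun I _ =>
    (hψ I).integrable_mul (hc I).locallyIntegrable]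
  have h2 : ∀ x, ∑ I : Fin k → Fin n, ⟪A I v, φ x⟫ *
      ((∏ i, ξ (I i)) * iteratedDeriv k g ⟪ξ, x⟫) = 0 := fun x => by
    have h3 : ⟪symbolMap n k A ξ v, φ x⟫ = 0 := by rw [hv, inner_zero_left]
    rw [symbolMap, LinearMap.sum_apply, sum_inner] at h3
    simp_rw [LinearMap.smul_apply, real_inner_smul_left] at h3
    rw [← mul_zero (iteratedDeriv k g ⟪ξ, x⟫), ← h3, Finset.mul_sum]
    exact Finset.sum_congr rfl fun I _ => by ring
  simp [h2]

theorem memBVAloc_planeWave_tsum {A : CoeffOp n k V W} {ξ : Euc n} {v : V}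
    (hv : symbolMap n k A ξ v = 0) {g : ℕ → ℝ → ℝ} (hg : ∀ i, ContDiff ℝ (⊤ : ℕ∞) (g i))
    (hs : ∀ R : ℝ, ∑' i, ∫⁻ x in ball (0 : Euc n) R, ‖g i ⟪ξ, x⟫‖ₑ ≠ ⊤) :
    MemBVAloc n k A fun x => (∑' i, g i ⟪ξ, x⟫) • v := by
  have hG : ∀ i, Continuous fun x : Euc n => g i ⟪ξ, x⟫ := fun i =>
    (contDiff_comp_inner (hg i) ξ).continuous
  have hU := locallyIntegrable_tsum_of_tsum_lintegral_ball hG hs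
  refine ⟨LocallyIntegrable.smul_vec hU v, 0, 0, inferInstance, ?_, by simp, fun φ hφ => ?_⟩
  · exact fun x => ⟨Set.univ, univ_mem, by simp⟩
  have h1 : ∀ I : Fin k → Fin n, IsTestFun n fun x => ⟪A I v, dirDeriv n k I φ x⟫ := fun I =>
    ⟨(innerSL ℝ (A I v)).contDiff.comp (hφ.dirDeriv I).1,
      (hφ.dirDeriv I).2.comp_left (g := fun w => ⟪A I v, w⟫) (by simp)⟩
  have h2 : ∀ (I : Fin k → Fin n) x, ⟪(∑' i, g i ⟪ξ, x⟫) • v,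
      LinearMap.adjoint (A I) (dirDeriv n k I φ x)⟫ =
      (∑' i, g i ⟪ξ, x⟫) * ⟪A I v, dirDeriv n k I φ x⟫ := fun I x => by
    rw [real_inner_smul_left, LinearMap.adjoint_inner_right]
  simp_rw [h2]
  have h3 : HasCompactSupport fun x => ∑ I : Fin k → Fin n, ⟪A I v, dirDeriv n k I φ x⟫ := by
    obtain ⟨R, -, hR⟩ : ∃ R : ℝ, 0 ≤ R ∧ ∀ z, R < ‖z‖ → ‖φ z‖ = 0 :=
      hφ.2.norm.exists_norm_radius
    refine hasCompactSupport_of_norm (R := R) fun z hz => Finset.sum_eq_zero fun I _ => ?_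
    rw [show ⟪A I v, dirDeriv n k I φ z⟫ = dirDeriv n k I (fun x => ⟪A I v, φ x⟫) z from
      (dirDeriv_clm_comp hφ.1 (innerSL ℝ (A I v)) I z).symm]
    exact dirDeriv_zero_of_norm (R := R)
      (fun z hz => by rw [norm_eq_zero.1 (hR z hz), inner_zero_right]) I hz
  rw [← integral_finsetSum _ fun I _ => by simpa only [mul_comm] using (h1 I).integrable_mul hU]
  simp_rw [← Finset.mul_sum]
  rw [integral_tsum_mul_of_tsum_lintegral_ball hG hs
    (continuous_finsetSum _ fun I _ => (h1 I).1.continuous) h3]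
  simp [integral_planeWave_mul hv (hg _) hφ]

end PlaneWave

section RidgeIntegral

variable {n : ℕ}

theorem exists_inner_eq_one {ξ : Euc n} (hξ : ξ ≠ 0) : ∃ e : Euc n, ⟪ξ, e⟫ = 1 :=
  ⟨(‖ξ‖ ^ 2)⁻¹ • ξ, by
    rw [real_inner_smul_right, real_inner_self_eq_norm_sq]
    exact inv_mul_cancel₀ (by simpa using hξ)⟩

theorem setLIntegral_ridge_add_le {ξ e : Euc n} (he : ⟪ξ, e⟫ = 1) {H : ℝ → ℝ≥0∞}
    {δ τ : ℝ} (hτ : |τ| ≤ δ) (x : Euc n) (ρ : ℝ) :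
    ∫⁻ y in ball x ρ, H (⟪ξ, y⟫ + τ) ≤ ∫⁻ y in ball x (ρ + δ * ‖e‖), H ⟪ξ, y⟫ := by
  rw [← lintegral_indicator measurableSet_ball, ← lintegral_indicator measurableSet_ball,
    ← lintegral_add_right_eq_self
      ((ball x (ρ + δ * ‖e‖)).indicator fun y => H ⟪ξ, y⟫) (τ • e)]
  refine lintegral_mono fun y => ?_
  by_cases hy : y ∈ ball x ρ
  · rw [Set.indicator_of_mem hy, Set.indicator_of_mem, inner_add_right, real_inner_smul_right, he,
      mul_one]
    rw [mem_ball_iff_norm] at hy ⊢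
    rw [add_sub_right_comm]
    refine (norm_add_le _ _).trans_lt ?_
    rw [norm_smul, Real.norm_eq_abs]
    have := mul_le_mul_of_nonneg_right hτ (norm_nonneg e)
    linarith
  · rw [Set.indicator_of_notMem hy]
    exact zero_le

theorem setLIntegral_ridge_le {ξ e : Euc n} (he : ⟪ξ, e⟫ = 1) {H : ℝ → ℝ≥0∞} (hH : Measurable H)
    (x : Euc n) (ρ : ℝ) :
    ∫⁻ y in ball x ρ, H ⟪ξ, y⟫ ≤ volume (ball x (ρ + ‖e‖)) * ∫⁻ t, H t := by
  have hm : Measurable fun z : ℝ × Euc n => H (⟪ξ, z.2⟫ + z.1) :=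
    hH.comp ((measurable_const.inner measurable_snd).add measurable_fst)
  calc ∫⁻ y in ball x ρ, H ⟪ξ, y⟫
      = ∫⁻ _ in Set.Icc (0 : ℝ) 1, ∫⁻ y in ball x ρ, H ⟪ξ, y⟫ := by simp
    _ ≤ ∫⁻ τ in Set.Icc (0 : ℝ) 1, ∫⁻ y in ball x (ρ + ‖e‖), H (⟪ξ, y⟫ + τ) := by
        refine setLIntegral_mono' measurableSet_Icc fun τ hτ => ?_
        have h := setLIntegral_ridge_add_le he (H := fun t => H (t + τ)) (δ := 1) (τ := -τ)
          (by rw [abs_neg, abs_of_nonneg hτ.1]; exact hτ.2) x ρ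
        simpa using h
    _ ≤ ∫⁻ τ, ∫⁻ y in ball x (ρ + ‖e‖), H (⟪ξ, y⟫ + τ) := setLIntegral_le_lintegral _ _
    _ = ∫⁻ y in ball x (ρ + ‖e‖), ∫⁻ τ, H (⟪ξ, y⟫ + τ) := lintegral_lintegral_swap hm.aemeasurable
    _ = volume (ball x (ρ + ‖e‖)) * ∫⁻ t, H t := by
        simp_rw [lintegral_add_left_eq_self H]
        rw [lintegral_const, Measure.restrict_apply_univ, mul_comm]

/-- A lower bound for the integral of a plane wave over a ball. -/
theorem exists_le_setLIntegral_ridge {ξ : Euc n} (hξ : ξ ≠ 0) (x : Euc n) {r : ℝ} (hr : 0 < r) :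
    ∃ (c : ℝ≥0∞) (δ : ℝ), c ≠ 0 ∧ 0 < δ ∧ ∀ H : ℝ → ℝ≥0∞, Measurable H →
      c * ∫⁻ t in Set.Ioo (⟪ξ, x⟫ - δ) (⟪ξ, x⟫ + δ), H t ≤ ∫⁻ y in ball x r, H ⟪ξ, y⟫ := by
  obtain ⟨e, he⟩ := exists_inner_eq_one hξ
  have he0 : 0 < ‖e‖ := norm_pos_iff.2 (by rintro rfl; simp at he)
  have hξ0 : 0 < ‖ξ‖ := norm_pos_iff.2 hξ
  set δ := r / (4 * ‖e‖) with hδ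
  have hδ0 : 0 < δ := by positivity
  set ρ := min (r / 2) (δ / ‖ξ‖) with hρ
  have hρ0 : 0 < ρ := by positivity
  have hv : volume (Set.Icc (-(2 * δ)) (2 * δ)) ≠ 0 := by
    rw [Real.volume_Icc]; simp; linarith
  have hv' : volume (Set.Icc (-(2 * δ)) (2 * δ)) ≠ ⊤ := by simp
  refine ⟨(volume (Set.Icc (-(2 * δ)) (2 * δ)))⁻¹ * volume (ball x ρ), δ,
    mul_ne_zero (ENNReal.inv_ne_zero.2 hv') (measure_ball_pos _ _ hρ0).ne', hδ0, fun H hH => ?_⟩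
  have hm : Measurable fun z : ℝ × Euc n => H (⟪ξ, z.2⟫ + z.1) :=
    hH.comp ((measurable_const.inner measurable_snd).add measurable_fst)
  rw [mul_assoc, ENNReal.inv_mul_le_iff hv hv']
  calc volume (ball x ρ) * ∫⁻ t in Set.Ioo (⟪ξ, x⟫ - δ) (⟪ξ, x⟫ + δ), H t
      = ∫⁻ _ in ball x ρ, ∫⁻ t in Set.Ioo (⟪ξ, x⟫ - δ) (⟪ξ, x⟫ + δ), H t := by
        rw [lintegral_const, Measure.restrict_apply_univ, mul_comm]
    _ ≤ ∫⁻ y in ball x ρ, ∫⁻ τ in Set.Icc (-(2 * δ)) (2 * δ), H (⟪ξ, y⟫ + τ) := by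
        refine setLIntegral_mono' measurableSet_ball fun y hy => ?_
        rw [← lintegral_indicator measurableSet_Ioo, ← lintegral_indicator measurableSet_Icc,
          ← lintegral_add_left_eq_self _ ⟪ξ, y⟫]
        refine lintegral_mono fun τ => ?_
        by_cases hτ : ⟪ξ, y⟫ + τ ∈ Set.Ioo (⟪ξ, x⟫ - δ) (⟪ξ, x⟫ + δ)
        · rw [Set.indicator_of_mem hτ, Set.indicator_of_mem]
          have h1 : |⟪ξ, y - x⟫| ≤ δ := by
            refine (abs_real_inner_le_norm _ _).trans ?_
            rw [mem_ball_iff_norm] at hy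
            have h2 : ‖y - x‖ ≤ δ / ‖ξ‖ := hy.le.trans (min_le_right _ _)
            rw [le_div_iff₀ hξ0] at h2
            linarith
          rw [inner_sub_right, abs_le] at h1
          exact ⟨by linarith [hτ.1], by linarith [hτ.2]⟩
        · rw [Set.indicator_of_notMem hτ]
          exact zero_le
    _ = ∫⁻ τ in Set.Icc (-(2 * δ)) (2 * δ), ∫⁻ y in ball x ρ, H (⟪ξ, y⟫ + τ) :=
        (lintegral_lintegral_swap hm.aemeasurable).symm
    _ ≤ ∫⁻ _ in Set.Icc (-(2 * δ)) (2 * δ), ∫⁻ y in ball x r, H ⟪ξ, y⟫ := by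
        refine setLIntegral_mono' measurableSet_Icc fun τ hτ => ?_
        refine (setLIntegral_ridge_add_le he (abs_le.2 hτ) x ρ).trans
          (lintegral_mono_set (ball_subset_ball ?_))
        have h1 : 2 * δ * ‖e‖ = r / 2 := by rw [hδ]; field_simp; norm_num
        linarith [min_le_left (r / 2) (δ / ‖ξ‖)]
    _ = volume (Set.Icc (-(2 * δ)) (2 * δ)) * ∫⁻ y in ball x r, H ⟪ξ, y⟫ := by
        rw [lintegral_const, Measure.restrict_apply_univ, mul_comm]

end RidgeIntegral

section NowhereIntegrable

theorem exists_concentrating_bumps {p : ℝ} (hp : 1 < p) : ∃ g : ℕ → ℝ → ℝ,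
    (∀ i, ContDiff ℝ (⊤ : ℕ∞) (g i)) ∧ (∀ i t, 0 ≤ g i t) ∧ (∑' i, ∫⁻ t, ‖g i t‖ₑ ≠ ⊤) ∧
      ∀ (t δ : ℝ), 0 < δ → ∀ K : ℕ, ∃ i,
        (K : ℝ≥0∞) ≤ ∫⁻ s in Set.Ioo (t - δ) (t + δ), ‖g i s‖ₑ ^ p := by
  obtain ⟨N, hN⟩ := exists_nat_gt (2 / (p - 1))
  rw [div_lt_iff₀ (by linarith)] at hN
  set q := TopologicalSpace.denseSeq ℝ with hq
  let β : ContDiffBump (0 : ℝ) := ⟨1, 2, one_pos, one_lt_two⟩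
  set g : ℕ → ℝ → ℝ := fun i t => 2 ^ (N * i) * β (2 ^ ((N + 1) * i) * (t - q i)) with hg
  have hg0 : ∀ i t, 0 ≤ g i t := fun i t => mul_nonneg (by positivity) β.nonneg
  refine ⟨g, fun i => ?_, hg0, ?_, fun t δ hδ K => ?_⟩
  · exact contDiff_const.mul
      (β.contDiff.comp (contDiff_const.mul (contDiff_id.sub contDiff_const)))
  · have hle : ∀ i, ∫⁻ t, ‖g i t‖ₑ ≤ ENNReal.ofReal (4 * (1 / 2) ^ i) := fun i => by
      have h1 : ∀ t, ‖g i t‖ₑ ≤ (closedBall (q i) (2 * (2 ^ ((N + 1) * i))⁻¹)).indicator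
          (fun _ => ENNReal.ofReal (2 ^ (N * i))) t := fun t => by
        by_cases ht : t ∈ closedBall (q i) (2 * (2 ^ ((N + 1) * i))⁻¹)
        · rw [Set.indicator_of_mem ht, Real.enorm_of_nonneg (hg0 i t)]
          exact ENNReal.ofReal_le_ofReal (mul_le_of_le_one_right (by positivity) β.le_one)
        · rw [Set.indicator_of_notMem ht, hg]
          beta_reduce
          rw [β.zero_of_le_dist, mul_zero, enorm_zero]
          rw [mem_closedBall, not_le, Real.dist_eq, ← div_eq_mul_inv,
            div_lt_iff₀ (by positivity)] at ht
          rw [Real.dist_eq, sub_zero, abs_mul, abs_of_pos (by positivity)]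
          exact (mul_comm _ |t - q i|).symm ▸ ht.le
      refine (lintegral_mono h1).trans ?_
      rw [lintegral_indicator measurableSet_closedBall, lintegral_const,
        Measure.restrict_apply_univ, Real.volume_closedBall, ← ENNReal.ofReal_mul (by positivity)]
      refine ENNReal.ofReal_le_ofReal (le_of_eq ?_)
      rw [add_mul, one_mul, pow_add, one_div, inv_pow]
      field_simp
      norm_num
    refine ne_top_of_le_ne_top ?_ (ENNReal.tsum_le_tsum hle)
    rw [← ENNReal.ofReal_tsum_of_nonneg (fun i => by positivity)
      (summable_geometric_two.mul_left 4)]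
    exact ENNReal.ofReal_ne_top
  · obtain ⟨J, hJ⟩ := exists_pow_lt_of_lt_one (half_pos hδ) (by norm_num : (1 / 2 : ℝ) < 1)
    have hd : Dense (Set.range q \ (q '' {i | i < K + J})) :=
      (TopologicalSpace.denseRange_denseSeq ℝ).sdiff_finite ((Set.finite_lt_nat _).image q)
    obtain ⟨_, ⟨⟨i, rfl⟩, hi⟩, hy⟩ := hd.exists_mem_open (isOpen_Ioo (a := t - δ / 2)
      (b := t + δ / 2))
      (Set.nonempty_Ioo.2 (by linarith))
    have hi : K + J ≤ i := by
      by_contra! h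
      exact hi ⟨i, h, rfl⟩
    set ε : ℝ := (2 ^ ((N + 1) * i))⁻¹ with hε
    have hε0 : 0 < ε := by positivity
    have hεδ : ε < δ / 2 := by
      refine lt_of_le_of_lt ?_ hJ
      rw [one_div, inv_pow]
      exact inv_anti₀ (by positivity) (pow_le_pow_right₀ one_le_two (by nlinarith))
    have hsub : closedBall (q i) ε ⊆ Set.Ioo (t - δ) (t + δ) := fun s hs => by
      rw [mem_closedBall, Real.dist_eq, abs_le] at hs
      exact ⟨by linarith [hy.1], by linarith [hy.2]⟩
    have hgs : ∀ s ∈ closedBall (q i) ε, ‖g i s‖ₑ ^ p = ENNReal.ofReal ((2 ^ (N * i)) ^ p) :=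
      fun s hs => by
      rw [hg]
      beta_reduce
      rw [β.one_of_mem_closedBall, mul_one, Real.enorm_of_nonneg (by positivity),
        ENNReal.ofReal_rpow_of_pos (by positivity)]
      rw [mem_closedBall, Real.dist_eq] at hs
      rw [mem_closedBall, Real.dist_eq, sub_zero, abs_mul, abs_of_pos (by positivity)]
      calc (2 : ℝ) ^ ((N + 1) * i) * |s - q i| ≤ 2 ^ ((N + 1) * i) * ε := by gcongr
        _ = 1 := mul_inv_cancel₀ (by positivity)
    refine ⟨i, le_trans ?_ (lintegral_mono_set hsub)⟩
    rw [setLIntegral_congr_fun measurableSet_closedBall hgs, lintegral_const,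
      Measure.restrict_apply_univ, Real.volume_closedBall, ← ENNReal.ofReal_mul (by positivity),
      ← ENNReal.ofReal_natCast]
    refine ENNReal.ofReal_le_ofReal ?_
    have h1 : (2 : ℝ) ^ ((N + 2) * i) ≤ (2 ^ (N * i)) ^ p := by
      rw [← Real.rpow_natCast, ← Real.rpow_natCast, ← Real.rpow_mul zero_le_two]
      refine Real.rpow_le_rpow_of_exponent_le one_le_two ?_
      push_cast
      have : (0 : ℝ) ≤ i := by positivity
      nlinarith
    have h2 : (2 : ℝ) ^ ((N + 2) * i) * ε = 2 ^ i := by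
      rw [hε, show (N + 2) * i = (N + 1) * i + i by ring, pow_add]
      field_simp
    have h3 : (K : ℝ) ≤ 2 ^ i := by
      have : i < 2 ^ i := Nat.lt_two_pow_self
      exact_mod_cast (by omega : K ≤ 2 ^ i)
    have h4 : (0 : ℝ) < 2 ^ i := by positivity
    have h5 := mul_le_mul_of_nonneg_right h1 hε0.le
    linarith

end NowhereIntegrable

section NowhereTaylor

variable {n k : ℕ} {V W : Type*}
  [NormedAddCommGroup V] [InnerProductSpace ℝ V] [FiniteDimensional ℝ V]
  [NormedAddCommGroup W] [InnerProductSpace ℝ W] [FiniteDimensional ℝ W]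

theorem MemT.exists_setLIntegral_ne_top {F : Type*} [NormedAddCommGroup F] [NormedSpace ℝ F]
    {j : ℕ} {p : ℝ} (hp : 1 ≤ p) {f : Euc n → F} {x : Euc n} (hf : MemT n j p f x) :
    ∃ r : ℝ, 0 < r ∧ ∫⁻ y in ball x r, ‖f y‖ₑ ^ p ≠ ⊤ := by
  have hp0 : 0 < p := by linarith
  obtain ⟨P, hP, hs⟩ := hf
  obtain ⟨r, hr1, hr0 : 0 < r⟩ :=
    ((hs.eventually (gt_mem_nhds one_pos)).and self_mem_nhdsWithin).exists
  have hfin : ∫⁻ y in ball x r, ‖f y - P y‖ₑ ^ p ≠ ⊤ := fun htop => by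
    refine hr1.not_ge ?_
    beta_reduce
    have hv : (volume (ball x r))⁻¹ ≠ 0 := ENNReal.inv_ne_zero.2 measure_ball_lt_top.ne
    have h1 : ∫⁻ y in ball x r, (‖f y - P y‖₊ : ℝ≥0∞) ^ p = ⊤ := htop
    rw [h1, ENNReal.mul_top hv, ENNReal.top_rpow_of_pos (by positivity),
      ENNReal.top_div_of_ne_top ENNReal.ofReal_ne_top]
    exact le_top
  obtain ⟨C, hC⟩ := (isCompact_closedBall x r).exists_bound_of_continuousOn
    hP.1.continuous.continuousOn
  refine ⟨r, hr0, ne_top_of_le_ne_top ?_ (setLIntegral_mono' (g := fun y =>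
    2 ^ (p - 1) * (‖f y - P y‖ₑ ^ p + ENNReal.ofReal C ^ p)) measurableSet_ball fun y hy => ?_)⟩
  · rw [lintegral_const_mul' _ _ (ENNReal.rpow_ne_top_of_nonneg (by linarith) (by simp)),
      lintegral_add_right _ measurable_const, lintegral_const]
    refine ENNReal.mul_ne_top (ENNReal.rpow_ne_top_of_nonneg (by linarith) (by simp))
      (ENNReal.add_ne_top.2 ⟨hfin, ENNReal.mul_ne_top
        (ENNReal.rpow_ne_top_of_nonneg hp0.le ENNReal.ofReal_ne_top) ?_⟩)
    rw [Measure.restrict_apply_univ]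
    exact measure_ball_lt_top.ne
  · refine le_trans ?_ ((ENNReal.rpow_add_le_mul_rpow_add_rpow _ ‖P y‖ₑ hp).trans
      (mul_le_mul_right (add_le_add_right (ENNReal.rpow_le_rpow (z := p) ?_ hp0.le) _) _))
    · refine ENNReal.rpow_le_rpow ?_ hp0.le
      simpa using enorm_add_le (f y - P y) (P y)
    · rw [← ofReal_norm]
      exact ENNReal.ofReal_le_ofReal (hC y (ball_subset_closedBall hy))

theorem exists_memBVAloc_nowhere_memT {A : CoeffOp n k V W} {ξ : Euc n} (hξ : ξ ≠ 0) {v : V}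
    (hv0 : v ≠ 0) (hv : symbolMap n k A ξ v = 0) {p : ℝ} (hp : 1 < p) :
    ∃ u : Euc n → V, MemBVAloc n k A u ∧ ∀ w : Euc n → V, w =ᵐ[volume] u →
      ∀ (j : ℕ) (x : Euc n), ¬ MemT n j p w x := by
  obtain ⟨g, hg, hg0, hsum, hlarge⟩ := exists_concentrating_bumps hp
  obtain ⟨e, he⟩ := exists_inner_eq_one hξ
  have hs : ∀ R : ℝ, ∑' i, ∫⁻ x in ball (0 : Euc n) R, ‖g i ⟪ξ, x⟫‖ₑ ≠ ⊤ := fun R => by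
    refine ne_top_of_le_ne_top ?_ (ENNReal.tsum_le_tsum fun i =>
      setLIntegral_ridge_le he (H := fun t => ‖g i t‖ₑ) (hg i).continuous.measurable.enorm 0 R)
    rw [ENNReal.tsum_mul_left]
    exact ENNReal.mul_ne_top measure_ball_lt_top.ne hsum
  refine ⟨_, memBVAloc_planeWave_tsum hv hg hs, fun w hw j x hx => ?_⟩
  obtain ⟨r, hr0, hr⟩ := hx.exists_setLIntegral_ne_top hp.le
  obtain ⟨c, δ, hc, hδ, hcδ⟩ := exists_le_setLIntegral_ridge hξ x hr0
  have hG : ∀ i, Continuous fun x : Euc n => g i ⟪ξ, x⟫ := fun i =>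
    (contDiff_comp_inner (hg i) ξ).continuous
  have hvp : ‖v‖ₑ ^ p ≠ 0 := by
    rw [Ne, ENNReal.rpow_eq_zero_iff_of_pos (by linarith)]
    simpa using hv0
  have hvp' : ‖v‖ₑ ^ p ≠ ⊤ := ENNReal.rpow_ne_top_of_nonneg (by linarith) (by simp)
  have hle : ∀ i, (∫⁻ y in ball x r, ‖g i ⟪ξ, y⟫‖ₑ ^ p) * ‖v‖ₑ ^ p ≤
      ∫⁻ y in ball x r, ‖w y‖ₑ ^ p := fun i => by
    rw [← lintegral_mul_const' _ _ hvp']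
    refine lintegral_mono_ae (ae_restrict_of_ae ?_)
    filter_upwards [hw, ae_summable_of_tsum_lintegral_ball hG hs] with y hy hsy
    rw [hy, enorm_smul, ENNReal.mul_rpow_of_nonneg _ _ (by linarith)]
    gcongr
    rw [Real.enorm_of_nonneg (hg0 _ _), Real.enorm_of_nonneg (tsum_nonneg fun i => hg0 _ _)]
    exact ENNReal.ofReal_le_ofReal (hsy.le_tsum i fun i _ => hg0 _ _)
  have hK : ∀ K : ℕ, c * K * ‖v‖ₑ ^ p ≤ ∫⁻ y in ball x r, ‖w y‖ₑ ^ p := fun K => by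
    obtain ⟨i, hi⟩ := hlarge ⟪ξ, x⟫ δ hδ K
    refine le_trans ?_ (hle i)
    gcongr
    refine le_trans ?_ (hcδ (fun t => ‖g i t‖ₑ ^ p)
      ((hg i).continuous.measurable.enorm.pow_const p))
    gcongr
  obtain ⟨K, hlt⟩ := ENNReal.exists_nat_mul_gt (mul_ne_zero hc hvp) hr
  exact absurd (hK K) (not_le.2 (by rwa [mul_right_comm, mul_comm]))

end NowhereTaylor

section NoWeakDeriv

theorem iteratedDeriv_cos_sq_add_iteratedDeriv_sin_sq (m : ℕ) (t : ℝ) :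
    iteratedDeriv m Real.cos t ^ 2 + iteratedDeriv m Real.sin t ^ 2 = 1 := by
  induction m with
  | zero => simp
  | succ m ih =>
    rw [Real.iteratedDeriv_add_one_cos, Real.iteratedDeriv_add_one_sin, Pi.neg_apply, neg_sq,
      add_comm, ih]

theorem lp_one_summable_abs (c : lp (fun _ : ℕ => ℝ) 1) : Summable fun l => |c l| := by
  simpa using (lp.memℓp c).summable (by simp)

theorem exists_clm_lp_one {τ : ℕ → ℝ} {B : ℝ} (hτ : ∀ l, |τ l| ≤ B) :
    ∃ T : lp (fun _ : ℕ => ℝ) 1 →L[ℝ] ℝ, ∀ c, T c = ∑' l, c l * τ l := by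
  have hle : ∀ (c : lp (fun _ : ℕ => ℝ) 1) l, ‖c l * τ l‖ ≤ |c l| * B := fun c l => by
    rw [Real.norm_eq_abs, abs_mul]
    exact mul_le_mul_of_nonneg_left (hτ l) (abs_nonneg _)
  have hs : ∀ c : lp (fun _ : ℕ => ℝ) 1, Summable fun l => c l * τ l := fun c =>
    ((lp_one_summable_abs c).mul_right B).of_norm_bounded (hle c)
  refine ⟨LinearMap.mkContinuous
    { toFun := fun c => ∑' l, c l * τ l
      map_add' := fun c d => by
        simp only [lp.coeFn_add, Pi.add_apply, add_mul]
        exact (hs c).tsum_add (hs d)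
      map_smul' := fun r c => by
        simp only [lp.coeFn_smul, Pi.smul_apply, smul_eq_mul, mul_assoc, RingHom.id_apply]
        exact tsum_mul_left } B fun c => ?_, fun c => rfl⟩
  have hn : ‖c‖ = ∑' l, |c l| := by
    rw [lp.norm_eq_tsum_rpow (by simp)]
    simp
  rw [hn, mul_comm, ← tsum_mul_right]
  exact tsum_of_norm_bounded ((lp_one_summable_abs c).mul_right B).hasSum (hle c)

variable {n k : ℕ} {V W : Type*}
  [NormedAddCommGroup V] [InnerProductSpace ℝ V] [FiniteDimensional ℝ V]
  [NormedAddCommGroup W] [InnerProductSpace ℝ W] [FiniteDimensional ℝ W]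

theorem exists_bound_integral_sq_iteratedDeriv {A : CoeffOp n k V W} {ξ : Euc n} {v : V}
    (hv0 : v ≠ 0) (hv : symbolMap n k A ξ v = 0) {m : ℕ}
    (hA : ∀ u : Euc n → V, MemBVAloc n k A u →
      ∃ w : (Fin m → Fin n) → Euc n → V, IsWeakDerivFamily n m u w)
    {F : ℝ → ℝ} (hF : ContDiff ℝ (⊤ : ℕ∞) F) (hb : ∀ l t, |iteratedDeriv l F t| ≤ 1)
    (q : Fin n) :
    ∃ C : ℝ, ∀ i : ℕ, (((i : ℝ) + 1) * |ξ q|) ^ m *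
      ∫ x, lowBump n x * iteratedDeriv m F (((i : ℝ) + 1) * ⟪ξ, x⟫) ^ 2 ≤ C := by
  set I : Fin m → Fin n := fun _ => q with hI
  have hFm : ContDiff ℝ (⊤ : ℕ∞) (iteratedDeriv m F) := by
    rw [iteratedDeriv_eq_iterate]
    exact hF.iterate_deriv m
  have hscale : ∀ {G : ℝ → ℝ} (_ : ContDiff ℝ (⊤ : ℕ∞) G) (i : ℕ),
      ContDiff ℝ (⊤ : ℕ∞) fun t => G (((i : ℝ) + 1) * t) := fun hG i =>
    hG.comp (contDiff_const.mul contDiff_id)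
  set φ : ℕ → Euc n → ℝ := fun i x =>
    lowBump n x * iteratedDeriv m F (((i : ℝ) + 1) * ⟪ξ, x⟫) with hφ
  have hφt : ∀ i, IsTestFun n (φ i) := fun i =>
    ⟨(lowBump n).contDiff.mul (contDiff_comp_inner (hscale hFm i) ξ),
      (lowBump n).hasCompactSupport.mul_right⟩
  have hφle : ∀ i x, |φ i x| ≤ lowBump n x := fun i x => by
    rw [hφ, abs_mul, abs_of_nonneg (lowBump n).nonneg]
    exact mul_le_of_le_one_right (lowBump n).nonneg (hb _ _)
  have hwave : ∀ l : ℕ, ContDiff ℝ (⊤ : ℕ∞) fun x : Euc n => F (((l : ℝ) + 1) * ⟪ξ, x⟫) :=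
    fun l => contDiff_comp_inner (hscale hF l) ξ
  set τ : ℕ → ℕ → ℝ := fun i l =>
    ∫ x, F (((l : ℝ) + 1) * ⟪ξ, x⟫) * dirDeriv n m I (φ i) x with hτ
  have hF1 : ∀ t, |F t| ≤ 1 := fun t => by simpa using hb 0 t
  have hτb : ∀ i l, |τ i l| ≤ ∫ x, |dirDeriv n m I (φ i) x| := fun i l => by
    have hi : Integrable (dirDeriv n m I (φ i)) :=
      ((hφt i).dirDeriv I).1.continuous.integrable_of_hasCompactSupport ((hφt i).dirDeriv I).2
    rw [← Real.norm_eq_abs]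
    refine norm_integral_le_of_norm_le hi.abs (Eventually.of_forall fun x => ?_)
    rw [Real.norm_eq_abs, abs_mul]
    exact mul_le_of_le_one_left (abs_nonneg _) (hF1 _)
  choose T hT using fun i => exists_clm_lp_one (hτb i)
  have hpt : ∀ c : lp (fun _ : ℕ => ℝ) 1, ∃ C, ∀ i, ‖T i c‖ ≤ C := fun c => by
    have hg : ∀ l : ℕ, ContDiff ℝ (⊤ : ℕ∞) fun t => c l * F (((l : ℝ) + 1) * t) := fun l =>
      contDiff_const.mul (hscale hF l)
    have hG : ∀ l : ℕ, Continuous fun x : Euc n => c l * F (((l : ℝ) + 1) * ⟪ξ, x⟫) := fun l =>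
      continuous_const.mul (hwave l).continuous
    have hs : ∀ R : ℝ, ∑' l : ℕ, ∫⁻ x in ball (0 : Euc n) R,
        ‖c l * F (((l : ℝ) + 1) * ⟪ξ, x⟫)‖ₑ ≠ ⊤ := fun R => by
      refine ne_top_of_le_ne_top ?_ (ENNReal.tsum_le_tsum fun l =>
        (lintegral_mono (g := fun _ => ‖c l‖ₑ) fun x => ?_))
      · simp_rw [lintegral_const]
        rw [ENNReal.tsum_mul_right, Measure.restrict_apply_univ]
        refine ENNReal.mul_ne_top ?_ measure_ball_lt_top.ne
        simp_rw [← ofReal_norm, Real.norm_eq_abs]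
        exact (lp_one_summable_abs c).tsum_ofReal_ne_top
      · rw [enorm_mul]
        refine mul_le_of_le_one_right (zero_le) ?_
        rw [← ofReal_norm, ENNReal.ofReal_le_one]
        exact hF1 _
    obtain ⟨w, hw, hwI⟩ := hA _ (memBVAloc_planeWave_tsum hv hg hs)
    refine ⟨(∫ x, lowBump n x * ‖w I x‖) / ‖v‖, fun i => ?_⟩
    rw [le_div_iff₀ (norm_pos_iff.2 hv0), ← norm_smul]
    have hTc : T i c = ∫ x, (∑' l : ℕ, c l * F (((l : ℝ) + 1) * ⟪ξ, x⟫)) *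
        dirDeriv n m I (φ i) x := by
      rw [hT, integral_tsum_mul_of_tsum_lintegral_ball hG hs
        ((hφt i).dirDeriv I).1.continuous ((hφt i).dirDeriv I).2]
      simp_rw [mul_assoc, integral_const_mul, hτ]
    have hv' := hwI I (φ i) (hφt i)
    simp_rw [smul_smul, integral_smul_const] at hv'
    rw [hTc]
    simp_rw [mul_comm _ (dirDeriv n m I (φ i) _)]
    rw [hv', norm_smul, norm_pow, norm_neg, norm_one, one_pow, one_mul]
    refine norm_integral_le_of_norm_le ((isTestFun_lowBump n).integrable_mul
      (fun x => (hw I x).norm))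
      (Eventually.of_forall fun x => ?_)
    rw [norm_smul]
    exact mul_le_mul_of_nonneg_right (hφle i x) (norm_nonneg _)
  obtain ⟨C, hC⟩ := banach_steinhaus hpt
  refine ⟨C, fun i => ?_⟩
  have h1 : |τ i i| ≤ C := by
    have h2 := (T i).le_of_opNorm_le (hC i) (lp.single 1 i (1 : ℝ))
    rw [lp.norm_single (by simp), norm_one, mul_one, hT, tsum_eq_single i fun l hl => by
      rw [lp.single_apply_ne _ _ _ hl, zero_mul], lp.single_apply_self, one_mul] at h2
    exact h2
  refine le_trans (le_of_eq ?_) h1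
  have h3 : τ i i = (-1) ^ m * ((((i : ℝ) + 1) * ξ q) ^ m *
      ∫ x, lowBump n x * iteratedDeriv m F (((i : ℝ) + 1) * ⟪ξ, x⟫) ^ 2) := by
    simp_rw [hτ, mul_comm (F _)]
    rw [integral_dirDeriv_mul (hwave i) (hφt i)]
    congr 1
    rw [← integral_const_mul]
    refine integral_congr_ae (Eventually.of_forall fun x => ?_)
    beta_reduce
    rw [dirDeriv_comp_inner (g := fun t => F (((i : ℝ) + 1) * t)) (hscale hF i),
      iteratedDeriv_comp_const_mul (hF.of_le (by exact_mod_cast le_top))]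
    simp only [hφ, hI, Finset.prod_const, Finset.card_univ, Fintype.card_fin, mul_pow]
    ring
  have h0 : 0 ≤ ∫ x, lowBump n x * iteratedDeriv m F (((i : ℝ) + 1) * ⟪ξ, x⟫) ^ 2 :=
    integral_nonneg fun x => mul_nonneg (lowBump n).nonneg (sq_nonneg _)
  rw [h3, abs_mul, abs_mul, abs_pow, abs_pow, abs_neg, abs_one, one_pow, one_mul,
    abs_of_nonneg h0, abs_mul, abs_of_nonneg (by positivity : (0 : ℝ) ≤ (i : ℝ) + 1)]

theorem exists_memBVAloc_forall_not_isWeakDerivFamily {A : CoeffOp n k V W} {ξ : Euc n}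
    (hξ : ξ ≠ 0) {v : V} (hv0 : v ≠ 0) (hv : symbolMap n k A ξ v = 0) {m : ℕ} (hm : m ≠ 0) :
    ∃ u : Euc n → V, MemBVAloc n k A u ∧
      ∀ w : (Fin m → Fin n) → Euc n → V, ¬ IsWeakDerivFamily n m u w := by
  by_contra! hA
  obtain ⟨q, hq⟩ : ∃ q, ξ q ≠ 0 := by
    by_contra! h
    exact hξ (by ext q; simpa using h q)
  obtain ⟨C, hC⟩ := exists_bound_integral_sq_iteratedDeriv hv0 hv hA Real.contDiff_cos
    Real.abs_iteratedDeriv_cos_le_one q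
  obtain ⟨D, hD⟩ := exists_bound_integral_sq_iteratedDeriv hv0 hv hA Real.contDiff_sin
    Real.abs_iteratedDeriv_sin_le_one q
  have hpos : 0 < ∫ x, lowBump n x := (lowBump n).integral_pos
  have hint : ∀ {F : ℝ → ℝ} (_ : ContDiff ℝ (⊤ : ℕ∞) F) (i : ℕ), Integrable fun x : Euc n =>
      lowBump n x * iteratedDeriv m F (((i : ℝ) + 1) * ⟪ξ, x⟫) ^ 2 := fun {F} hF i => by
    have hFm : Continuous (iteratedDeriv m F) :=
      hF.continuous_iteratedDeriv m (by exact_mod_cast le_top)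
    exact Continuous.integrable_of_hasCompactSupport
      ((lowBump n).continuous.mul ((hFm.comp (by fun_prop)).pow 2))
      (lowBump n).hasCompactSupport.mul_right
  have hle : ∀ i : ℕ, (((i : ℝ) + 1) * |ξ q|) ^ m * ∫ x, lowBump n x ≤ C + D := fun i => by
    refine le_trans (le_of_eq ?_) (add_le_add (hC i) (hD i))
    rw [← mul_add, ← integral_add (hint Real.contDiff_cos i) (hint Real.contDiff_sin i)]
    simp_rw [← mul_add, iteratedDeriv_cos_sq_add_iteratedDeriv_sin_sq, mul_one]
  have htend : Tendsto (fun i : ℕ => (((i : ℝ) + 1) * |ξ q|) ^ m * ∫ x, lowBump n x) atTop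
      atTop :=
    ((tendsto_pow_atTop hm).comp ((tendsto_atTop_add_const_right _ 1
      tendsto_natCast_atTop_atTop).atTop_mul_const (abs_pos.2 hq))).atTop_mul_const hpos
  obtain ⟨i, hi⟩ := (htend.eventually_gt_atTop (C + D)).exists
  exact absurd (hle i) hi.not_ge

end NoWeakDeriv

section Converse

variable {n k : ℕ} {V W : Type*}
  [NormedAddCommGroup V] [InnerProductSpace ℝ V] [FiniteDimensional ℝ V]
  [NormedAddCommGroup W] [InnerProductSpace ℝ W] [FiniteDimensional ℝ W]

theorem IsWeakDerivFamily.ae_eq_of_zero {u : Euc n → V} {v : (Fin 0 → Fin n) → Euc n → V}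
    (hu : LocallyIntegrable u) (h : IsWeakDerivFamily n 0 u v) (I : Fin 0 → Fin n) :
    v I =ᵐ[volume] u := by
  refine ae_eq_of_integral_contDiff_smul_eq (h.1 I) hu fun g hg hgc => ?_
  have := h.2 I g ⟨hg, hgc⟩
  rw [dirDeriv_zero] at this
  simpa using this.symm

theorem isElliptic_of_forall_exists_isWeakDerivFamily_memT {A : CoeffOp n k V W} {m j : ℕ} {p : ℝ}
    (hp : 1 < p) (h : ∀ u : Euc n → V, MemBVAloc n k A u →
      ∃ v : (Fin m → Fin n) → Euc n → V, IsWeakDerivFamily n m u v ∧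
        ∀ᵐ x ∂(volume : Measure (Euc n)), ∀ I, MemT n j p (v I) x) :
    IsElliptic n k A := by
  intro ξ hξ
  rw [injective_iff_map_eq_zero]
  intro v hv
  by_contra hv0
  obtain rfl | hm := eq_or_ne m 0
  · obtain ⟨u, hu, hnot⟩ := exists_memBVAloc_nowhere_memT hξ hv0 hv hp
    obtain ⟨w, hw, hT⟩ := h u hu
    obtain ⟨x, hx⟩ := hT.exists
    exact hnot _ (hw.ae_eq_of_zero hu.1 Fin.elim0) j x (hx Fin.elim0)
  · obtain ⟨u, hu, hnot⟩ := exists_memBVAloc_forall_not_isWeakDerivFamily hξ hv0 hv hm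
    obtain ⟨w, hw, -⟩ := h u hu
    exact hnot w hw

end Converse

/-- Theorem 1.4(1): for `1 ≤ j ≤ min{k, n-1}` and `1 < p < n/(n-j)`,
`𝒜` is elliptic iff `D^{k-j} u ∈ t^{j,p}(x)` a.e. for every `u ∈ BV^𝒜_loc`. -/
theorem statement5 (n k j : ℕ) (p : ℝ) {V W : Type*}
    [NormedAddCommGroup V] [InnerProductSpace ℝ V] [FiniteDimensional ℝ V]
    [NormedAddCommGroup W] [InnerProductSpace ℝ W] [FiniteDimensional ℝ W]
    (A : CoeffOp n k V W) (hA : IsSymmetricOp n k A)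
    (hj1 : 1 ≤ j) (hjk : j ≤ k) (hjn : j < n)
    (hp1 : 1 < p) (hp2 : p * ((n : ℝ) - (j : ℝ)) < n) :
    IsElliptic n k A ↔
      ∀ u : Euc n → V, MemBVAloc n k A u →
        ∃ v : (Fin (k - j) → Fin n) → Euc n → V, IsWeakDerivFamily n (k - j) u v ∧
          ∀ᵐ x ∂(volume : Measure (Euc n)), ∀ I, MemT n j p (v I) x :=
  ⟨fun hE _ hu => hu.exists_weakDeriv hE hj1 hjk hjn hp1.le hp2,
    isElliptic_of_forall_exists_isWeakDerivFamily_memT hp1⟩
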